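/- arXiv:2109.07098 — 3 statements merged into one kernel-verified Lean document; each statement's English description precedes it below -/
import Mathlib

section
/- The function E_min : ℝ₊ → ℝ, 𝔭 ↦ E_min(𝔭), is concave, nondecreasing, and √2-Lipschitz continuous; moreover there exists a constant K ≥ 0 such that E_min(𝔭) ≤ 2π ln 𝔭 + K for every 𝔭 ≥ 1. -/
open MeasureTheory Filter Metric

noncomputable section

/-- First partial derivative (direction `x₁`), identifying `ℝ²` with `ℂ`. -/
def pd1 (u : ℂ → ℂ) (z : ℂ) : ℂ := fderiv ℝ u z 1

/-- Second partial derivative (direction `x₂`). -/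
def pd2 (u : ℂ → ℂ) (z : ℂ) : ℂ := fderiv ℝ u z Complex.I

/-- Laplacian `Δu`. -/
def lap (u : ℂ → ℂ) (z : ℂ) : ℂ := fderiv ℝ (pd1 u) z 1 + fderiv ℝ (pd2 u) z Complex.I

/-- `|∇u|²`. -/
def gradSq (u : ℂ → ℂ) (z : ℂ) : ℝ := ‖pd1 u z‖ ^ 2 + ‖pd2 u z‖ ^ 2

/-- Ginzburg–Landau energy density. -/
def energyDensity (u : ℂ → ℂ) (z : ℂ) : ℝ :=
  (1 / 2) * gradSq u z + (1 / 4) * (1 - ‖u z‖ ^ 2) ^ 2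

/-- Ginzburg–Landau energy, valued in `[0,∞]`. -/
def energy (u : ℂ → ℂ) : ENNReal := ∫⁻ z : ℂ, ENNReal.ofReal (energyDensity u z)

/-- `E(u)`, real valued. -/
def Efun (u : ℂ → ℂ) : ℝ := (energy u).toReal

/-- The energy space `ℰ`: (smooth) maps with finite Ginzburg–Landau energy. -/
def memE (u : ℂ → ℂ) : Prop := ContDiff ℝ (⊤ : ℕ∞) u ∧ energy u < ⊤

/-- Momentum density `Re(i ∂₂u (conj u − 1))`. -/
def momDensity (u : ℂ → ℂ) (z : ℂ) : ℝ :=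
  (Complex.I * pd2 u z * ((starRingEnd ℂ) (u z) - 1)).re

/-- Integrability of the momentum density. -/
def momInt (u : ℂ → ℂ) : Prop := Integrable (momDensity u)

/-- The momentum `P₂(u)`. -/
def P2 (u : ℂ → ℂ) : ℝ := (1 / 2) * ∫ z : ℂ, momDensity u z

/-- `(TW_c)(u) = 0`: the travelling wave equation `−ic∂₂u − Δu − (1−|u|²)u = 0`. -/
def TW (c : ℝ) (u : ℂ → ℂ) : Prop :=
  ∀ z : ℂ, -(Complex.I * (c : ℂ) * pd2 u z) - lap u z - ((1 - ‖u z‖ ^ 2 : ℝ) : ℂ) * u z = 0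

/-- `E_min(p)`. -/
def Emin (p : ℝ) : ℝ := sInf (Efun '' {u : ℂ → ℂ | memE u ∧ P2 u = p})

/-- Evenness in `x₁`: `u(−x₁, x₂) = u(x₁, x₂)`. -/
def evenX1 (u : ℂ → ℂ) : Prop := ∀ z : ℂ, u (-((starRingEnd ℂ) z)) = u z

/-- Quasi-minimizer hypotheses (with symmetry), momentum `p` and speed `c`. -/
def QuasiMin (Λ₀ : ℝ) (u : ℂ → ℂ) (p c : ℝ) : Prop :=
  memE u ∧ evenX1 u ∧ 0 < c ∧ TW c u ∧ momInt u ∧ P2 u = p ∧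
  Efun u ≤ 2 * Real.pi * Real.log p + Λ₀

/-- `V1` is the degree-one vortex with (increasing) modulus profile `ρ`. -/
def IsVortex (V1 : ℂ → ℂ) (ρ : ℝ → ℝ) : Prop :=
  ContDiff ℝ (⊤ : ℕ∞) V1 ∧
  (∀ z : ℂ, lap V1 z + V1 z * ((1 - ‖V1 z‖ ^ 2 : ℝ) : ℂ) = 0) ∧
  V1 0 = 0 ∧
  (∀ z : ℂ, z ≠ 0 → V1 z = ((ρ ‖z‖ : ℝ) : ℂ) * (z / (‖z‖ : ℂ))) ∧
  ρ 0 = 0 ∧ StrictMonoOn ρ (Set.Ici 0) ∧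
  (∀ r : ℝ, 0 ≤ r → 0 ≤ ρ r ∧ ρ r < 1) ∧
  Filter.Tendsto ρ Filter.atTop (nhds 1)

/-- The map `x₁ + i x₂ ↦ k(x₁) + i x₂`. -/
def shear (k : ℝ → ℝ) (z : ℂ) : ℂ := ⟨k z.re, z.im⟩

lemma shear_eq (k : ℝ → ℝ) : shear k = fun z : ℂ => (k z.re : ℂ) + (z.im : ℂ) * Complex.I := by
  funext z
  apply Complex.ext <;> simp [shear]

lemma contDiff_shear {k : ℝ → ℝ} (hk : ContDiff ℝ (⊤ : ℕ∞) k) :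
    ContDiff ℝ (⊤ : ℕ∞) (shear k) := by
  rw [shear_eq]
  have h1 : ContDiff ℝ (⊤ : ℕ∞) (fun z : ℂ => (z.re : ℝ)) := Complex.reCLM.contDiff
  have h2 : ContDiff ℝ (⊤ : ℕ∞) (fun z : ℂ => ((k z.re : ℝ) : ℂ)) :=
    Complex.ofRealCLM.contDiff.comp (hk.comp h1)
  have h3 : ContDiff ℝ (⊤ : ℕ∞) (fun z : ℂ => ((z.im : ℝ) : ℂ)) :=
    Complex.ofRealCLM.contDiff.comp Complex.imCLM.contDiff
  exact h2.add (h3.mul contDiff_const)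

lemma hasDerivAt_mk_re {k : ℝ → ℝ} {k' x : ℝ} (hk : HasDerivAt k k' x) (y : ℝ) :
    HasDerivAt (fun t : ℝ => (⟨k t, y⟩ : ℂ)) (k' : ℂ) x := by
  have : (fun t : ℝ => (⟨k t, y⟩ : ℂ)) = fun t => (k t : ℂ) + (y : ℂ) * Complex.I := by
    funext t
    apply Complex.ext <;> simp
  rw [this]
  exact hk.ofReal_comp.add_const _

lemma hasDerivAt_mk_im (x y : ℝ) :
    HasDerivAt (fun t : ℝ => (⟨x, t⟩ : ℂ)) Complex.I y := by
  have : (fun t : ℝ => (⟨x, t⟩ : ℂ)) = fun t : ℝ => (x : ℂ) + (t : ℂ) * Complex.I := by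
    funext t
    apply Complex.ext <;> simp
  rw [this]
  simpa using ((hasDerivAt_id y).ofReal_comp.mul_const Complex.I).const_add (x : ℂ)

lemma pd1_eq {u : ℂ → ℂ} {z d : ℂ} (hu : DifferentiableAt ℝ u z)
    (h : HasDerivAt (fun t : ℝ => u ⟨t, z.im⟩) d z.re) : pd1 u z = d := by
  have h1 := hasDerivAt_mk_re (hasDerivAt_id z.re) z.im
  have h2 : HasDerivAt (fun t : ℝ => u ⟨t, z.im⟩) (fderiv ℝ u z ((1 : ℝ) : ℂ)) z.re :=
    HasFDerivAt.comp_hasDerivAt (x := z.re) (f := fun t : ℝ => (⟨t, z.im⟩ : ℂ))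
      hu.hasFDerivAt h1
  rw [← h2.unique h]
  simp [pd1]

lemma hasDerivAt_pd2 {u : ℂ → ℂ} (hu : Differentiable ℝ u) (x y : ℝ) :
    HasDerivAt (fun t : ℝ => u ⟨x, t⟩) (pd2 u ⟨x, y⟩) y :=
  HasFDerivAt.comp_hasDerivAt (x := y) (f := fun t : ℝ => (⟨x, t⟩ : ℂ))
    (hu ⟨x, y⟩).hasFDerivAt (hasDerivAt_mk_im x y)

lemma pd2_eq {u : ℂ → ℂ} {z d : ℂ} (hu : Differentiable ℝ u)
    (h : HasDerivAt (fun t : ℝ => u ⟨z.re, t⟩) d z.im) : pd2 u z = d :=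
  (hasDerivAt_pd2 hu z.re z.im).unique h

lemma pd1_comp_shear {u : ℂ → ℂ} {k : ℝ → ℝ} {k' : ℝ} {z : ℂ} (hu : Differentiable ℝ u)
    (hus : Differentiable ℝ (u ∘ shear k)) (hk : HasDerivAt k k' z.re) :
    pd1 (u ∘ shear k) z = k' * pd1 u (shear k z) := by
  refine pd1_eq (hus z) ?_
  have h2 := HasFDerivAt.comp_hasDerivAt (x := z.re) (f := fun t : ℝ => (⟨k t, z.im⟩ : ℂ))
    (hu (shear k z)).hasFDerivAt (hasDerivAt_mk_re hk z.im)
  have h3 : fderiv ℝ u (shear k z) (k' : ℂ) = k' * pd1 u (shear k z) := by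
    have : (k' : ℂ) = k' • (1 : ℂ) := by simp
    rw [this, map_smul]
    simp [pd1]
  rw [h3] at h2
  exact h2

lemma pd2_comp_shear {u : ℂ → ℂ} {k : ℝ → ℝ} {z : ℂ} (hu : Differentiable ℝ u)
    (hus : Differentiable ℝ (u ∘ shear k)) :
    pd2 (u ∘ shear k) z = pd2 u (shear k z) := by
  refine pd2_eq hus ?_
  exact hasDerivAt_pd2 hu (k z.re) z.im

lemma gradSq_nonneg (u : ℂ → ℂ) (z : ℂ) : 0 ≤ gradSq u z := by
  unfold gradSq; positivity

lemma energyDensity_nonneg (u : ℂ → ℂ) (z : ℂ) : 0 ≤ energyDensity u z := by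
  unfold energyDensity
  have := gradSq_nonneg u z
  positivity

lemma energyDensity_comp_shear_le {u : ℂ → ℂ} {k : ℝ → ℝ} {k' K : ℝ} {z : ℂ}
    (hu : Differentiable ℝ u) (hus : Differentiable ℝ (u ∘ shear k))
    (hk : HasDerivAt k k' z.re) (h1 : k' ^ 2 ≤ K) (hK : 1 ≤ K) :
    energyDensity (u ∘ shear k) z ≤ K * energyDensity u (shear k z) := by
  unfold energyDensity gradSq
  rw [pd1_comp_shear hu hus hk, pd2_comp_shear hu hus, norm_mul, mul_pow]
  have h2 : ‖(k' : ℂ)‖ ^ 2 ≤ K := by simpa using h1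
  simp only [Function.comp]
  have h3 := mul_le_mul_of_nonneg_right h2 (sq_nonneg ‖pd1 u (shear k z)‖)
  have h4 := mul_le_mul_of_nonneg_right hK (sq_nonneg ‖pd2 u (shear k z)‖)
  have h5 := mul_le_mul_of_nonneg_right hK (sq_nonneg (1 - ‖u (shear k z)‖ ^ 2))
  linarith

lemma momDensity_comp_shear {u : ℂ → ℂ} {k : ℝ → ℝ} {z : ℂ}
    (hu : Differentiable ℝ u) (hus : Differentiable ℝ (u ∘ shear k)) :
    momDensity (u ∘ shear k) z = momDensity u (shear k z) := by
  unfold momDensity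
  rw [pd2_comp_shear hu hus]
  rfl

lemma measurable_shear {k : ℝ → ℝ} (hk : Measurable k) : Measurable (shear k) := by
  rw [shear_eq]
  fun_prop

lemma map_shear {k : ℝ → ℝ} (hk : Measurable k) {c : ENNReal}
    (h : Measure.map k volume = c • volume) :
    Measure.map (shear k) volume = c • volume := by
  have e := Complex.volume_preserving_equiv_real_prod
  have h1 : shear k = Complex.measurableEquivRealProd.symm ∘ (Prod.map k id) ∘
      Complex.measurableEquivRealProd := by
    funext z
    apply Complex.ext <;> simp [shear, Complex.measurableEquivRealProd]
  have hm : Measurable (Prod.map k (id : ℝ → ℝ)) := hk.prodMap measurable_id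
  rw [h1, ← Measure.map_map (Complex.measurableEquivRealProd.symm.measurable)
    (hm.comp Complex.measurableEquivRealProd.measurable),
    ← Measure.map_map hm Complex.measurableEquivRealProd.measurable, e.map_eq,
    Measure.volume_eq_prod, ← Measure.map_prod_map _ _ hk measurable_id, h, Measure.map_id,
    Measure.prod_smul_left, Measure.map_smul, ← Measure.volume_eq_prod,
    (e.symm _).map_eq]

lemma continuous_pd1 {u : ℂ → ℂ} (hu : ContDiff ℝ (⊤ : ℕ∞) u) : Continuous (pd1 u) :=
  (hu.continuous_fderiv (by simp)).clm_apply continuous_const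

lemma continuous_pd2 {u : ℂ → ℂ} (hu : ContDiff ℝ (⊤ : ℕ∞) u) : Continuous (pd2 u) :=
  (hu.continuous_fderiv (by simp)).clm_apply continuous_const

lemma continuous_energyDensity {u : ℂ → ℂ} (hu : ContDiff ℝ (⊤ : ℕ∞) u) :
    Continuous (energyDensity u) := by
  have h1 := continuous_pd1 hu
  have h2 := continuous_pd2 hu
  have h3 := hu.continuous
  unfold energyDensity gradSq
  fun_prop

lemma continuous_momDensity {u : ℂ → ℂ} (hu : ContDiff ℝ (⊤ : ℕ∞) u) :
    Continuous (momDensity u) := by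
  have h2 := continuous_pd2 hu
  have h3 := hu.continuous
  unfold momDensity
  exact Complex.continuous_re.comp ((continuous_const.mul h2).mul
    ((Complex.continuous_conj.comp h3).sub continuous_const))

lemma Efun_nonneg (u : ℂ → ℂ) : 0 ≤ Efun u := ENNReal.toReal_nonneg

lemma Emin_le {u : ℂ → ℂ} (hu : memE u) : Emin (P2 u) ≤ Efun u :=
  csInf_le ⟨0, by rintro _ ⟨v, -, rfl⟩; exact Efun_nonneg v⟩ ⟨u, ⟨hu, rfl⟩, rfl⟩

lemma Emin_nonneg (p : ℝ) : 0 ≤ Emin p :=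
  Real.sInf_nonneg (by rintro _ ⟨v, -, rfl⟩; exact Efun_nonneg v)

lemma Emin_zero : Emin 0 = 0 := by
  refine le_antisymm ?_ (Emin_nonneg 0)
  have h1 : ∀ z, pd1 (fun _ => 1) z = 0 := by intro z; simp [pd1]
  have h2 : ∀ z, pd2 (fun _ => 1) z = 0 := by intro z; simp [pd2]
  have hE : energy (fun _ => 1) = 0 := by simp [energy, energyDensity, gradSq, h1, h2]
  have hP : P2 (fun _ => 1) = 0 := by simp [P2, momDensity]
  have := Emin_le (u := fun _ => 1) ⟨contDiff_const, by simp [hE]⟩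
  rw [hP] at this
  simpa [Efun, hE] using this

lemma momInt_of_P2_ne {u : ℂ → ℂ} (h : P2 u ≠ 0) : momInt u := by
  by_contra h1
  exact h (by rw [P2, integral_undef h1, mul_zero])

/-- Stretching in the first variable. -/
lemma exists_stretch {v : ℂ → ℂ} (hv : memE v) {l : ℝ} (hl : 0 < l) :
    ∃ w, memE w ∧ P2 w = l⁻¹ * P2 v ∧ Efun w ≤ max l l⁻¹ * Efun v := by
  set k : ℝ → ℝ := fun x => l * x with hk
  have hkd : ContDiff ℝ (⊤ : ℕ∞) k := contDiff_const.mul contDiff_id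
  have hmap : Measure.map (shear k) volume = ENNReal.ofReal |l⁻¹| • volume :=
    map_shear (by fun_prop) (Real.map_volume_mul_left hl.ne')
  have hm : Measurable (shear k) := measurable_shear (by fun_prop)
  have hw : ContDiff ℝ (⊤ : ℕ∞) (v ∘ shear k) := hv.1.comp (contDiff_shear hkd)
  have hvd := hv.1.differentiable (by simp)
  have hwd := hw.differentiable (by simp)
  have hP : P2 (v ∘ shear k) = l⁻¹ * P2 v := by
    unfold P2
    simp_rw [momDensity_comp_shear hvd hwd]
    rw [← integral_map hm.aemeasurable (f := momDensity v), hmap, integral_smul_measure,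
      ENNReal.toReal_ofReal (abs_nonneg _), abs_of_pos (inv_pos.2 hl), smul_eq_mul]
    · ring
    · exact (continuous_momDensity hv.1).aestronglyMeasurable
  have hE : energy (v ∘ shear k) ≤ ENNReal.ofReal (max l l⁻¹) * energy v := by
    have h1 : ∀ z, ENNReal.ofReal (energyDensity (v ∘ shear k) z) ≤
        ENNReal.ofReal (max (l ^ 2) 1) * ENNReal.ofReal (energyDensity v (shear k z)) := by
      intro z
      rw [← ENNReal.ofReal_mul (by positivity)]
      apply ENNReal.ofReal_le_ofReal
      refine energyDensity_comp_shear_le hvd hwd (k' := l) ?_ (le_max_left _ _) (le_max_right _ _)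
      simpa using (hasDerivAt_id z.re).const_mul l
    have hme : Measurable (fun z => ENNReal.ofReal (energyDensity v z)) :=
      (continuous_energyDensity hv.1).measurable.ennreal_ofReal
    calc energy (v ∘ shear k) ≤ ∫⁻ z, ENNReal.ofReal (max (l ^ 2) 1) *
          ENNReal.ofReal (energyDensity v (shear k z)) := lintegral_mono h1
      _ = ENNReal.ofReal (max (l ^ 2) 1) * (ENNReal.ofReal l⁻¹ * energy v) := by
          have h2 := lintegral_map (μ := volume) hme hm
          rw [hmap, lintegral_smul_measure, abs_of_pos (inv_pos.2 hl)] at h2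
          have hme' : Measurable (fun z => ENNReal.ofReal (energyDensity v (shear k z))) :=
            hme.comp hm
          rw [lintegral_const_mul _ hme', ← h2]
          rfl
      _ = ENNReal.ofReal (max l l⁻¹) * energy v := by
          rw [← mul_assoc, ← ENNReal.ofReal_mul (by positivity)]
          congr 2
          rw [max_mul_of_nonneg _ _ (inv_pos.2 hl).le]
          congr 1 <;> field_simp
  have hfin : ENNReal.ofReal (max l l⁻¹) * energy v < ⊤ :=
    ENNReal.mul_lt_top ENNReal.ofReal_lt_top hv.2
  refine ⟨_, ⟨hw, hE.trans_lt hfin⟩, hP, ?_⟩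
  unfold Efun
  refine (ENNReal.toReal_mono hfin.ne hE).trans_eq ?_
  rw [ENNReal.toReal_mul, ENNReal.toReal_ofReal (by positivity)]

lemma Emin_stretch {v : ℂ → ℂ} (hv : memE v) {l : ℝ} (hl : 0 < l) :
    Emin (l⁻¹ * P2 v) ≤ max l l⁻¹ * Efun v := by
  obtain ⟨w, hw, hP, hE⟩ := exists_stretch hv hl
  rw [← hP]
  exact (Emin_le hw).trans hE

lemma Emin_le_of_near {p : ℝ} (hp : 0 ≤ p) {ε : ℝ} (hε : 0 < ε) :
    ∃ η > 0, ∀ v, memE v → |P2 v - p| < η → Emin p ≤ (1 + ε) * Efun v := by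
  rcases hp.eq_or_lt with rfl | hp
  · refine ⟨1, one_pos, fun v _ _ => ?_⟩
    rw [Emin_zero]
    exact mul_nonneg (by positivity) (Efun_nonneg v)
  · refine ⟨p * (ε / (1 + ε)), by positivity, fun v hv hvp => ?_⟩
    rw [abs_lt] at hvp
    have h1 : p - p * (ε / (1 + ε)) = p / (1 + ε) := by field_simp; ring
    have h1' : p + p * (ε / (1 + ε)) ≤ p * (1 + ε) := by
      have : ε / (1 + ε) ≤ ε := div_le_self hε.le (by linarith)
      nlinarith
    have h2 : p / (1 + ε) < P2 v := by linarith [hvp.1]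
    have h3 : P2 v ≤ p * (1 + ε) := by linarith [hvp.2]
    have h0 : 0 < P2 v := lt_trans (by positivity) h2
    have := Emin_stretch hv (l := P2 v / p) (by positivity)
    have h4 : (P2 v / p)⁻¹ * P2 v = p := by field_simp
    rw [h4] at this
    refine this.trans (mul_le_mul_of_nonneg_right ?_ (Efun_nonneg v))
    apply max_le
    · rw [div_le_iff₀ hp]; linarith
    · rw [inv_div, div_le_iff₀ h0]
      rw [div_lt_iff₀ (by positivity)] at h2
      linarith

lemma exists_smooth_abs : ∃ C : ℝ, 1 ≤ C ∧ ∀ δ : ℝ, 0 < δ → ∃ h : ℝ → ℝ,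
    ContDiff ℝ (⊤ : ℕ∞) h ∧ (∀ t, δ ≤ |t| → h t = |t|) ∧ (∀ t, deriv h t ^ 2 ≤ C) := by
  set f : ℝ → ℝ := fun t => t * (2 * Real.smoothTransition ((t + 1) / 2) - 1) with hf
  have hfd : ContDiff ℝ (⊤ : ℕ∞) f := by
    have : ContDiff ℝ (⊤ : ℕ∞) (fun t : ℝ => Real.smoothTransition ((t + 1) / 2)) :=
      Real.smoothTransition.contDiff.comp (by fun_prop)
    exact contDiff_id.mul ((contDiff_const.mul this).sub contDiff_const)
  have hf1 : ∀ t, 1 ≤ t → f t = t := by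
    intro t ht
    simp only [hf]
    rw [Real.smoothTransition.one_of_one_le (by linarith)]; ring
  have hf2 : ∀ t, t ≤ -1 → f t = -t := by
    intro t ht
    simp only [hf]
    rw [Real.smoothTransition.zero_of_nonpos (by linarith)]; ring
  have hc : Continuous (deriv f) := hfd.continuous_deriv (by simp)
  obtain ⟨B, hB⟩ := isCompact_Icc.exists_bound_of_continuousOn (s := Set.Icc (-1 : ℝ) 1)
    (hc.pow 2).continuousOn
  have hbd : ∀ t, deriv f t ^ 2 ≤ max B 1 := by
    intro t
    by_cases h1 : 1 < t
    · have : f =ᶠ[nhds t] id := by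
        filter_upwards [lt_mem_nhds h1] with s hs using hf1 s hs.le
      rw [this.deriv_eq]; simp
    by_cases h2 : t < -1
    · have : f =ᶠ[nhds t] fun s => -s := by
        filter_upwards [gt_mem_nhds h2] with s hs using hf2 s hs.le
      rw [this.deriv_eq]; simp
    have := hB t ⟨by linarith, by linarith⟩
    rw [Real.norm_eq_abs] at this
    exact (le_abs_self _).trans (this.trans (le_max_left _ _))
  refine ⟨max B 1, le_max_right _ _, fun δ hδ => ⟨fun t => δ * f (t / δ), ?_, ?_, ?_⟩⟩
  · exact contDiff_const.mul (hfd.comp (contDiff_id.div_const δ))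
  · intro t ht
    rcases le_total 0 t with h0 | h0
    · rw [abs_of_nonneg h0] at ht ⊢
      simp only
      rw [hf1 _ (by rwa [le_div_iff₀ hδ, one_mul])]; field_simp
    · rw [abs_of_nonpos h0] at ht ⊢
      simp only
      rw [hf2 _ (by rw [div_le_iff₀ hδ]; linarith)]; field_simp
  · intro t
    have hd : HasDerivAt f (deriv f (t / δ)) (t / δ) :=
      (hfd.differentiable (by simp) _).hasDerivAt
    have := ((hd.comp t ((hasDerivAt_id t).div_const δ)).const_mul δ).deriv
    simp only [Function.comp_def, id] at this
    rw [this]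
    have : δ * (deriv f (t / δ) * (1 / δ)) = deriv f (t / δ) := by field_simp
    rw [this]
    exact hbd _

lemma measurePreserving_shear_affine (a σ : ℝ) (hσ : σ ^ 2 = 1) :
    MeasurePreserving (shear fun x => a + σ * x) := by
  have h0 : σ ≠ 0 := by rintro rfl; simp at hσ
  refine ⟨measurable_shear (by fun_prop), ?_⟩
  have h1 : Measure.map (fun x => a + σ * x) volume = (1 : ENNReal) • (volume : Measure ℝ) := by
    have : (fun x => a + σ * x) = (fun x => a + x) ∘ (fun x => σ * x) := rfl
    have h2 : |σ⁻¹| = 1 := by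
      rcases sq_eq_one_iff.mp hσ with h | h <;> simp [h]
    rw [this, ← Measure.map_map (by fun_prop) (by fun_prop), Real.map_volume_mul_left h0, h2,
      ENNReal.ofReal_one, one_smul, map_add_left_eq_self]
  rw [map_shear (by fun_prop) h1, one_smul]

lemma measurableEmbedding_shear_affine (a σ : ℝ) (hσ : σ ^ 2 = 1) :
    MeasurableEmbedding (shear fun x => a + σ * x) := by
  have h0 : σ ≠ 0 := by rintro rfl; simp at hσ
  refine Continuous.measurableEmbedding ?_ ?_
  · rw [shear_eq]; fun_prop
  · intro z w h
    simp only [shear, Complex.mk.injEq, add_right_inj, mul_eq_mul_left_iff, h0, or_false] at h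
    exact Complex.ext h.1 h.2

lemma lintegral_re_preimage {f : ℂ → ENNReal} (hf : Measurable f) {s : Set ℝ}
    (hs : MeasurableSet s) :
    ∫⁻ z in Complex.re ⁻¹' s, f z = ∫⁻ x in s, ∫⁻ y, f ⟨x, y⟩ := by
  have e := Complex.volume_preserving_equiv_real_prod.symm
  rw [← e.setLIntegral_comp_preimage (hs.preimage Complex.measurable_re) hf]
  have : Complex.measurableEquivRealProd.symm ⁻¹' (Complex.re ⁻¹' s) = s ×ˢ Set.univ := by
    ext p; simp
  rw [this, Measure.volume_eq_prod, setLIntegral_prod]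
  · simp only [Measure.restrict_univ]; rfl
  · exact (hf.comp e.measurable).aemeasurable

lemma integrable_re_im {f : ℂ → ℝ} (hf : Integrable f) :
    Integrable (fun p : ℝ × ℝ => f ⟨p.1, p.2⟩) (volume.prod volume) := by
  have e := Complex.volume_preserving_equiv_real_prod.symm
  have := e.integrable_comp_of_integrable hf
  rw [Measure.volume_eq_prod] at this
  exact this

lemma integral_re_preimage {f : ℂ → ℝ} (hf : Integrable f) {s : Set ℝ} :
    ∫ z in Complex.re ⁻¹' s, f z = ∫ x in s, ∫ y, f ⟨x, y⟩ := by
  have e := Complex.volume_preserving_equiv_real_prod.symm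
  rw [← e.setIntegral_preimage_emb Complex.measurableEquivRealProd.symm.measurableEmbedding]
  have : Complex.measurableEquivRealProd.symm ⁻¹' (Complex.re ⁻¹' s) = s ×ˢ Set.univ := by
    ext p; simp
  rw [this, Measure.volume_eq_prod, setIntegral_prod]
  · simp only [Measure.restrict_univ]; rfl
  · exact (integrable_re_im hf).integrableOn

section fold

variable {δ a σ : ℝ} {h : ℝ → ℝ}

lemma shear_fold_pos (hh : ∀ t, δ ≤ |t| → h t = |t|) (hδ : 0 < δ) {z : ℂ} (hz : δ < z.re) :
    shear (fun x => a + σ * h x) z = shear (fun x => a + σ * x) z := by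
  have h1 : |z.re| = z.re := abs_of_pos (hδ.trans hz)
  simp only [shear]
  rw [hh z.re (by rw [h1]; exact hz.le), h1]

lemma shear_fold_neg (hh : ∀ t, δ ≤ |t| → h t = |t|) (hδ : 0 < δ) {z : ℂ} (hz : z.re < -δ) :
    shear (fun x => a + σ * h x) z = shear (fun x => a + (-σ) * x) z := by
  have h1 : |z.re| = -z.re := abs_of_neg (by linarith)
  simp only [shear]
  rw [hh z.re (by rw [h1]; linarith), h1, mul_neg, neg_mul]

lemma compl_strip : {z : ℂ | |z.re| ≤ δ}ᶜ = {z : ℂ | δ < z.re} ∪ {z | z.re < -δ} := by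
  ext z
  simp only [Set.mem_compl_iff, Set.mem_ofPred_eq, Set.mem_union, not_le, lt_abs]
  constructor <;> rintro (h | h) <;> [left; right; left; right] <;> linarith

lemma disjoint_sides (hδ : 0 < δ) : Disjoint {z : ℂ | δ < z.re} {z | z.re < -δ} := by
  rw [Set.disjoint_left]
  intro z h1 h2
  simp only [Set.mem_ofPred_eq] at h1 h2
  linarith

lemma measurableSet_strip : MeasurableSet {z : ℂ | |z.re| ≤ δ} :=
  measurableSet_le (by fun_prop) measurable_const

lemma measurableSet_side_neg : MeasurableSet {z : ℂ | z.re < -δ} :=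
  measurableSet_lt (by fun_prop) measurable_const

lemma measurableSet_side_pos : MeasurableSet {z : ℂ | δ < z.re} :=
  measurableSet_lt measurable_const (by fun_prop)

lemma preimage_half_pos (hσ : σ ^ 2 = 1) :
    shear (fun x => a + σ * x) ⁻¹' {w | δ < σ * (w.re - a)} = {z | δ < z.re} := by
  ext z
  have : σ * (a + σ * z.re - a) = z.re := by linear_combination z.re * hσ
  simp [shear, ← mul_assoc, ← sq, hσ]

lemma preimage_half_neg (hσ : σ ^ 2 = 1) :
    shear (fun x => a + (-σ) * x) ⁻¹' {w | δ < σ * (w.re - a)} = {z | z.re < -δ} := by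
  ext z
  simp only [shear, Set.mem_preimage, Set.mem_ofPred_eq]
  have : σ * (a + (-σ) * z.re - a) = -z.re := by linear_combination -z.re * hσ
  rw [this]
  constructor <;> intro <;> linarith

lemma lintegral_fold (hδ : 0 < δ) (hσ : σ ^ 2 = 1) (hh : ∀ t, δ ≤ |t| → h t = |t|)
    {f : ℂ → ENNReal} (hf : Measurable f) :
    ∫⁻ z, f (shear (fun x => a + σ * h x) z) = 2 * (∫⁻ w in {w | δ < σ * (w.re - a)}, f w) +
      ∫⁻ z in {z : ℂ | |z.re| ≤ δ}, f (shear (fun x => a + σ * h x) z) := by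
  have hH : MeasurableSet {w : ℂ | δ < σ * (w.re - a)} :=
    measurableSet_lt measurable_const (by fun_prop)
  rw [← lintegral_add_compl _ (measurableSet_strip (δ := δ)), add_comm, compl_strip,
    lintegral_union measurableSet_side_neg (disjoint_sides hδ), two_mul]
  congr 2
  · rw [← (measurePreserving_shear_affine a σ hσ).setLIntegral_comp_preimage hH hf,
      preimage_half_pos hσ]
    exact setLIntegral_congr_fun measurableSet_side_pos
      fun z hz => by rw [shear_fold_pos hh hδ hz]
  · rw [← (measurePreserving_shear_affine a (-σ) (by rwa [neg_sq])).setLIntegral_comp_preimage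
      hH hf, preimage_half_neg hσ]
    exact setLIntegral_congr_fun measurableSet_side_neg
      fun z hz => by rw [shear_fold_neg hh hδ hz]

lemma integral_fold (hδ : 0 < δ) (hσ : σ ^ 2 = 1) (hh : ∀ t, δ ≤ |t| → h t = |t|)
    {f : ℂ → ℝ} (hf : Integrable fun z => f (shear (fun x => a + σ * h x) z)) :
    ∫ z, f (shear (fun x => a + σ * h x) z) = 2 * (∫ w in {w | δ < σ * (w.re - a)}, f w) +
      ∫ z in {z : ℂ | |z.re| ≤ δ}, f (shear (fun x => a + σ * h x) z) := by
  rw [← integral_add_compl (measurableSet_strip (δ := δ)) hf, add_comm, compl_strip,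
    setIntegral_union (disjoint_sides hδ) measurableSet_side_neg hf.integrableOn
      hf.integrableOn, two_mul]
  congr 2
  · rw [← (measurePreserving_shear_affine a σ hσ).setIntegral_preimage_emb
      (measurableEmbedding_shear_affine a σ hσ) f _, preimage_half_pos hσ]
    exact setIntegral_congr_fun measurableSet_side_pos
      fun z hz => by simp only [shear_fold_pos hh hδ hz]
  · rw [← (measurePreserving_shear_affine a (-σ) (by rwa [neg_sq])).setIntegral_preimage_emb
      (measurableEmbedding_shear_affine a (-σ) (by rwa [neg_sq])) f _, preimage_half_neg hσ]
    exact setIntegral_congr_fun measurableSet_side_neg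
      fun z hz => by simp only [shear_fold_neg hh hδ hz]

/-- Averaging the strip integral over the position of the fold. -/
lemma lintegral_strip_average (hh : Measurable h) {g : ℂ → ENNReal}
    (hg : Measurable g) :
    ∫⁻ b : ℝ, ∫⁻ z in {z : ℂ | |z.re| ≤ δ}, g (shear (fun x => b + σ * h x) z) =
      ENNReal.ofReal (2 * δ) * ∫⁻ z, g z := by
  have hmk : Measurable fun p : ℝ × ℝ => (⟨p.1, p.2⟩ : ℂ) :=
    Complex.measurableEquivRealProd.symm.measurable
  have hsh : ∀ b, Measurable (shear fun x => b + σ * h x) :=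
    fun b => measurable_shear (by fun_prop)
  have h1 : ∀ b : ℝ, ∫⁻ z in {z : ℂ | |z.re| ≤ δ}, g (shear (fun x => b + σ * h x) z) =
      ∫⁻ x in Set.Icc (-δ) δ, ∫⁻ y, g ⟨b + σ * h x, y⟩ := by
    intro b
    have := lintegral_re_preimage (hg.comp (hsh b)) (s := Set.Icc (-δ) δ) measurableSet_Icc
    have hs : {z : ℂ | |z.re| ≤ δ} = Complex.re ⁻¹' (Set.Icc (-δ) δ) := by
      ext z; simp [abs_le]
    rw [hs]
    exact this
  simp_rw [h1]
  have hm1 : Measurable fun p : ℝ × ℝ => ∫⁻ y, g ⟨p.1 + σ * h p.2, y⟩ := by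
    apply Measurable.lintegral_prod_right'
      (f := fun q : (ℝ × ℝ) × ℝ => g ⟨q.1.1 + σ * h q.1.2, q.2⟩)
    have hq : Measurable fun q : (ℝ × ℝ) × ℝ => (q.1.1 + σ * h q.1.2, q.2) := by fun_prop
    exact hg.comp (hmk.comp hq)
  rw [lintegral_lintegral_swap hm1.aemeasurable]
  have h2 : ∀ x, ∫⁻ b : ℝ, ∫⁻ y, g ⟨b + σ * h x, y⟩ = ∫⁻ z, g z := by
    intro x
    rw [lintegral_add_right_eq_self (fun b => ∫⁻ y, g ⟨b, y⟩) (σ * h x)]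
    have := lintegral_re_preimage hg (s := Set.univ) MeasurableSet.univ
    simpa using this.symm
  simp_rw [h2]
  rw [setLIntegral_const, Real.volume_Icc, mul_comm]
  congr 2
  ring

end fold

/-- Control of the map folded along the line `x₁ = a`. -/
lemma folded_map {u : ℂ → ℂ} (hu : memE u) (hm : momInt u) {C δ a σ κ : ℝ} {h : ℝ → ℝ}
    (hC : 1 ≤ C) (hδ : 0 < δ) (hσ : σ ^ 2 = 1) (hκ : 0 ≤ κ) (hhd : ContDiff ℝ (⊤ : ℕ∞) h)
    (hh : ∀ t, δ ≤ |t| → h t = |t|) (hh' : ∀ t, deriv h t ^ 2 ≤ C)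
    (hs : ∫⁻ z in {z : ℂ | |z.re| ≤ δ}, (fun w => ENNReal.ofReal (energyDensity u w) +
      ENNReal.ofReal |momDensity u w|) (shear (fun x => a + σ * h x) z) ≤ ENNReal.ofReal κ) :
    ∃ v, memE v ∧ |P2 v - ∫ w in {w | δ < σ * (w.re - a)}, momDensity u w| ≤ κ ∧
      energy v ≤ 2 * (∫⁻ w in {w | δ < σ * (w.re - a)}, ENNReal.ofReal (energyDensity u w)) +
        ENNReal.ofReal (C * κ) := by
  set k : ℝ → ℝ := fun x => a + σ * h x with hk
  have hkd : ContDiff ℝ (⊤ : ℕ∞) k := contDiff_const.add (contDiff_const.mul hhd)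
  have hkm : Measurable (shear k) := measurable_shear hkd.continuous.measurable
  have hv : ContDiff ℝ (⊤ : ℕ∞) (u ∘ shear k) := hu.1.comp (contDiff_shear hkd)
  have hud := hu.1.differentiable (by simp)
  have hvd := hv.differentiable (by simp)
  have hkder : ∀ x, HasDerivAt k (σ * deriv h x) x := fun x =>
    ((hhd.differentiable (by simp) x).hasDerivAt.const_mul σ).const_add a
  have hme : Measurable (fun z => ENNReal.ofReal (energyDensity u z)) :=
    (continuous_energyDensity hu.1).measurable.ennreal_ofReal
  have hmm : Measurable (fun z => ENNReal.ofReal |momDensity u z|) :=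
    (continuous_momDensity hu.1).abs.measurable.ennreal_ofReal
  have hS := measurableSet_strip (δ := δ)
  have hs1 : ∫⁻ z in {z : ℂ | |z.re| ≤ δ}, ENNReal.ofReal (energyDensity u (shear k z)) ≤
      ENNReal.ofReal κ := (lintegral_mono fun z => le_self_add).trans hs
  have hs2 : ∫⁻ z in {z : ℂ | |z.re| ≤ δ}, ENNReal.ofReal |momDensity u (shear k z)| ≤
      ENNReal.ofReal κ := (lintegral_mono fun z => le_add_self).trans hs
  have hE : energy (u ∘ shear k) ≤
      2 * (∫⁻ w in {w | δ < σ * (w.re - a)}, ENNReal.ofReal (energyDensity u w)) +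
        ENNReal.ofReal (C * κ) := by
    have hdens : ∀ z, ENNReal.ofReal (energyDensity (u ∘ shear k) z) ≤
        ENNReal.ofReal C * ENNReal.ofReal (energyDensity u (shear k z)) := by
      intro z
      rw [← ENNReal.ofReal_mul (by linarith)]
      refine ENNReal.ofReal_le_ofReal (energyDensity_comp_shear_le hud hvd (hkder _) ?_ hC)
      rw [mul_pow, hσ, one_mul]
      exact hh' _
    have hside : ∀ z ∈ {z : ℂ | |z.re| ≤ δ}ᶜ, ENNReal.ofReal (energyDensity (u ∘ shear k) z) ≤
        ENNReal.ofReal (energyDensity u (shear k z)) := by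
      intro z hz
      apply ENNReal.ofReal_le_ofReal
      rw [← one_mul (energyDensity u (shear k z))]
      refine energyDensity_comp_shear_le hud hvd (hkder _) ?_ le_rfl
      rw [mul_pow, hσ, one_mul]
      rw [compl_strip] at hz
      rcases hz with hz | hz
      · have : h =ᶠ[nhds z.re] id := by
          filter_upwards [lt_mem_nhds hz] with s hs
          have h1 : |s| = s := abs_of_pos (hδ.trans hs)
          rw [hh s (by rw [h1]; exact hs.le), h1]; rfl
        rw [this.deriv_eq]; simp
      · have : h =ᶠ[nhds z.re] fun s => -s := by
          filter_upwards [gt_mem_nhds hz] with s hs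
          have h1 : |s| = -s := abs_of_neg (by linarith)
          rw [hh s (by rw [h1]; linarith), h1]
        rw [this.deriv_eq]; simp
    have hfold := lintegral_fold (a := a) hδ hσ hh hme
    rw [← lintegral_add_compl _ hS, add_comm] at hfold
    unfold energy
    rw [← lintegral_add_compl _ hS, add_comm]
    refine add_le_add ?_ ?_
    · refine (setLIntegral_mono' hS.compl hside).trans ?_
      refine le_of_eq ((ENNReal.add_left_inj ?_).mp hfold)
      exact (hs1.trans_lt ENNReal.ofReal_lt_top).ne
    · refine (lintegral_mono hdens).trans ?_
      have hme' : Measurable (fun z => ENNReal.ofReal (energyDensity u (shear k z))) :=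
        hme.comp hkm
      rw [lintegral_const_mul _ hme', ENNReal.ofReal_mul (by linarith)]
      gcongr
  have hHE : ∫⁻ w in {w | δ < σ * (w.re - a)}, ENNReal.ofReal (energyDensity u w) ≤ energy u :=
    setLIntegral_le_lintegral _ _
  have h_integrable : Integrable (fun z => momDensity u (shear k z)) := by
    refine ⟨((continuous_momDensity hu.1).measurable.comp hkm).aestronglyMeasurable, ?_⟩
    rw [hasFiniteIntegral_iff_norm]
    simp only [Real.norm_eq_abs]
    rw [lintegral_fold (a := a) hδ hσ hh hmm]
    refine ENNReal.add_lt_top.2 ⟨ENNReal.mul_lt_top (by simp) ?_,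
      hs2.trans_lt ENNReal.ofReal_lt_top⟩
    refine (setLIntegral_le_lintegral _ _).trans_lt ?_
    have := hm.2
    rw [hasFiniteIntegral_iff_norm] at this
    exact this
  refine ⟨u ∘ shear k, ⟨hv, hE.trans_lt ?_⟩, ?_, hE⟩
  · exact ENNReal.add_lt_top.2 ⟨ENNReal.mul_lt_top (by simp) (hHE.trans_lt hu.2),
      ENNReal.ofReal_lt_top⟩
  · unfold P2
    simp_rw [momDensity_comp_shear hud hvd]
    rw [integral_fold (a := a) hδ hσ hh h_integrable]
    have h1 : |∫ z in {z : ℂ | |z.re| ≤ δ}, momDensity u (shear k z)| ≤ κ := by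
      rw [← Real.norm_eq_abs]
      refine (norm_integral_le_lintegral_norm _).trans ?_
      exact ENNReal.toReal_le_of_le_ofReal hκ hs2
    rw [abs_le] at h1 ⊢
    constructor <;> linarith [h1.1, h1.2]

/-- Position of a fold for which the strip contributes little on both sides. -/
lemma exists_good_fold {g : ℂ → ENNReal} (hg : Measurable g) (hgf : ∫⁻ z, g z < ⊤)
    (a₀ : ℝ) {η κ : ℝ} (hη : 0 < η) (hκ : 0 < κ) :
    ∃ δ > 0, δ < η ∧ ∀ h : ℝ → ℝ, Measurable h → ∃ a, |a - a₀| ≤ η ∧ ∀ σ : ℝ, σ ^ 2 = 1 →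
      ∫⁻ z in {z : ℂ | |z.re| ≤ δ}, g (shear (fun x => a + σ * h x) z) ≤ ENNReal.ofReal κ := by
  set G := (∫⁻ z, g z).toReal with hG
  have hG0 : 0 ≤ G := ENNReal.toReal_nonneg
  have hGe : ∫⁻ z, g z = ENNReal.ofReal G := (ENNReal.ofReal_toReal hgf.ne).symm
  obtain ⟨δ, hδ0, hδ1⟩ : ∃ δ > 0, δ < min η (η * κ / (2 * (G + 1))) :=
    exists_between (by positivity)
  have hδ2 : 4 * δ * G < 2 * η * κ := by
    have h1 := hδ1.trans_le (min_le_right _ _)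
    rw [lt_div_iff₀ (by positivity)] at h1
    nlinarith
  refine ⟨δ, hδ0, hδ1.trans_le (min_le_left _ _), fun h hh => ?_⟩
  by_contra! hcon
  set S : ℝ → ℝ → ENNReal := fun σ b =>
    ∫⁻ z in {z : ℂ | |z.re| ≤ δ}, g (shear (fun x => b + σ * h x) z) with hS
  have hSm : ∀ σ, Measurable (S σ) := by
    intro σ
    have hk : Measurable fun q : ℝ × ℂ => (⟨q.1 + σ * h q.2.re, q.2.im⟩ : ℂ) := by
      have h2 : Measurable fun q : ℝ × ℂ => (q.1 + σ * h q.2.re, q.2.im) := by fun_prop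
      exact Complex.measurableEquivRealProd.symm.measurable.comp h2
    exact Measurable.lintegral_prod_right'
      (f := fun q : ℝ × ℂ => g ⟨q.1 + σ * h q.2.re, q.2.im⟩) (hg.comp hk)
  have hlow : ∀ b ∈ Set.Icc (a₀ - η) (a₀ + η), ENNReal.ofReal κ ≤ S 1 b + S (-1) b := by
    intro b hb
    obtain ⟨σ, hσ, hlt⟩ := hcon b (by rw [abs_le]; constructor <;> linarith [hb.1, hb.2])
    rcases sq_eq_one_iff.mp hσ with rfl | rfl
    · exact hlt.le.trans le_self_add
    · exact hlt.le.trans le_add_self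
  have h1 : ENNReal.ofReal κ * ENNReal.ofReal (2 * η) ≤ ∫⁻ b, (S 1 b + S (-1) b) := by
    have h2 : volume (Set.Icc (a₀ - η) (a₀ + η)) = ENNReal.ofReal (2 * η) := by
      rw [Real.volume_Icc]; congr 1; ring
    rw [← h2, ← setLIntegral_const]
    exact (setLIntegral_mono' measurableSet_Icc hlow).trans (setLIntegral_le_lintegral _ _)
  rw [lintegral_add_left (hSm 1), lintegral_strip_average hh hg, lintegral_strip_average hh hg,
    hGe, ← ENNReal.ofReal_mul hκ.le, ← ENNReal.ofReal_mul (by positivity),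
    ← ENNReal.ofReal_add (by positivity) (by positivity),
    ENNReal.ofReal_le_ofReal_iff (by positivity)] at h1
  linarith

lemma continuous_integral_Iic {M : ℝ → ℝ} (hM : Integrable M) :
    Continuous fun a => ∫ x in Set.Iic a, M x := by
  have : (fun a => ∫ x in Set.Iic a, M x) =
      fun a => (∫ x in Set.Iic 0, M x) + ∫ x in (0 : ℝ)..a, M x := by
    funext a
    rw [← intervalIntegral.integral_Iic_sub_Iic hM.integrableOn hM.integrableOn]
    ring
  rw [this]
  exact continuous_const.add (intervalIntegral.continuous_primitive
    (fun a b => hM.intervalIntegrable) 0)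

lemma exists_integral_Iic_near {M : ℝ → ℝ} (hM : Integrable M) {c ε : ℝ} (hc : 0 ≤ c)
    (hc' : c ≤ ∫ x, M x) (hε : 0 < ε) : ∃ a, |(∫ x in Set.Iic a, M x) - c| < ε := by
  set J : ℝ → ℝ := fun a => ∫ x in Set.Iic a, M x with hJ
  have hJc : Continuous J := continuous_integral_Iic hM
  have hbot : Tendsto J atBot (nhds 0) := by
    have h1 := intervalIntegral_tendsto_integral_Iic (0 : ℝ) hM.integrableOn tendsto_id
    have h2 : J = fun a => J 0 - ∫ x in a..0, M x := by
      funext a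
      rw [← intervalIntegral.integral_Iic_sub_Iic hM.integrableOn hM.integrableOn]
      simp [hJ]
    rw [h2]
    simpa [hJ] using h1.const_sub (J 0)
  have htop : Tendsto J atTop (nhds (∫ x, M x)) := by
    have h1 := intervalIntegral_tendsto_integral_Ioi (0 : ℝ) hM.integrableOn tendsto_id
    have h2 : J = fun a => J 0 + ∫ x in (0 : ℝ)..a, M x := by
      funext a
      rw [← intervalIntegral.integral_Iic_sub_Iic hM.integrableOn hM.integrableOn]
      simp [hJ]
    rw [h2, ← intervalIntegral.integral_Iic_add_Ioi (b := 0) hM.integrableOn hM.integrableOn]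
    exact h1.const_add (J 0)
  obtain ⟨a₁, ha₁⟩ := (hbot.eventually (Metric.ball_mem_nhds 0 hε)).exists
  obtain ⟨a₂, ha₂⟩ := (htop.eventually (Metric.ball_mem_nhds _ hε)).exists
  rw [Real.dist_eq, abs_lt] at ha₁ ha₂
  by_cases h1 : c ≤ J a₁
  · exact ⟨a₁, by rw [abs_lt]; constructor <;> linarith [ha₁.2]⟩
  by_cases h2 : J a₂ ≤ c
  · exact ⟨a₂, by rw [abs_lt]; constructor <;> linarith [ha₂.1]⟩
  push Not at h1 h2
  obtain ⟨a, ha⟩ := mem_range_of_exists_le_of_exists_ge hJc ⟨a₁, h1.le⟩ ⟨a₂, h2.le⟩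
  exact ⟨a, by show |J a - c| < ε; rw [ha]; simpa⟩

/-- Cutting a map along a vertical line and reflecting both halves. -/
lemma exists_reflected_pair {u : ℂ → ℂ} (hu : memE u) (hm : momInt u) {p q ε : ℝ} (hp : 0 ≤ p)
    (hq : 0 ≤ q) (hP : P2 u = (p + q) / 2) (hε : 0 < ε) :
    ∃ v w, memE v ∧ memE w ∧ |P2 v - p| < ε ∧ |P2 w - q| < ε ∧
      Efun v + Efun w ≤ 2 * Efun u + ε := by
  obtain ⟨C, hC, hfold⟩ := exists_smooth_abs
  set M : ℝ → ℝ := fun x => ∫ y, momDensity u ⟨x, y⟩ with hMdef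
  have hM : Integrable M := (integrable_re_im hm).integral_prod_left
  have htot : ∫ x, M x = p + q := by
    have h1 := integral_re_preimage hm (s := Set.univ)
    simp only [Set.preimage_univ, Measure.restrict_univ] at h1
    unfold P2 at hP
    rw [h1] at hP
    linarith
  set J : ℝ → ℝ := fun a => ∫ x in Set.Iic a, M x with hJ
  have hJc : Continuous J := continuous_integral_Iic hM
  obtain ⟨a₀, ha₀⟩ := exists_integral_Iic_near hM (c := p) (ε := ε / 4) hp (by linarith)
    (by positivity)
  obtain ⟨η, hη, hηJ⟩ := Metric.continuous_iff.1 hJc a₀ (ε / 4) (by positivity)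
  set κ := ε / (4 * C) with hκdef
  have hκ : 0 < κ := by positivity
  have hCκ : C * κ = ε / 4 := by rw [hκdef]; field_simp
  have hκ' : κ ≤ ε / 4 := by rw [← hCκ]; nlinarith
  have hme : Measurable (fun z => ENNReal.ofReal (energyDensity u z)) :=
    (continuous_energyDensity hu.1).measurable.ennreal_ofReal
  have hmm : Measurable (fun z => ENNReal.ofReal |momDensity u z|) :=
    (continuous_momDensity hu.1).abs.measurable.ennreal_ofReal
  have hgf : ∫⁻ w, (ENNReal.ofReal (energyDensity u w) + ENNReal.ofReal |momDensity u w|) < ⊤ := by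
    rw [lintegral_add_left hme]
    have := hm.2
    rw [hasFiniteIntegral_iff_norm] at this
    exact ENNReal.add_lt_top.2 ⟨hu.2, this⟩
  obtain ⟨δ, hδ, hδη, hgood⟩ := exists_good_fold (hme.add hmm) hgf a₀ (η := η / 4) (κ := κ)
    (by positivity) hκ
  obtain ⟨h, hhd, hh, hh'⟩ := hfold δ hδ
  obtain ⟨a, haa, hstrip⟩ := hgood h hhd.continuous.measurable
  obtain ⟨v, hv, hvP, hvE⟩ := folded_map hu hm hC hδ (σ := -1) (a := a) (by norm_num) hκ.le hhd hh
    hh' (hstrip (-1) (by norm_num))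
  obtain ⟨w, hw, hwP, hwE⟩ := folded_map hu hm hC hδ (σ := 1) (a := a) (by norm_num) hκ.le hhd hh
    hh' (hstrip 1 (by norm_num))
  have hleft : {w : ℂ | δ < -1 * (w.re - a)} = Complex.re ⁻¹' (Set.Iio (a - δ)) := by
    ext z
    simp only [Set.mem_ofPred_eq, Set.mem_preimage, Set.mem_Iio]
    constructor <;> intro <;> linarith
  have hright : {w : ℂ | δ < 1 * (w.re - a)} = Complex.re ⁻¹' (Set.Ioi (a + δ)) := by
    ext z
    simp only [Set.mem_ofPred_eq, Set.mem_preimage, Set.mem_Ioi]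
    constructor <;> intro <;> linarith
  rw [hleft] at hvP hvE
  rw [hright] at hwP hwE
  rw [integral_re_preimage hm, ← integral_Iic_eq_integral_Iio] at hvP
  rw [integral_re_preimage hm] at hwP
  have hadd : J (a + δ) + ∫ x in Set.Ioi (a + δ), M x = p + q := by
    rw [← htot]
    exact intervalIntegral.integral_Iic_add_Ioi hM.integrableOn hM.integrableOn
  have hn : ∀ b, |b - a₀| < η → |J b - p| < ε / 2 := by
    intro b hb
    have h1 := hηJ b (by rwa [Real.dist_eq])
    rw [Real.dist_eq] at h1
    have := abs_add_le (J b - J a₀) (J a₀ - p)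
    rw [sub_add_sub_cancel] at this
    linarith
  rw [abs_le] at haa
  have hn1 := hn (a - δ) (by rw [abs_lt]; constructor <;> linarith [haa.1, haa.2])
  have hn2 := hn (a + δ) (by rw [abs_lt]; constructor <;> linarith [haa.1, haa.2])
  refine ⟨v, w, hv, hw, ?_, ?_, ?_⟩
  · have hvP' : |P2 v - J (a - δ)| ≤ κ := hvP
    rw [abs_le] at hvP'
    rw [abs_lt] at hn1 ⊢
    constructor <;> linarith [hvP'.1, hvP'.2, hn1.1, hn1.2]
  · have hwP' : |P2 w - ∫ x in Set.Ioi (a + δ), M x| ≤ κ := hwP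
    rw [abs_le] at hwP'
    rw [abs_lt] at hn2 ⊢
    constructor <;> linarith [hwP'.1, hwP'.2, hn2.1, hn2.2]
  · have hsum : energy v + energy w ≤ 2 * energy u + ENNReal.ofReal (ε / 2) := by
      refine (add_le_add hvE hwE).trans ?_
      have h1 : (∫⁻ w in Complex.re ⁻¹' (Set.Iio (a - δ)), ENNReal.ofReal (energyDensity u w)) +
          (∫⁻ w in Complex.re ⁻¹' (Set.Ioi (a + δ)), ENNReal.ofReal (energyDensity u w)) ≤
          energy u := by
        rw [← lintegral_union (measurableSet_Ioi.preimage Complex.measurable_re)]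
        · exact setLIntegral_le_lintegral _ _
        · rw [Set.disjoint_left]
          intro z h1 h2
          simp only [Set.mem_preimage, Set.mem_Iio, Set.mem_Ioi] at h1 h2
          linarith
      rw [add_add_add_comm, ← mul_add, ← ENNReal.ofReal_add (by positivity) (by positivity), hCκ]
      have h2 : ε / 4 + ε / 4 = ε / 2 := by ring
      rw [h2]
      gcongr
    have hfin : 2 * energy u + ENNReal.ofReal (ε / 2) ≠ ⊤ :=
      (ENNReal.add_lt_top.2 ⟨ENNReal.mul_lt_top (by simp) hu.2, ENNReal.ofReal_lt_top⟩).ne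
    have := ENNReal.toReal_mono hfin hsum
    rw [ENNReal.toReal_add hv.2.ne hw.2.ne, ENNReal.toReal_add
      (ENNReal.mul_lt_top (by simp) hu.2).ne ENNReal.ofReal_ne_top, ENNReal.toReal_mul,
      ENNReal.toReal_ofReal (by positivity)] at this
    simp only [ENNReal.toReal_ofNat] at this
    unfold Efun
    linarith

lemma Emin_midpoint_of_mem {u : ℂ → ℂ} (hu : memE u) {p q : ℝ} (hp : 0 ≤ p)
    (hq : 0 ≤ q) (hP : P2 u = (p + q) / 2) : Emin p + Emin q ≤ 2 * Efun u := by
  by_cases h0 : P2 u = 0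
  · have hp0 : p = 0 := by linarith
    have hq0 : q = 0 := by linarith
    rw [hp0, hq0, Emin_zero]
    linarith [Efun_nonneg u]
  have hm := momInt_of_P2_ne h0
  have key : ∀ ε : ℝ, 0 < ε → Emin p + Emin q ≤ (1 + ε) * (2 * Efun u + ε) := by
    intro ε hε
    obtain ⟨η₁, hη₁, H₁⟩ := Emin_le_of_near hp hε
    obtain ⟨η₂, hη₂, H₂⟩ := Emin_le_of_near hq hε
    obtain ⟨v, w, hv, hw, hvP, hwP, hE⟩ := exists_reflected_pair hu hm hp hq hP
      (ε := min ε (min η₁ η₂)) (by positivity)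
    have h1 := H₁ v hv (hvP.trans_le ((min_le_right _ _).trans (min_le_left _ _)))
    have h2 := H₂ w hw (hwP.trans_le ((min_le_right _ _).trans (min_le_right _ _)))
    have h3 : Efun v + Efun w ≤ 2 * Efun u + ε := hE.trans (by gcongr; exact min_le_left _ _)
    nlinarith
  have hlim : Tendsto (fun ε : ℝ => (1 + ε) * (2 * Efun u + ε)) (nhdsWithin 0 (Set.Ioi 0))
      (nhds ((1 + 0) * (2 * Efun u + 0))) := by
    apply Tendsto.mono_left _ nhdsWithin_le_nhds
    exact Continuous.tendsto (by fun_prop) 0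
  have := ge_of_tendsto hlim (by filter_upwards [self_mem_nhdsWithin] with ε hε using key ε hε)
  simpa using this

/-- A nonnegative midpoint concave function on the half-line is nondecreasing. -/
lemma monotoneOn_of_midpoint {f : ℝ → ℝ} (h0 : ∀ x, 0 ≤ x → 0 ≤ f x)
    (hmid : ∀ x y, 0 ≤ x → 0 ≤ y → f x + f y ≤ 2 * f ((x + y) / 2)) :
    MonotoneOn f (Set.Ici 0) := by
  intro x hx y hy hxy
  rw [Set.mem_Ici] at hx hy
  by_contra! hlt
  have hstep : ∀ n : ℕ, f (y + n * (y - x)) ≤ f y - n * (f x - f y) ∧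
      f (y + (n + 1 : ℕ) * (y - x)) - f (y + n * (y - x)) ≤ f y - f x := by
    intro n
    have hd : 0 ≤ y - x := by linarith
    induction n with
    | zero =>
      refine ⟨by simp, ?_⟩
      have := hmid x (y + (y - x)) hx (by linarith)
      have h1 : (x + (y + (y - x))) / 2 = y := by ring
      rw [h1] at this
      simp only [zero_add, Nat.cast_one, one_mul, Nat.cast_zero, zero_mul, add_zero]
      linarith
    | succ n ih =>
      refine ⟨?_, ?_⟩
      · push_cast at ih ⊢
        linarith [ih.1, ih.2]
      · have := hmid (y + n * (y - x)) (y + (n + 1 + 1 : ℕ) * (y - x)) (by positivity)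
          (by positivity)
        have h1 : (y + n * (y - x) + (y + (n + 1 + 1 : ℕ) * (y - x))) / 2 =
            y + (n + 1 : ℕ) * (y - x) := by push_cast; ring
        rw [h1] at this
        linarith [ih.2]
  obtain ⟨n, hn⟩ := exists_nat_gt (f y / (f x - f y))
  rw [div_lt_iff₀ (by linarith)] at hn
  have h1 := (hstep n).1
  have h2 := h0 (y + n * (y - x)) (by have : 0 ≤ y - x := by linarith
                                      positivity)
  linarith

lemma dyadic_concave {f : ℝ → ℝ}
    (hmid : ∀ x y, 0 ≤ x → 0 ≤ y → f x + f y ≤ 2 * f ((x + y) / 2)) (n : ℕ) :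
    ∀ k : ℕ, k ≤ 2 ^ n → ∀ x y, 0 ≤ x → 0 ≤ y →
      (1 - k / 2 ^ n) * f x + k / 2 ^ n * f y ≤ f ((1 - k / 2 ^ n) * x + k / 2 ^ n * y) := by
  induction n with
  | zero =>
    intro k hk x y _ _
    interval_cases k <;> simp
  | succ n ih =>
    intro k hk x y hx hy
    have hm0 : 0 ≤ (x + y) / 2 := by positivity
    have h3 := hmid x y hx hy
    have hpos : (0 : ℝ) < 2 ^ n := by positivity
    rcases le_total k (2 ^ n) with h | h
    · have h1 := ih k h x ((x + y) / 2) hx hm0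
      have e : (1 - (k : ℝ) / 2 ^ n) * x + k / 2 ^ n * ((x + y) / 2) =
          (1 - k / 2 ^ (n + 1)) * x + k / 2 ^ (n + 1) * y := by
        rw [pow_succ]; field_simp; ring
      rw [e] at h1
      refine le_trans ?_ h1
      have hk0 : (0 : ℝ) ≤ k / 2 ^ n := by positivity
      have e2 : (k : ℝ) / 2 ^ (n + 1) = k / 2 ^ n / 2 := by rw [pow_succ]; field_simp
      rw [e2]
      nlinarith
    · obtain ⟨j, rfl⟩ := Nat.exists_eq_add_of_le h
      have hj : j ≤ 2 ^ n := by rw [pow_succ] at hk; omega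
      have h1 := ih j hj ((x + y) / 2) y hm0 hy
      have hj1 : (j : ℝ) / 2 ^ n ≤ 1 := by
        rw [div_le_one hpos]; exact_mod_cast hj
      have e2 : ((2 ^ n + j : ℕ) : ℝ) / 2 ^ (n + 1) = 1 / 2 + j / 2 ^ n / 2 := by
        push_cast; rw [pow_succ]; field_simp
      rw [e2]
      have e : (1 - (j : ℝ) / 2 ^ n) * ((x + y) / 2) + j / 2 ^ n * y =
          (1 - (1 / 2 + j / 2 ^ n / 2)) * x + (1 / 2 + j / 2 ^ n / 2) * y := by ring
      rw [e] at h1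
      refine le_trans ?_ h1
      nlinarith

lemma concaveOn_of_midpoint {f : ℝ → ℝ} (h0 : ∀ x, 0 ≤ x → 0 ≤ f x)
    (hmid : ∀ x y, 0 ≤ x → 0 ≤ y → f x + f y ≤ 2 * f ((x + y) / 2)) :
    ConcaveOn ℝ (Set.Ici 0) f := by
  have hmono := monotoneOn_of_midpoint h0 hmid
  refine LinearOrder.concaveOn_of_lt (convex_Ici 0) ?_
  intro x hx y hy hxy a b ha hb hab
  rw [Set.mem_Ici] at hx hy
  obtain rfl : a = 1 - b := by linarith
  simp only [smul_eq_mul]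
  have key : ∀ n : ℕ, (1 - (⌊b * 2 ^ n⌋₊ : ℝ) / 2 ^ n) * f x + (⌊b * 2 ^ n⌋₊ : ℝ) / 2 ^ n * f y ≤
      f ((1 - b) * x + b * y) := by
    intro n
    have hpos : (0 : ℝ) < 2 ^ n := by positivity
    have hfl : (⌊b * 2 ^ n⌋₊ : ℝ) ≤ b * 2 ^ n := Nat.floor_le (by positivity)
    have hle : (⌊b * 2 ^ n⌋₊ : ℝ) / 2 ^ n ≤ b := by rwa [div_le_iff₀ hpos]
    have hnn : (0 : ℝ) ≤ (⌊b * 2 ^ n⌋₊ : ℝ) / 2 ^ n := by positivity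
    have hk : ⌊b * 2 ^ n⌋₊ ≤ 2 ^ n := by
      have : (⌊b * 2 ^ n⌋₊ : ℝ) ≤ 2 ^ n := by nlinarith
      exact_mod_cast this
    refine (dyadic_concave hmid n _ hk x y hx hy).trans (hmono ?_ ?_ ?_)
    · have : 0 ≤ 1 - (⌊b * 2 ^ n⌋₊ : ℝ) / 2 ^ n := by linarith
      rw [Set.mem_Ici]; positivity
    · rw [Set.mem_Ici]; positivity
    · nlinarith
  have hlim : Tendsto (fun n : ℕ => (⌊b * 2 ^ n⌋₊ : ℝ) / 2 ^ n) atTop (nhds b) :=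
    (tendsto_nat_floor_mul_div_atTop hb.le).comp
      (tendsto_pow_atTop_atTop_of_one_lt (one_lt_two : (1 : ℝ) < 2))
  exact le_of_tendsto (((hlim.const_sub 1).mul_const _).add (hlim.mul_const _))
    (Eventually.of_forall key)

lemma integrable_re_mul_im {F G : ℝ → ℝ} (hF : Integrable F) (hG : Integrable G) :
    Integrable fun z : ℂ => F z.re * G z.im := by
  have e := Complex.volume_preserving_equiv_real_prod
  have h := hF.mul_prod hG
  rw [← Measure.volume_eq_prod] at h
  exact e.integrable_comp_of_integrable h

lemma integral_re_mul_im (F G : ℝ → ℝ) :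
    ∫ z : ℂ, F z.re * G z.im = (∫ x, F x) * ∫ y, G y := by
  have e := Complex.volume_preserving_equiv_real_prod
  rw [← integral_prod_mul, ← Measure.volume_eq_prod, ← e.integral_comp
    Complex.measurableEquivRealProd.measurableEmbedding]
  rfl

lemma Efun_eq_integral {u : ℂ → ℂ} (hu : ContDiff ℝ (⊤ : ℕ∞) u) :
    Efun u = ∫ z, energyDensity u z := by
  rw [integral_eq_lintegral_of_nonneg_ae (Eventually.of_forall (energyDensity_nonneg u))
    (continuous_energyDensity hu).aestronglyMeasurable]
  rfl

lemma memE_of_integrable {u : ℂ → ℂ} (hu : ContDiff ℝ (⊤ : ℕ∞) u)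
    (hE : Integrable (energyDensity u)) : memE u :=
  ⟨hu, hE.lintegral_lt_top⟩

section wave

variable {A A' B B' B'' : ℝ → ℝ} {r : ℝ}

/-- Small-amplitude perturbation of the constant `1`. -/
def wave (A B B' : ℝ → ℝ) (r t : ℝ) (z : ℂ) : ℂ :=
  1 + (t : ℂ) * ((A z.re : ℂ) * (-(r : ℂ) * (B' z.im : ℂ) + Complex.I * (B z.im : ℂ)))

lemma contDiff_wave (hA : ContDiff ℝ (⊤ : ℕ∞) A) (hB : ContDiff ℝ (⊤ : ℕ∞) B)
    (hB' : ContDiff ℝ (⊤ : ℕ∞) B') (t : ℝ) : ContDiff ℝ (⊤ : ℕ∞) (wave A B B' r t) := by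
  have h1 : ∀ {F : ℝ → ℝ}, ContDiff ℝ (⊤ : ℕ∞) F →
      ContDiff ℝ (⊤ : ℕ∞) fun z : ℂ => (F z.re : ℂ) := fun hF =>
    Complex.ofRealCLM.contDiff.comp (hF.comp Complex.reCLM.contDiff)
  have h2 : ∀ {F : ℝ → ℝ}, ContDiff ℝ (⊤ : ℕ∞) F →
      ContDiff ℝ (⊤ : ℕ∞) fun z : ℂ => (F z.im : ℂ) := fun hF =>
    Complex.ofRealCLM.contDiff.comp (hF.comp Complex.imCLM.contDiff)
  exact contDiff_const.add (contDiff_const.mul ((h1 hA).mul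
    ((contDiff_const.mul (h2 hB')).add (contDiff_const.mul (h2 hB)))))

lemma pd1_wave (hA : ContDiff ℝ (⊤ : ℕ∞) A) (hB : ContDiff ℝ (⊤ : ℕ∞) B)
    (hB' : ContDiff ℝ (⊤ : ℕ∞) B') (dA : ∀ x, HasDerivAt A (A' x) x) (t : ℝ) (z : ℂ) :
    pd1 (wave A B B' r t) z =
      (t : ℂ) * ((A' z.re : ℂ) * (-(r : ℂ) * (B' z.im : ℂ) + Complex.I * (B z.im : ℂ))) := by
  refine pd1_eq ((contDiff_wave hA hB hB' t).differentiable (by simp) z) ?_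
  change HasDerivAt (fun s : ℝ => 1 + (t : ℂ) * ((A s : ℂ) *
    (-(r : ℂ) * (B' z.im : ℂ) + Complex.I * (B z.im : ℂ)))) _ z.re
  exact ((((dA z.re).ofReal_comp).mul_const _).const_mul _).const_add _

lemma pd2_wave (hA : ContDiff ℝ (⊤ : ℕ∞) A) (hB : ContDiff ℝ (⊤ : ℕ∞) B)
    (hB' : ContDiff ℝ (⊤ : ℕ∞) B') (dB : ∀ x, HasDerivAt B (B' x) x)
    (dB' : ∀ x, HasDerivAt B' (B'' x) x) (t : ℝ) (z : ℂ) :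
    pd2 (wave A B B' r t) z =
      (t : ℂ) * ((A z.re : ℂ) * (-(r : ℂ) * (B'' z.im : ℂ) + Complex.I * (B' z.im : ℂ))) := by
  refine pd2_eq ((contDiff_wave hA hB hB' t).differentiable (by simp)) ?_
  change HasDerivAt (fun s : ℝ => 1 + (t : ℂ) * ((A z.re : ℂ) *
    (-(r : ℂ) * (B' s : ℂ) + Complex.I * (B s : ℂ)))) _ z.im
  exact ((((dB' z.im).ofReal_comp.const_mul _).fun_add
    ((dB z.im).ofReal_comp.const_mul _)).const_mul _).const_mul _ |>.const_add _

lemma wave_energy_momentum (hr : r ^ 2 = 1 / 2)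
    (hA : ContDiff ℝ (⊤ : ℕ∞) A) (hB : ContDiff ℝ (⊤ : ℕ∞) B) (hB' : ContDiff ℝ (⊤ : ℕ∞) B')
    (cA' : Continuous A') (cB'' : Continuous B'')
    (dA : ∀ x, HasDerivAt A (A' x) x) (dB : ∀ x, HasDerivAt B (B' x) x)
    (dB' : ∀ x, HasDerivAt B' (B'' x) x)
    (sA : HasCompactSupport A) (sA' : HasCompactSupport A') (sB : HasCompactSupport B)
    (sB' : HasCompactSupport B') (sB'' : HasCompactSupport B'') :
    ∃ c₃ c₄ : ℝ, ∀ t : ℝ, memE (wave A B B' r t) ∧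
      P2 (wave A B B' r t) = t ^ 2 * r * ((∫ x, A x ^ 2) * ∫ y, B' y ^ 2) ∧
      Efun (wave A B B' r t) = t ^ 2 * ((∫ x, A x ^ 2) * (∫ y, B' y ^ 2) + 1 / 4 *
        ((∫ x, A' x ^ 2) * (∫ y, B' y ^ 2) + 2 * ((∫ x, A' x ^ 2) * ∫ y, B y ^ 2) +
          (∫ x, A x ^ 2) * ∫ y, B'' y ^ 2)) + t ^ 3 * c₃ + t ^ 4 * c₄ := by
  have cA := hA.continuous
  have cB := hB.continuous
  have cB' := hB'.continuous
  have int : ∀ {F : ℝ → ℝ} (_ : Continuous F) (_ : HasCompactSupport F) (n : ℕ),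
      Integrable fun x => F x ^ (n + 1) := by
    intro F cF sF n
    refine Continuous.integrable_of_hasCompactSupport (cF.pow _) ?_
    exact sF.comp_left (g := fun x : ℝ => x ^ (n + 1)) (by simp)
  have iA2 := int cA sA 1
  have iA'2 := int cA' sA' 1
  have iB2 := int cB sB 1
  have iB'2 := int cB' sB' 1
  have iB''2 := int cB'' sB'' 1
  have iB3 : Integrable fun y => B' y ^ 3 / 2 + B' y * B y ^ 2 := by
    refine ((int cB' sB' 2).div_const 2).add ?_
    exact Continuous.integrable_of_hasCompactSupport (by fun_prop) sB'.mul_right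
  have iB4 : Integrable fun y => (B' y ^ 2 / 2 + B y ^ 2) ^ 2 := by
    have h1 : Integrable fun y => B' y ^ 2 * B y ^ 2 := by
      refine Continuous.integrable_of_hasCompactSupport (by fun_prop) (HasCompactSupport.mul_right ?_)
      exact sB'.comp_left (g := fun x : ℝ => x ^ 2) (by simp)
    refine ((((int cB' sB' 3).div_const 4).add h1).add (int cB sB 3)).congr
      (Eventually.of_forall fun y => ?_)
    simp only [Pi.add_apply]
    ring
  have iBB : Integrable fun y => B y * B'' y :=
    Continuous.integrable_of_hasCompactSupport (by fun_prop) sB.mul_right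
  have hibp : ∫ y, B y * B'' y = -∫ y, B' y ^ 2 := by
    rw [integral_mul_deriv_eq_deriv_mul_of_integrable (fun x _ => dB x) (fun x _ => dB' x) iBB]
    · simp_rw [sq]
    · have : B' * B' = fun x => B' x ^ (1 + 1) := by funext x; simp [sq]
      rwa [this]
    · exact Continuous.integrable_of_hasCompactSupport (by fun_prop) sB.mul_right
  have hdens : ∀ (t : ℝ) (z : ℂ), energyDensity (wave A B B' r t) z =
      t ^ 2 * (A z.re ^ 2 * B' z.im ^ 2) + t ^ 2 / 4 * (A' z.re ^ 2 * B' z.im ^ 2) +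
      t ^ 2 / 2 * (A' z.re ^ 2 * B z.im ^ 2) + t ^ 2 / 4 * (A z.re ^ 2 * B'' z.im ^ 2) +
      t ^ 3 * (-r) * (A z.re ^ 3 * (B' z.im ^ 3 / 2 + B' z.im * B z.im ^ 2)) +
      t ^ 4 / 4 * (A z.re ^ 4 * (B' z.im ^ 2 / 2 + B z.im ^ 2) ^ 2) := by
    intro t z
    unfold energyDensity gradSq
    rw [pd1_wave hA hB hB' dA, pd2_wave hA hB hB' dB dB']
    simp only [Complex.sq_norm, Complex.normSq_apply, wave]
    simp
    generalize A z.re = a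
    generalize A' z.re = a'
    generalize B z.im = b
    generalize B' z.im = b'
    generalize B'' z.im = b''
    have hr3 : r ^ 3 = r / 2 := by rw [pow_succ, hr]; ring
    have hr4 : r ^ 4 = 1 / 4 := by
      have : r ^ 4 = (r ^ 2) ^ 2 := by ring
      rw [this, hr]; norm_num
    ring_nf
    rw [hr3, hr4, hr]
    ring
  have hmom : ∀ (t : ℝ) (z : ℂ), momDensity (wave A B B' r t) z =
      t ^ 2 * r * (A z.re ^ 2 * B' z.im ^ 2) - t ^ 2 * r * (A z.re ^ 2 * (B z.im * B'' z.im)) := by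
    intro t z
    unfold momDensity
    rw [pd2_wave hA hB hB' dB dB']
    simp [wave]
    ring
  set c₃ := -r * ((∫ x, A x ^ 3) * ∫ y, (B' y ^ 3 / 2 + B' y * B y ^ 2)) with hc₃
  set c₄ := 1 / 4 * ((∫ x, A x ^ 4) * ∫ y, (B' y ^ 2 / 2 + B y ^ 2) ^ 2) with hc₄
  refine ⟨c₃, c₄, fun t => ?_⟩
  have hsm := contDiff_wave (r := r) hA hB hB' t
  have i1 := (integrable_re_mul_im iA2 iB'2).const_mul (t ^ 2)
  have i2 := (integrable_re_mul_im iA'2 iB'2).const_mul (t ^ 2 / 4)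
  have i3 := (integrable_re_mul_im iA'2 iB2).const_mul (t ^ 2 / 2)
  have i4 := (integrable_re_mul_im iA2 iB''2).const_mul (t ^ 2 / 4)
  have i5 := (integrable_re_mul_im (int cA sA 2) iB3).const_mul (t ^ 3 * (-r))
  have i6 := (integrable_re_mul_im (int cA sA 3) iB4).const_mul (t ^ 4 / 4)
  simp only [Nat.reduceAdd] at i1 i2 i3 i4 i5 i6
  have hE : energyDensity (wave A B B' r t) = _ := funext (hdens t)
  refine ⟨memE_of_integrable hsm ?_, ?_, ?_⟩
  · rw [hE]
    exact ((((i1.add i2).add i3).add i4).add i5).add i6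
  · unfold P2
    simp_rw [hmom]
    rw [integral_sub, integral_const_mul, integral_const_mul,
      integral_re_mul_im (fun x => A x ^ 2) (fun y => B' y ^ 2),
      integral_re_mul_im (fun x => A x ^ 2) (fun y => B y * B'' y), hibp]
    · ring
    · exact (integrable_re_mul_im iA2 iB'2).const_mul _
    · exact (integrable_re_mul_im iA2 iBB).const_mul _
  · rw [Efun_eq_integral hsm, hE]
    refine (integral_add' ((((i1.add i2).add i3).add i4).add i5) i6).trans ?_
    rw [integral_add' (((i1.add i2).add i3).add i4) i5,
      integral_add' ((i1.add i2).add i3) i4, integral_add' (i1.add i2) i3, integral_add' i1 i2]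
    simp only [integral_const_mul]
    rw [integral_re_mul_im (fun x => A x ^ 2) (fun y => B' y ^ 2),
      integral_re_mul_im (fun x => A' x ^ 2) (fun y => B' y ^ 2),
      integral_re_mul_im (fun x => A' x ^ 2) (fun y => B y ^ 2),
      integral_re_mul_im (fun x => A x ^ 2) (fun y => B'' y ^ 2),
      integral_re_mul_im (fun x => A x ^ 3) (fun y => B' y ^ 3 / 2 + B' y * B y ^ 2),
      integral_re_mul_im (fun x => A x ^ 4) (fun y => (B' y ^ 2 / 2 + B y ^ 2) ^ 2), hc₃, hc₄]
    ring

end wave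

lemma exists_slow_wave {ε p : ℝ} (hε : 0 < ε) (hp : 0 < p) :
    ∃ u, memE u ∧ 0 < P2 u ∧ P2 u < p ∧ Efun u ≤ (√2 + ε) * P2 u := by
  let b : ContDiffBump (0 : ℝ) := ⟨1, 2, one_pos, one_lt_two⟩
  set f : ℝ → ℝ := fun x => b x
  have hf : ContDiff ℝ (⊤ : ℕ∞) f := b.contDiff
  have sf : HasCompactSupport f := b.hasCompactSupport
  have hf1 : ContDiff ℝ (⊤ : ℕ∞) (deriv f) := (contDiff_infty_iff_deriv.1 hf).2
  have hf2 : ContDiff ℝ (⊤ : ℕ∞) (deriv (deriv f)) := (contDiff_infty_iff_deriv.1 hf1).2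
  have sf1 : HasCompactSupport (deriv f) := sf.deriv
  have sf2 : HasCompactSupport (deriv (deriv f)) := sf1.deriv
  have df : ∀ x, HasDerivAt f (deriv f x) x := fun x =>
    (hf.differentiable (by simp) x).hasDerivAt
  have df1 : ∀ x, HasDerivAt (deriv f) (deriv (deriv f) x) x := fun x =>
    (hf1.differentiable (by simp) x).hasDerivAt
  have pos : ∀ {F : ℝ → ℝ}, Continuous F → HasCompactSupport F → (∃ x, F x ≠ 0) →
      0 < ∫ x, F x ^ 2 := by
    rintro F cF sF ⟨x, hx⟩
    refine (cF.pow 2).integral_pos_of_hasCompactSupport_nonneg_nonzero (x := x) ?_ ?_ ?_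
    · exact sF.comp_left (g := fun x : ℝ => x ^ 2) (by simp)
    · exact fun y => sq_nonneg _
    · exact pow_ne_zero 2 hx
  have hf0 : f 0 = 1 := b.one_of_mem_closedBall (by simp [b])
  have hf3 : f 3 = 0 := b.zero_of_le_dist (by simp [b]; norm_num)
  have hφ0 := pos hf.continuous sf ⟨0, by rw [hf0]; exact one_ne_zero⟩
  have hφ1 := pos hf1.continuous sf1 (by
    by_contra! h
    have := is_const_of_deriv_eq_zero (hf.differentiable (by simp)) h 0 3
    rw [hf0, hf3] at this
    exact one_ne_zero this)
  set φ0 := ∫ x, f x ^ 2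
  set φ1 := ∫ x, deriv f x ^ 2
  set φ2 := ∫ x, deriv (deriv f) x ^ 2
  have hφ2 : 0 ≤ φ2 := integral_nonneg fun x => sq_nonneg _
  -- choice of the slow scale
  obtain ⟨s, hs0, hs⟩ : ∃ s > 0, s ^ 3 * φ1 * φ1 + 2 * (s * φ1 * φ0) + s * φ0 * φ2 ≤
      ε * (s⁻¹ * φ0 * φ1) := by
    have hlim : Tendsto (fun s : ℝ => s ^ 4 * φ1 * φ1 + 2 * (s ^ 2 * φ1 * φ0) + s ^ 2 * φ0 * φ2)
        (nhdsWithin 0 (Set.Ioi 0)) (nhds 0) := by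
      have : Continuous (fun s : ℝ =>
          s ^ 4 * φ1 * φ1 + 2 * (s ^ 2 * φ1 * φ0) + s ^ 2 * φ0 * φ2) := by fun_prop
      simpa using (this.tendsto 0).mono_left (nhdsWithin_le_nhds (s := Set.Ioi 0))
    have hpos : 0 < ε * (φ0 * φ1) := by positivity
    obtain ⟨s, hs, hs0⟩ := ((hlim.eventually (gt_mem_nhds hpos)).and self_mem_nhdsWithin).exists
    refine ⟨s, hs0, ?_⟩
    have h1 : ε * (s⁻¹ * φ0 * φ1) = ε * (φ0 * φ1) / s := by field_simp
    rw [h1, le_div_iff₀ hs0]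
    nlinarith
  have hscale : ∀ (F : ℝ → ℝ) (l c : ℝ), 0 < l → ∫ x, (c * F (l * x)) ^ 2 =
      c ^ 2 * l⁻¹ * ∫ x, F x ^ 2 := by
    intro F l c hl
    have := Measure.integral_comp_mul_left (fun x => F x ^ 2) l
    simp only [smul_eq_mul] at this
    simp_rw [mul_pow]
    rw [integral_const_mul, this, abs_of_pos (inv_pos.2 hl)]
    ring
  have sm : ∀ {F : ℝ → ℝ} (l c : ℝ), ContDiff ℝ (⊤ : ℕ∞) F →
      ContDiff ℝ (⊤ : ℕ∞) fun x => c * F (l * x) := fun l c hF =>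
    contDiff_const.mul (hF.comp (contDiff_const.mul contDiff_id))
  have cs : ∀ {F : ℝ → ℝ} (l c : ℝ), l ≠ 0 → HasCompactSupport F →
      HasCompactSupport fun x => c * F (l * x) := fun l c hl hF =>
    (hF.comp_smul hl).mul_left
  have ds : ∀ {F F' : ℝ → ℝ} (l c : ℝ), (∀ x, HasDerivAt F (F' x) x) →
      ∀ x, HasDerivAt (fun x => c * F (l * x)) (c * l * F' (l * x)) x := by
    intro F F' l c hF x
    have h1 : HasDerivAt (fun x : ℝ => l * x) l x := by
      simpa using (hasDerivAt_id x).const_mul l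
    have := ((hF (l * x)).comp x h1).const_mul c
    rw [show c * l * F' (l * x) = c * (F' (l * x) * l) by ring]
    exact this
  have hs2 : 0 < s ^ 2 := by positivity
  set r : ℝ := √2 / 2 with hr
  have hr2 : r ^ 2 = 1 / 2 := by rw [hr, div_pow, Real.sq_sqrt (by norm_num)]; norm_num
  have hr0 : 0 < r := by positivity
  obtain ⟨c₃, c₄, H⟩ := wave_energy_momentum (r := r)
    (A := fun x => 1 * f (s ^ 2 * x)) (A' := fun x => 1 * s ^ 2 * deriv f (s ^ 2 * x))
    (B := fun x => 1 * f (s * x)) (B' := fun x => 1 * s * deriv f (s * x))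
    (B'' := fun x => 1 * s * s * deriv (deriv f) (s * x)) hr2
    (sm _ _ hf) (sm _ _ hf) (sm _ _ hf1) (sm _ _ hf1).continuous (sm _ _ hf2).continuous
    (ds _ _ df) (ds _ _ df) (ds _ _ df1) (cs _ _ hs2.ne' sf) (cs _ _ hs2.ne' sf1)
    (cs _ _ hs0.ne' sf) (cs _ _ hs0.ne' sf1) (cs _ _ hs0.ne' sf2)
  simp only [hscale _ _ _ hs2, hscale _ _ _ hs0] at H
  set m := s⁻¹ * φ0 * φ1 with hm
  have hm0 : 0 < m := by positivity
  have e1 : 1 ^ 2 * (s ^ 2)⁻¹ * φ0 * ((1 * s) ^ 2 * s⁻¹ * φ1) = m := by rw [hm]; field_simp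
  have e2 : (1 * s ^ 2) ^ 2 * (s ^ 2)⁻¹ * φ1 * ((1 * s) ^ 2 * s⁻¹ * φ1) +
      2 * ((1 * s ^ 2) ^ 2 * (s ^ 2)⁻¹ * φ1 * (1 ^ 2 * s⁻¹ * φ0)) +
      1 ^ 2 * (s ^ 2)⁻¹ * φ0 * ((1 * s * s) ^ 2 * s⁻¹ * φ2) =
      s ^ 3 * φ1 * φ1 + 2 * (s * φ1 * φ0) + s * φ0 * φ2 := by field_simp
  simp only [φ0, φ1, φ2] at e1 e2
  simp only [e1, e2] at H
  -- choice of the amplitude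
  have hlim1 : Tendsto (fun t : ℝ => t ^ 2 * r * m) (nhdsWithin 0 (Set.Ioi 0)) (nhds 0) := by
    have : Continuous (fun t : ℝ => t ^ 2 * r * m) := by fun_prop
    simpa using (this.tendsto 0).mono_left (nhdsWithin_le_nhds (s := Set.Ioi 0))
  have hlim2 : Tendsto (fun t : ℝ => t * c₃ + t ^ 2 * c₄) (nhdsWithin 0 (Set.Ioi 0))
      (nhds 0) := by
    have : Continuous (fun t : ℝ => t * c₃ + t ^ 2 * c₄) := by fun_prop
    simpa using (this.tendsto 0).mono_left (nhdsWithin_le_nhds (s := Set.Ioi 0))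
  have hpos2 : 0 < ε * m / 4 := by positivity
  obtain ⟨t, ⟨ht1, ht2⟩, ht0⟩ := (((hlim1.eventually (gt_mem_nhds hp)).and
    (hlim2.eventually (gt_mem_nhds hpos2))).and self_mem_nhdsWithin).exists
  obtain ⟨hmem, hP, hE⟩ := H t
  refine ⟨_, hmem, ?_, ?_, ?_⟩
  · rw [hP]; positivity
  · rw [hP]; exact ht1
  · rw [hE, hP]
    have h2r : √2 * r = 1 := by
      rw [hr, ← mul_div_assoc, Real.mul_self_sqrt (by norm_num)]; norm_num
    have hr1 : 1 / 2 ≤ r := by nlinarith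
    have e3 : (√2 + ε) * (t ^ 2 * r * m) = t ^ 2 * (m + ε * r * m) := by
      linear_combination t ^ 2 * m * h2r
    have e4 : ∀ Q : ℝ, t ^ 2 * Q + t ^ 3 * c₃ + t ^ 4 * c₄ = t ^ 2 * (Q + (t * c₃ + t ^ 2 * c₄)) := by
      intro Q; ring
    rw [e3, e4]
    refine mul_le_mul_of_nonneg_left ?_ (sq_nonneg t)
    have h5 : ε * m * (1 / 2) ≤ ε * m * r := by gcongr
    linarith

lemma exists_memE_P2_eq {p : ℝ} (hp : 0 ≤ p) : ∃ u, memE u ∧ P2 u = p := by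
  obtain ⟨u, hu, hu0, -, -⟩ := exists_slow_wave (ε := 1) (p := 1) one_pos one_pos
  rcases hp.eq_or_lt with rfl | hp
  · refine ⟨fun _ => 1, ⟨contDiff_const, ?_⟩, ?_⟩
    · simp [energy, energyDensity, gradSq, pd1, pd2]
    · simp [P2, momDensity, pd2]
  · obtain ⟨w, hw, hP, -⟩ := exists_stretch hu (l := P2 u / p) (by positivity)
    refine ⟨w, hw, ?_⟩
    rw [hP]
    field_simp

lemma Emin_midpoint {p q : ℝ} (hp : 0 ≤ p) (hq : 0 ≤ q) :
    Emin p + Emin q ≤ 2 * Emin ((p + q) / 2) := by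
  obtain ⟨u, hu, hP⟩ := exists_memE_P2_eq (p := (p + q) / 2) (by positivity)
  have : (Emin p + Emin q) / 2 ≤ Emin ((p + q) / 2) := by
    refine le_csInf ⟨_, u, ⟨hu, hP⟩, rfl⟩ ?_
    rintro _ ⟨v, ⟨hv, hPv⟩, rfl⟩
    linarith [Emin_midpoint_of_mem hv hp hq hPv]
  linarith

lemma concaveOn_Emin : ConcaveOn ℝ (Set.Ici (0 : ℝ)) Emin :=
  concaveOn_of_midpoint (fun x _ => Emin_nonneg x) fun _ _ hx hy => Emin_midpoint hx hy

lemma monotoneOn_Emin : MonotoneOn Emin (Set.Ici (0 : ℝ)) :=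
  monotoneOn_of_midpoint (fun x _ => Emin_nonneg x) fun _ _ hx hy => Emin_midpoint hx hy

lemma mul_Emin_le {p q : ℝ} (hp : 0 < p) (hpq : p ≤ q) : p * Emin q ≤ q * Emin p := by
  have hq := hp.trans_le hpq
  have h1 : 0 ≤ 1 - p / q := by rw [sub_nonneg, div_le_one hq]; exact hpq
  have h2 : 0 ≤ p / q := by positivity
  have h := concaveOn_Emin.2 (Set.mem_Ici.2 le_rfl) (Set.mem_Ici.2 hq.le) h1 h2 (by ring)
  simp only [smul_eq_mul, mul_zero, zero_add, Emin_zero, div_mul_cancel₀ p hq.ne'] at h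
  rw [div_mul_eq_mul_div, div_le_iff₀ hq] at h
  linarith

lemma Emin_le_sqrt_two_mul {p : ℝ} (hp : 0 ≤ p) : Emin p ≤ √2 * p := by
  rcases hp.eq_or_lt with rfl | hp
  · simp [Emin_zero]
  have key : ∀ ε > 0, Emin p ≤ √2 * p + ε * p := by
    intro ε hε
    obtain ⟨u, hu, h0, hlt, hE⟩ := exists_slow_wave hε hp
    have h1 := mul_Emin_le h0 hlt.le
    have h2 := (Emin_le hu).trans hE
    have h3 : P2 u * Emin p ≤ P2 u * (√2 * p + ε * p) := by nlinarith
    exact le_of_mul_le_mul_left h3 h0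
  refine le_of_forall_pos_le_add fun ε hε => ?_
  have := key (ε / p) (by positivity)
  rwa [div_mul_cancel₀ _ hp.ne'] at this

lemma Emin_sub_le {p q : ℝ} (hp : 0 ≤ p) (hpq : p ≤ q) : Emin q - Emin p ≤ √2 * (q - p) := by
  rcases hp.eq_or_lt with rfl | hp
  · simpa [Emin_zero] using Emin_le_sqrt_two_mul hpq
  have h1 := mul_Emin_le hp hpq
  have h2 := Emin_le_sqrt_two_mul hp.le
  have h3 : p * (Emin q - Emin p) ≤ p * (√2 * (q - p)) := by
    nlinarith [mul_le_mul_of_nonneg_left h2 (sub_nonneg.2 hpq)]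
  exact le_of_mul_le_mul_left h3 hp

lemma lipschitzOnWith_Emin :
    LipschitzOnWith (Real.toNNReal (Real.sqrt 2)) Emin (Set.Ici (0 : ℝ)) := by
  have key : ∀ p q : ℝ, 0 ≤ p → p ≤ q → |Emin p - Emin q| ≤ √2 * |p - q| := by
    intro p q hp hpq
    rw [abs_sub_comm, abs_sub_comm p, abs_of_nonneg (sub_nonneg.2 hpq), abs_of_nonneg
      (sub_nonneg.2 (monotoneOn_Emin hp (hp.trans hpq) hpq))]
    exact Emin_sub_le hp hpq
  refine LipschitzOnWith.of_dist_le_mul fun p hp q hq => ?_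
  rw [Real.coe_toNNReal _ (Real.sqrt_nonneg 2), Real.dist_eq, Real.dist_eq]
  rcases le_total p q with h | h
  · exact key p q hp h
  · rw [abs_sub_comm, abs_sub_comm p]
    exact key q p hq h

section dipoleAlgebra

variable {x y a G H : ℝ}

lemma dipole_gradient_identity (hG : G * (1 + (x - a) ^ 2 + y ^ 2) = 1)
    (hH : H * (1 + (x + a) ^ 2 + y ^ 2) = 1) :
    (2 * x - (x ^ 2 + y ^ 2 - a ^ 2) * ((x - a) * G + (x + a) * H)) ^ 2 +
      (2 * a * y * ((x - a) * G + (x + a) * H)) ^ 2 +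
      (2 * y - (x ^ 2 + y ^ 2 - a ^ 2) * (y * (G + H))) ^ 2 +
      (2 * a - 2 * a * y * (y * (G + H))) ^ 2 =
    4 * a ^ 2 + ((x + a) ^ 2 + y ^ 2) * G ^ 2 + ((x - a) ^ 2 + y ^ 2) * H ^ 2 +
      2 * G * H * (x ^ 2 + y ^ 2 - a ^ 2) := by
  have hP : (1 + (x - a) ^ 2 + y ^ 2) ≠ 0 := by positivity
  have hM : (1 + (x + a) ^ 2 + y ^ 2) ≠ 0 := by positivity
  rw [eq_div_of_mul_eq hP hG, eq_div_of_mul_eq hM hH]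
  field_simp
  ring

lemma dipole_gradient_le (hG0 : 0 < G) (hH0 : 0 < H) (hG : G * (1 + (x - a) ^ 2 + y ^ 2) = 1)
    (hH : H * (1 + (x + a) ^ 2 + y ^ 2) = 1) :
    G * H * (4 * a ^ 2 + ((x + a) ^ 2 + y ^ 2) * G ^ 2 + ((x - a) ^ 2 + y ^ 2) * H ^ 2 +
      2 * G * H * (x ^ 2 + y ^ 2 - a ^ 2)) ≤ 4 * a ^ 2 * (G * H) + 2 * (G ^ 2 + H ^ 2) := by
  have hG1 : G ≤ 1 := by nlinarith [mul_nonneg hG0.le (sq_nonneg (x - a)), mul_nonneg hG0.le (sq_nonneg y)]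
  have hH1 : H ≤ 1 := by nlinarith [mul_nonneg hH0.le (sq_nonneg (x + a)), mul_nonneg hH0.le (sq_nonneg y)]
  have h1 : G * H * (((x + a) ^ 2 + y ^ 2) * G ^ 2) ≤ G ^ 2 := by
    have : G * H * (((x + a) ^ 2 + y ^ 2) * G ^ 2) = G ^ 3 * (1 - H) := by
      linear_combination G ^ 3 * hH
    rw [this]
    nlinarith [pow_pos hG0 2, pow_pos hG0 3]
  have h2 : G * H * (((x - a) ^ 2 + y ^ 2) * H ^ 2) ≤ H ^ 2 := by
    have : G * H * (((x - a) ^ 2 + y ^ 2) * H ^ 2) = H ^ 3 * (1 - G) := by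
      linear_combination H ^ 3 * hG
    rw [this]
    nlinarith [pow_pos hH0 2, pow_pos hH0 3]
  have h3 : G * H * (2 * G * H * (x ^ 2 + y ^ 2 - a ^ 2)) ≤ G ^ 2 + H ^ 2 := by
    have : G * H * (2 * G * H * (x ^ 2 + y ^ 2 - a ^ 2)) =
        G * H * (G + H) - 2 * (G * H) ^ 2 * (1 + 2 * a ^ 2) := by
      linear_combination G * H ^ 2 * hG + G ^ 2 * H * hH
    rw [this]
    have : 0 ≤ 2 * (G * H) ^ 2 * (1 + 2 * a ^ 2) := by positivity
    have : G * H * (G + H) ≤ G * H * 2 := mul_le_mul_of_nonneg_left (by linarith) (by positivity)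
    nlinarith [sq_nonneg (G - H)]
  nlinarith

lemma dipole_modulus (hG : G * (1 + (x - a) ^ 2 + y ^ 2) = 1)
    (hH : H * (1 + (x + a) ^ 2 + y ^ 2) = 1) :
    G * H * ((x ^ 2 + y ^ 2 - a ^ 2) ^ 2 + (2 * a * y) ^ 2) = (1 - G) * (1 - H) := by
  linear_combination (1 - H) * hG + G * ((x - a) ^ 2 + y ^ 2) * hH

end dipoleAlgebra

/-- Squared modulus profile deficit of a vortex centred at `(a, 0)`. -/
def vortexCore (a : ℝ) (z : ℂ) : ℝ := (1 + (z.re - a) ^ 2 + z.im ^ 2)⁻¹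

lemma vortexCore_pos (a : ℝ) (z : ℂ) : 0 < vortexCore a z := by
  unfold vortexCore; positivity

lemma vortexCore_mul (a : ℝ) (z : ℂ) : vortexCore a z * (1 + (z.re - a) ^ 2 + z.im ^ 2) = 1 :=
  inv_mul_cancel₀ (by positivity)

lemma vortexCore_neg_mul (a : ℝ) (z : ℂ) :
    vortexCore (-a) z * (1 + (z.re + a) ^ 2 + z.im ^ 2) = 1 := by
  simpa using vortexCore_mul (-a) z

lemma vortexCore_eq_norm (a : ℝ) (z : ℂ) : vortexCore a z = (1 + ‖z - a‖ ^ 2)⁻¹ := by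
  rw [vortexCore, Complex.sq_norm, Complex.normSq_apply]
  simp only [Complex.sub_re, Complex.ofReal_re, Complex.sub_im, Complex.ofReal_im]
  ring_nf

lemma vortexCore_le_one (a : ℝ) (z : ℂ) : vortexCore a z ≤ 1 :=
  inv_le_one_of_one_le₀ (by nlinarith [sq_nonneg (z.re - a), sq_nonneg z.im])

lemma contDiff_vortexCore (a : ℝ) : ContDiff ℝ (⊤ : ℕ∞) (vortexCore a) := by
  have h1 : ContDiff ℝ (⊤ : ℕ∞) (fun z : ℂ => z.re) := Complex.reCLM.contDiff
  have h2 : ContDiff ℝ (⊤ : ℕ∞) (fun z : ℂ => z.im) := Complex.imCLM.contDiff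
  exact ((contDiff_const.add ((h1.sub contDiff_const).pow 2)).add (h2.pow 2)).inv
    fun z => by positivity

lemma hasDerivAt_vortexCore_re (a : ℝ) (z : ℂ) :
    HasDerivAt (fun t : ℝ => vortexCore a ⟨t, z.im⟩)
      (-2 * vortexCore a z * ((z.re - a) * vortexCore a z)) z.re := by
  have h := (((((hasDerivAt_id z.re).sub_const a).fun_pow 2).const_add 1).add_const
    (z.im ^ 2)).fun_inv (by simp; positivity)
  refine h.congr_deriv ?_
  simp [vortexCore]
  field_simp

lemma hasDerivAt_vortexCore_im (a : ℝ) (z : ℂ) :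
    HasDerivAt (fun t : ℝ => vortexCore a ⟨z.re, t⟩)
      (-2 * vortexCore a z * (z.im * vortexCore a z)) z.im := by
  have h := (((hasDerivAt_id z.im).fun_pow 2).const_add (1 + (z.re - a) ^ 2)).fun_inv
    (by simp; positivity)
  refine h.congr_deriv ?_
  simp [vortexCore]
  field_simp

/-- Common modulus factor of the vortex dipole. -/
def dipoleFactor (a : ℝ) (z : ℂ) : ℝ := √(vortexCore a z * vortexCore (-a) z)

lemma dipoleFactor_pos (a : ℝ) (z : ℂ) : 0 < dipoleFactor a z :=
  Real.sqrt_pos.2 (mul_pos (vortexCore_pos _ _) (vortexCore_pos _ _))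

lemma sq_dipoleFactor (a : ℝ) (z : ℂ) :
    dipoleFactor a z ^ 2 = vortexCore a z * vortexCore (-a) z :=
  Real.sq_sqrt (mul_pos (vortexCore_pos _ _) (vortexCore_pos _ _)).le

lemma contDiff_dipoleFactor (a : ℝ) : ContDiff ℝ (⊤ : ℕ∞) (dipoleFactor a) :=
  ((contDiff_vortexCore a).mul (contDiff_vortexCore (-a))).sqrt
    fun _ => (mul_pos (vortexCore_pos _ _) (vortexCore_pos _ _)).ne'

lemma HasDerivAt.sqrt_of_log {f : ℝ → ℝ} {s t : ℝ} (hf : HasDerivAt f (-2 * f t * s) t)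
    (h0 : 0 < f t) : HasDerivAt (fun x => √(f x)) (-√(f t) * s) t := by
  refine (hf.sqrt h0.ne').congr_deriv ?_
  have h1 : √(f t) ≠ 0 := (Real.sqrt_pos.2 h0).ne'
  field_simp
  rw [Real.sq_sqrt h0.le, mul_comm]

lemma hasDerivAt_dipoleFactor_re (a : ℝ) (z : ℂ) :
    HasDerivAt (fun t : ℝ => dipoleFactor a ⟨t, z.im⟩) (-dipoleFactor a z *
      ((z.re - a) * vortexCore a z + (z.re + a) * vortexCore (-a) z)) z.re := by
  refine HasDerivAt.sqrt_of_log (f := fun t : ℝ => vortexCore a ⟨t, z.im⟩ *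
    vortexCore (-a) ⟨t, z.im⟩) ?_ (mul_pos (vortexCore_pos _ _) (vortexCore_pos _ _))
  refine ((hasDerivAt_vortexCore_re a z).fun_mul (hasDerivAt_vortexCore_re (-a) z)).congr_deriv ?_
  simp only [sub_neg_eq_add, Complex.eta]
  ring

lemma hasDerivAt_dipoleFactor_im (a : ℝ) (z : ℂ) :
    HasDerivAt (fun t : ℝ => dipoleFactor a ⟨z.re, t⟩) (-dipoleFactor a z *
      (z.im * (vortexCore a z + vortexCore (-a) z))) z.im := by
  refine HasDerivAt.sqrt_of_log (f := fun t : ℝ => vortexCore a ⟨z.re, t⟩ *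
    vortexCore (-a) ⟨z.re, t⟩) ?_ (mul_pos (vortexCore_pos _ _) (vortexCore_pos _ _))
  refine ((hasDerivAt_vortexCore_im a z).fun_mul (hasDerivAt_vortexCore_im (-a) z)).congr_deriv ?_
  simp only [Complex.eta]
  ring

/-- A pair of vortices of opposite degrees centred at `(± a, 0)`. -/
def dipole (a : ℝ) (z : ℂ) : ℂ :=
  (dipoleFactor a z : ℂ) * ⟨z.re ^ 2 + z.im ^ 2 - a ^ 2, 2 * a * z.im⟩

lemma dipole_eq (a : ℝ) (z : ℂ) : dipole a z =
    ((dipoleFactor a z * (z.re ^ 2 + z.im ^ 2 - a ^ 2) : ℝ) : ℂ) +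
      Complex.I * ((dipoleFactor a z * (2 * a * z.im) : ℝ) : ℂ) := by
  rw [dipole]
  apply Complex.ext <;> simp only [Complex.add_re, Complex.add_im, Complex.mul_re,
    Complex.mul_im, Complex.I_re, Complex.I_im, Complex.ofReal_re, Complex.ofReal_im] <;> ring

lemma contDiff_dipole (a : ℝ) : ContDiff ℝ (⊤ : ℕ∞) (dipole a) := by
  have h1 : ContDiff ℝ (⊤ : ℕ∞) (fun z : ℂ => z.re) := Complex.reCLM.contDiff
  have h2 : ContDiff ℝ (⊤ : ℕ∞) (fun z : ℂ => z.im) := Complex.imCLM.contDiff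
  have h3 := contDiff_dipoleFactor a
  rw [show dipole a = _ from funext (dipole_eq a)]
  exact (Complex.ofRealCLM.contDiff.comp
    (h3.mul (((h1.pow 2).add (h2.pow 2)).sub contDiff_const))).add
    (contDiff_const.mul (Complex.ofRealCLM.contDiff.comp (h3.mul (contDiff_const.mul h2))))

lemma pd1_dipole (a : ℝ) (z : ℂ) : pd1 (dipole a) z = (dipoleFactor a z : ℂ) *
    ⟨2 * z.re - (z.re ^ 2 + z.im ^ 2 - a ^ 2) *
        ((z.re - a) * vortexCore a z + (z.re + a) * vortexCore (-a) z),
      -(2 * a * z.im * ((z.re - a) * vortexCore a z + (z.re + a) * vortexCore (-a) z))⟩ := by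
  refine pd1_eq ((contDiff_dipole a).differentiable (by simp) z) ?_
  simp_rw [dipole_eq]
  have h1 := hasDerivAt_dipoleFactor_re a z
  have h2 : HasDerivAt (fun t : ℝ => t ^ 2 + z.im ^ 2 - a ^ 2) (2 * z.re) z.re := by
    simpa using (((hasDerivAt_id z.re).fun_pow 2).add_const (z.im ^ 2)).sub_const (a ^ 2)
  refine ((h1.fun_mul h2).ofReal_comp.fun_add
    ((h1.mul_const (2 * a * z.im)).ofReal_comp.const_mul Complex.I)).congr_deriv ?_
  apply Complex.ext <;> simp only [Complex.add_re, Complex.add_im, Complex.mul_re,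
    Complex.mul_im, Complex.I_re, Complex.I_im, Complex.ofReal_re, Complex.ofReal_im] <;> ring

lemma pd2_dipole (a : ℝ) (z : ℂ) : pd2 (dipole a) z = (dipoleFactor a z : ℂ) *
    ⟨2 * z.im - (z.re ^ 2 + z.im ^ 2 - a ^ 2) * (z.im * (vortexCore a z + vortexCore (-a) z)),
      2 * a - 2 * a * z.im * (z.im * (vortexCore a z + vortexCore (-a) z))⟩ := by
  refine pd2_eq ((contDiff_dipole a).differentiable (by simp)) ?_
  simp_rw [dipole_eq]
  have h1 := hasDerivAt_dipoleFactor_im a z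
  have h2 : HasDerivAt (fun t : ℝ => z.re ^ 2 + t ^ 2 - a ^ 2) (2 * z.im) z.im := by
    simpa using (((hasDerivAt_id z.im).fun_pow 2).const_add (z.re ^ 2)).sub_const (a ^ 2)
  have h3 : HasDerivAt (fun t : ℝ => 2 * a * t) (2 * a) z.im := by
    simpa using (hasDerivAt_id z.im).const_mul (2 * a)
  refine ((h1.fun_mul h2).ofReal_comp.fun_add
    ((h1.fun_mul h3).ofReal_comp.const_mul Complex.I)).congr_deriv ?_
  apply Complex.ext <;> simp only [Complex.add_re, Complex.add_im, Complex.mul_re,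
    Complex.mul_im, Complex.I_re, Complex.I_im, Complex.ofReal_re, Complex.ofReal_im] <;> ring

lemma gradSq_dipole_le (a : ℝ) (z : ℂ) : gradSq (dipole a) z ≤
    4 * a ^ 2 * (vortexCore a z * vortexCore (-a) z) +
      2 * (vortexCore a z ^ 2 + vortexCore (-a) z ^ 2) := by
  refine le_trans (le_of_eq ?_) (dipole_gradient_le (vortexCore_pos a z) (vortexCore_pos (-a) z)
    (vortexCore_mul a z) (vortexCore_neg_mul a z))
  rw [← dipole_gradient_identity (vortexCore_mul a z) (vortexCore_neg_mul a z),
    ← sq_dipoleFactor, gradSq, pd1_dipole, pd2_dipole]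
  simp only [norm_mul, mul_pow, Complex.sq_norm, Complex.normSq_apply, Complex.ofReal_re,
    Complex.ofReal_im]
  ring

lemma sq_norm_dipole (a : ℝ) (z : ℂ) :
    ‖dipole a z‖ ^ 2 = (1 - vortexCore a z) * (1 - vortexCore (-a) z) := by
  rw [← dipole_modulus (vortexCore_mul a z) (vortexCore_neg_mul a z), ← sq_dipoleFactor, dipole]
  simp only [norm_mul, mul_pow, Complex.sq_norm, Complex.normSq_apply, Complex.ofReal_re,
    Complex.ofReal_im]
  ring

lemma energyDensity_dipole_le (a : ℝ) (z : ℂ) : energyDensity (dipole a) z ≤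
    2 * a ^ 2 * (vortexCore a z * vortexCore (-a) z) +
      3 / 2 * (vortexCore a z ^ 2 + vortexCore (-a) z ^ 2) := by
  have h := gradSq_dipole_le a z
  rw [energyDensity, sq_norm_dipole]
  have hG := vortexCore_pos a z
  have hH := vortexCore_pos (-a) z
  have hG1 := vortexCore_le_one a z
  have hH1 := vortexCore_le_one (-a) z
  generalize vortexCore a z = G at *
  generalize vortexCore (-a) z = H at *
  have h2 : (1 - (1 - G) * (1 - H)) ^ 2 ≤ (G + H) ^ 2 := by
    apply pow_le_pow_left₀ <;> nlinarith
  nlinarith [sq_nonneg (G - H)]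

lemma momDensity_dipole (a : ℝ) (z : ℂ) : momDensity (dipole a) z =
    2 * a * (vortexCore a z * vortexCore (-a) z * (z.im ^ 2 + (a ^ 2 - z.re ^ 2))) +
    dipoleFactor a z *
      (2 * a - 2 * a * z.im * (z.im * (vortexCore a z + vortexCore (-a) z))) := by
  rw [momDensity, pd2_dipole, ← sq_dipoleFactor, dipole]
  simp
  ring

/-- Radial majorant of the interaction energy of a vortex dipole of half-width `a`. -/
def interactionBound (a r : ℝ) : ℝ :=
  if r ≤ a then (1 + 3 * r / a) / (1 + r ^ 2) else 4 * a ^ 2 / (1 + r ^ 2) ^ 2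

lemma interactionBound_nonneg {a r : ℝ} (ha : 0 < a) (hr : 0 ≤ r) : 0 ≤ interactionBound a r := by
  unfold interactionBound
  split_ifs <;> positivity

lemma interaction_le_of_le {a r s : ℝ} (ha : 0 < a) (hr : 0 ≤ r) (hrs : r ≤ s)
    (h : 2 * a ≤ r + s) :
    4 * a ^ 2 * ((1 + r ^ 2)⁻¹ * (1 + s ^ 2)⁻¹) ≤ interactionBound a r := by
  have hr1 : 0 < 1 + r ^ 2 := by positivity
  have hs1 : 0 < 1 + s ^ 2 := by positivity
  unfold interactionBound
  split_ifs with hra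
  · have hsa : a ≤ s := by linarith
    have h1 : 4 * a ^ 2 ≤ (1 + 3 * r / a) * (1 + s ^ 2) := by
      have h2 : 3 * r * s ≤ 3 * r / a * s ^ 2 := by
        rw [div_mul_eq_mul_div, le_div_iff₀ ha, mul_assoc, sq]
        exact mul_le_mul_of_nonneg_left (mul_le_mul_of_nonneg_left hsa (hr.trans hrs))
          (by positivity)
      have h3 : 0 ≤ 3 * r / a := by positivity
      nlinarith
    rw [← mul_inv, ← div_eq_mul_inv, div_le_div_iff₀ (by positivity) hr1]
    nlinarith
  · rw [← mul_inv, ← div_eq_mul_inv]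
    gcongr
    rw [sq (1 + r ^ 2)]
    gcongr

lemma interaction_le {a r s : ℝ} (ha : 0 < a) (hr : 0 ≤ r) (hs : 0 ≤ s) (h : 2 * a ≤ r + s) :
    4 * a ^ 2 * ((1 + r ^ 2)⁻¹ * (1 + s ^ 2)⁻¹) ≤
      interactionBound a r + interactionBound a s := by
  have h1 := interactionBound_nonneg ha hr
  have h2 := interactionBound_nonneg ha hs
  rcases le_total r s with hrs | hrs
  · linarith [interaction_le_of_le ha hr hrs h]
  · rw [mul_comm (1 + r ^ 2)⁻¹]
    linarith [interaction_le_of_le ha hs hrs (by linarith)]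

lemma radial_interactionBound {a : ℝ} (ha : 0 < a) :
    IntegrableOn (fun r => r * interactionBound a r) (Set.Ioi 0) ∧
    ∫ r in Set.Ioi 0, r * interactionBound a r ≤ 1 / 2 * Real.log (1 + a ^ 2) + 5 := by
  have hd1 : ∀ r ∈ Set.Ici a, HasDerivAt (fun r : ℝ => -(2 * a ^ 2 * (1 + r ^ 2)⁻¹))
      (r * (4 * a ^ 2 / (1 + r ^ 2) ^ 2)) r := by
    intro r _
    have h := ((((hasDerivAt_id r).fun_pow 2).const_add 1).fun_inv
      (by simp; positivity)).const_mul (2 * a ^ 2) |>.fun_neg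
    refine h.congr_deriv ?_
    simp
    field_simp
    ring
  have hlim : Tendsto (fun r : ℝ => -(2 * a ^ 2 * (1 + r ^ 2)⁻¹)) atTop (nhds 0) := by
    have h : Tendsto (fun r : ℝ => 1 + r ^ 2) atTop atTop :=
      tendsto_atTop_add_const_left _ _ (tendsto_pow_atTop two_ne_zero)
    simpa using (h.inv_tendsto_atTop.const_mul (2 * a ^ 2)).neg
  have hpos : ∀ r ∈ Set.Ioi a, 0 ≤ r * (4 * a ^ 2 / (1 + r ^ 2) ^ 2) := fun r hr =>
    mul_nonneg (ha.trans hr).le (by positivity)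
  have i2 := integrableOn_Ioi_deriv_of_nonneg' hd1 hpos hlim
  have v2 := integral_Ioi_of_hasDerivAt_of_nonneg' hd1 hpos hlim
  have e2 : Set.EqOn (fun r => r * interactionBound a r)
      (fun r => r * (4 * a ^ 2 / (1 + r ^ 2) ^ 2)) (Set.Ioi a) := fun r hr => by
    simp only [interactionBound, if_neg (not_le.2 (Set.mem_Ioi.1 hr))]
  have e1 : Set.EqOn (fun r => r * interactionBound a r)
      (fun r => r * ((1 + 3 * r / a) / (1 + r ^ 2))) (Set.Ioc 0 a) := fun r hr => by
    simp only [interactionBound, if_pos hr.2]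
  have c1 : Continuous fun r : ℝ => r * ((1 + 3 * r / a) / (1 + r ^ 2)) :=
    continuous_id.mul (Continuous.div (by fun_prop) (by fun_prop) fun r => by positivity)
  have i1 : IntegrableOn (fun r => r * ((1 + 3 * r / a) / (1 + r ^ 2))) (Set.Ioc 0 a) :=
    (c1.integrableOn_Icc (a := 0) (b := a)).mono_set Set.Ioc_subset_Icc_self
  have j1 := (integrableOn_congr_fun e1 measurableSet_Ioc).2 i1
  have j2 := (integrableOn_congr_fun e2 measurableSet_Ioi).2 i2
  have hU : Set.Ioc 0 a ∪ Set.Ioi a = Set.Ioi 0 := Set.Ioc_union_Ioi_eq_Ioi ha.le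
  refine ⟨hU ▸ j1.union j2, ?_⟩
  rw [← hU, setIntegral_union (Set.Ioc_disjoint_Ioi le_rfl) measurableSet_Ioi j1 j2,
    setIntegral_congr_fun measurableSet_Ioc e1, setIntegral_congr_fun measurableSet_Ioi e2, v2,
    ← intervalIntegral.integral_of_le ha.le]
  have b2 : 0 - -(2 * a ^ 2 * (1 + a ^ 2)⁻¹) ≤ 2 := by
    have : a ^ 2 * (1 + a ^ 2)⁻¹ ≤ 1 := by
      rw [← div_eq_mul_inv, div_le_one (by positivity)]; linarith
    linarith
  have hd3 : ∀ r ∈ Set.uIcc 0 a, HasDerivAt (fun r : ℝ => 1 / 2 * Real.log (1 + r ^ 2) + 3 / a * r)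
      (r / (1 + r ^ 2) + 3 / a) r := by
    intro r _
    have h0 : HasDerivAt (fun r : ℝ => 1 + r ^ 2) (2 * r) r := by
      simpa using ((hasDerivAt_id r).fun_pow 2).const_add 1
    refine (((h0.log (by positivity)).const_mul (1 / 2)).fun_add
      ((hasDerivAt_id r).const_mul (3 / a))).congr_deriv ?_
    ring
  have c3 : Continuous fun r : ℝ => r / (1 + r ^ 2) + 3 / a :=
    (Continuous.div (by fun_prop) (by fun_prop) fun r => by positivity).add continuous_const
  have v3 := intervalIntegral.integral_eq_sub_of_hasDerivAt hd3 (c3.intervalIntegrable 0 a)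
  have b1 : ∫ r in (0 : ℝ)..a, r * ((1 + 3 * r / a) / (1 + r ^ 2)) ≤
      ∫ r in (0 : ℝ)..a, (r / (1 + r ^ 2) + 3 / a) := by
    refine intervalIntegral.integral_mono_on ha.le (c1.intervalIntegrable 0 a)
      (c3.intervalIntegrable 0 a) fun r hr => ?_
    have : r * ((1 + 3 * r / a) / (1 + r ^ 2)) =
        r / (1 + r ^ 2) + 3 / a * (r ^ 2 / (1 + r ^ 2)) := by ring
    rw [this]
    have h1 : r ^ 2 / (1 + r ^ 2) ≤ 1 := by rw [div_le_one (by positivity)]; linarith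
    have h2 : 0 ≤ 3 / a := by positivity
    nlinarith
  rw [v3] at b1
  simp only [ne_eq, OfNat.ofNat_ne_zero, not_false_eq_true, zero_pow, add_zero, Real.log_one,
    mul_zero, div_mul_cancel₀ _ ha.ne'] at b1
  linarith

lemma integral_interactionBound {a : ℝ} (ha : 0 < a) (b : ℂ) :
    Integrable (fun z : ℂ => interactionBound a ‖z - b‖) ∧
    ∫ z : ℂ, interactionBound a ‖z - b‖ ≤ Real.pi * Real.log (1 + a ^ 2) + 10 * Real.pi := by
  obtain ⟨h1, h2⟩ := radial_interactionBound ha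
  have i : Integrable (fun z : ℂ => interactionBound a ‖z‖) := by
    rw [integrable_fun_norm_addHaar volume (f := interactionBound a)]
    simpa using h1
  refine ⟨i.comp_sub_right b, ?_⟩
  rw [integral_sub_right_eq_self (fun z : ℂ => interactionBound a ‖z‖) b,
    integral_fun_norm_addHaar volume (interactionBound a)]
  simp only [Complex.finrank_real_complex, Nat.add_one_sub_one, pow_one, smul_eq_mul,
    measureReal_def, Complex.volume_ball, nsmul_eq_mul]
  simp
  nlinarith [Real.pi_pos]

lemma integrable_sq_inv_one_add_norm_sq (b : ℂ) :
    Integrable fun z : ℂ => ((1 + ‖z - b‖ ^ 2)⁻¹) ^ 2 := by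
  have h := (integrable_rpow_neg_one_add_norm_sq (E := ℂ) (μ := volume) (r := 4)
    (by simp; norm_num)).comp_sub_right b
  refine h.congr (Eventually.of_forall fun z => ?_)
  have : (-4 / 2 : ℝ) = -(2 : ℕ) := by norm_num
  simp only [this]
  rw [Real.rpow_neg (by positivity), Real.rpow_natCast, inv_pow]

lemma interaction_vortexCore_le {a : ℝ} (ha : 0 < a) (z : ℂ) :
    4 * a ^ 2 * (vortexCore a z * vortexCore (-a) z) ≤
      interactionBound a ‖z - (a : ℂ)‖ + interactionBound a ‖z - ((-a : ℝ) : ℂ)‖ := by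
  rw [vortexCore_eq_norm, vortexCore_eq_norm]
  refine interaction_le ha (norm_nonneg _) (norm_nonneg _) ?_
  have h := norm_sub_le (z - ((-a : ℝ) : ℂ)) (z - (a : ℂ))
  rw [sub_sub_sub_cancel_left, ← Complex.ofReal_sub, Complex.norm_real, Real.norm_eq_abs,
    abs_of_pos (by linarith)] at h
  linarith

lemma exists_Efun_dipole_le : ∃ C : ℝ, ∀ a : ℝ, 1 ≤ a →
    memE (dipole a) ∧ Efun (dipole a) ≤ 2 * Real.pi * Real.log a + C := by
  refine ⟨Real.pi * Real.log 2 + 10 * Real.pi + 3 * ∫ z : ℂ, ((1 + ‖z - 0‖ ^ 2)⁻¹) ^ 2,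
    fun a ha1 => ?_⟩
  have ha : 0 < a := by linarith
  obtain ⟨f1, g1⟩ := integral_interactionBound ha (a : ℂ)
  obtain ⟨f2, g2⟩ := integral_interactionBound ha ((-a : ℝ) : ℂ)
  have f3 := integrable_sq_inv_one_add_norm_sq (a : ℂ)
  have f4 := integrable_sq_inv_one_add_norm_sq ((-a : ℝ) : ℂ)
  have hle : ∀ z, energyDensity (dipole a) z ≤
      1 / 2 * (interactionBound a ‖z - (a : ℂ)‖ + interactionBound a ‖z - ((-a : ℝ) : ℂ)‖) +
      3 / 2 * (((1 + ‖z - (a : ℂ)‖ ^ 2)⁻¹) ^ 2 + ((1 + ‖z - ((-a : ℝ) : ℂ)‖ ^ 2)⁻¹) ^ 2) := by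
    intro z
    have h1 := energyDensity_dipole_le a z
    have h2 := interaction_vortexCore_le ha z
    rw [← vortexCore_eq_norm, ← vortexCore_eq_norm]
    linarith
  have h_integrable := ((f1.fun_add f2).const_mul (1 / 2)).fun_add ((f3.fun_add f4).const_mul (3 / 2))
  have hE : Integrable (energyDensity (dipole a)) := by
    refine h_integrable.mono' (continuous_energyDensity (contDiff_dipole a)).aestronglyMeasurable
      (Eventually.of_forall fun z => ?_)
    rw [Real.norm_of_nonneg (energyDensity_nonneg _ _)]
    exact hle z
  refine ⟨memE_of_integrable (contDiff_dipole a) hE, ?_⟩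
  rw [Efun_eq_integral (contDiff_dipole a)]
  refine (integral_mono hE h_integrable hle).trans ?_
  rw [integral_add ((f1.fun_add f2).const_mul (1 / 2)) ((f3.fun_add f4).const_mul (3 / 2)),
    integral_const_mul, integral_const_mul, integral_add f1 f2, integral_add f3 f4]
  have t : ∀ b : ℂ, ∫ z : ℂ, ((1 + ‖z - b‖ ^ 2)⁻¹) ^ 2 = ∫ z : ℂ, ((1 + ‖z - 0‖ ^ 2)⁻¹) ^ 2 := by
    intro b
    simp only [sub_zero]
    exact integral_sub_right_eq_self (fun z : ℂ => ((1 + ‖z‖ ^ 2)⁻¹) ^ 2) b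
  rw [t (a : ℂ), t ((-a : ℝ) : ℂ)]
  have hlog : Real.log (1 + a ^ 2) ≤ Real.log 2 + 2 * Real.log a := by
    rw [← Real.log_rpow ha, ← Real.log_mul two_ne_zero (by positivity)]
    refine Real.log_le_log (by positivity) ?_
    norm_cast
    nlinarith
  nlinarith [Real.pi_pos]

lemma integral_univ_inv_sq_add_sq {A : ℝ} (hA : 0 < A) :
    Integrable (fun y : ℝ => (A ^ 2 + y ^ 2)⁻¹) ∧
    ∫ y : ℝ, (A ^ 2 + y ^ 2)⁻¹ = Real.pi / A := by
  have e : (fun y : ℝ => (A ^ 2 + y ^ 2)⁻¹) =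
      fun y : ℝ => (A ^ 2)⁻¹ * (1 + (y / A) ^ 2)⁻¹ := by
    funext y
    rw [← mul_inv]
    congr 1
    field_simp
  rw [e]
  refine ⟨(integrable_inv_one_add_sq.comp_div hA.ne').const_mul _, ?_⟩
  rw [integral_const_mul, Measure.integral_comp_div (fun y : ℝ => (1 + y ^ 2)⁻¹) A,
    integral_univ_inv_one_add_sq, abs_of_pos hA, smul_eq_mul]
  field_simp

lemma integral_inv_mul_inv_mul {A B : ℝ} (hA : 0 < A) (hB : 0 < B) (hAB : A ≠ B) (k : ℝ) :
    Integrable (fun y : ℝ => (A ^ 2 + y ^ 2)⁻¹ * (B ^ 2 + y ^ 2)⁻¹ * (y ^ 2 + k)) ∧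
    ∫ y : ℝ, (A ^ 2 + y ^ 2)⁻¹ * (B ^ 2 + y ^ 2)⁻¹ * (y ^ 2 + k) =
      Real.pi * (A * B + k) / (A * B * (A + B)) := by
  have h1 : B - A ≠ 0 := sub_ne_zero.2 hAB.symm
  have h2 : B ^ 2 - A ^ 2 ≠ 0 := by
    rw [sq_sub_sq]
    exact mul_ne_zero (by positivity) h1
  have e : (fun y : ℝ => (A ^ 2 + y ^ 2)⁻¹ * (B ^ 2 + y ^ 2)⁻¹ * (y ^ 2 + k)) =
      fun y : ℝ => (k - A ^ 2) / (B ^ 2 - A ^ 2) * (A ^ 2 + y ^ 2)⁻¹ -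
        (k - B ^ 2) / (B ^ 2 - A ^ 2) * (B ^ 2 + y ^ 2)⁻¹ := by
    funext y
    field_simp
    ring
  obtain ⟨iA, vA⟩ := integral_univ_inv_sq_add_sq hA
  obtain ⟨iB, vB⟩ := integral_univ_inv_sq_add_sq hB
  rw [e]
  refine ⟨(iA.const_mul _).sub (iB.const_mul _), ?_⟩
  rw [integral_sub (iA.const_mul _) (iB.const_mul _), integral_const_mul, integral_const_mul,
    vA, vB]
  have h3 : A + B ≠ 0 := by positivity
  have h4 : B ^ 2 - A ^ 2 = (B - A) * (A + B) := by ring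
  rw [h4]
  field_simp
  ring

lemma vortexCore_le (a x y : ℝ) : vortexCore a ⟨x, y⟩ ≤ (1 + y ^ 2)⁻¹ := by
  unfold vortexCore
  gcongr
  simp only
  nlinarith [sq_nonneg (x - a)]

lemma dipoleFactor_le (a x y : ℝ) : dipoleFactor a ⟨x, y⟩ ≤ (1 + y ^ 2)⁻¹ := by
  refine Real.sqrt_le_iff.2 ⟨by positivity, ?_⟩
  rw [sq]
  exact mul_le_mul (vortexCore_le _ _ _) (vortexCore_le _ _ _) (vortexCore_pos _ _).le
    (by positivity)

lemma tendsto_mul_inv_one_add_sq (l : Filter ℝ) (hl : Tendsto (fun y : ℝ => |y|) l atTop) :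
    Tendsto (fun y : ℝ => |y| * (1 + y ^ 2)⁻¹) l (nhds 0) := by
  refine squeeze_zero (fun y => by positivity) (fun y => ?_) hl.inv_tendsto_atTop
  rcases eq_or_ne y 0 with rfl | hy
  · simp
  have : 0 < |y| := abs_pos.2 hy
  simp only [Pi.inv_apply]
  rw [← div_eq_mul_inv, div_le_iff₀ (by positivity), ← sq_abs, inv_mul_eq_div, le_div_iff₀ this]
  nlinarith

lemma integral_deriv_im_dipole (a x : ℝ) (ha : 0 < a) :
    Integrable (fun y : ℝ => dipoleFactor a ⟨x, y⟩ *
      (2 * a - 2 * a * y * (y * (vortexCore a ⟨x, y⟩ + vortexCore (-a) ⟨x, y⟩)))) ∧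
    ∫ y : ℝ, dipoleFactor a ⟨x, y⟩ *
      (2 * a - 2 * a * y * (y * (vortexCore a ⟨x, y⟩ + vortexCore (-a) ⟨x, y⟩))) = 0 := by
  have cmk : Continuous fun y : ℝ => (⟨x, y⟩ : ℂ) := by
    have : (fun y : ℝ => (⟨x, y⟩ : ℂ)) = fun y : ℝ => (x : ℂ) + (y : ℂ) * Complex.I :=
      funext fun y => by apply Complex.ext <;> simp
    rw [this]
    fun_prop
  have c1 := (contDiff_dipoleFactor a).continuous.comp cmk
  have c2 := (contDiff_vortexCore a).continuous.comp cmk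
  have c3 := (contDiff_vortexCore (-a)).continuous.comp cmk
  have hI : Integrable (fun y : ℝ => dipoleFactor a ⟨x, y⟩ *
      (2 * a - 2 * a * y * (y * (vortexCore a ⟨x, y⟩ + vortexCore (-a) ⟨x, y⟩)))) := by
    refine (integrable_inv_one_add_sq.const_mul (2 * a)).mono' ?_ (Eventually.of_forall fun y => ?_)
    · refine Continuous.aestronglyMeasurable ?_
      exact c1.mul (continuous_const.sub ((continuous_const.mul continuous_id).mul
        (continuous_id.mul (c2.add c3))))
    · have h1 := dipoleFactor_le a x y
      have h2 := (dipoleFactor_pos a ⟨x, y⟩).le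
      have h3 : ∀ b, y ^ 2 * vortexCore b ⟨x, y⟩ ≤ 1 := fun b => by
        have := vortexCore_mul b ⟨x, y⟩
        have := (vortexCore_pos b ⟨x, y⟩).le
        simp only at *
        nlinarith [mul_nonneg this (sq_nonneg (x - b))]
      have h4 := mul_nonneg (sq_nonneg y) (vortexCore_pos a ⟨x, y⟩).le
      have h5 := mul_nonneg (sq_nonneg y) (vortexCore_pos (-a) ⟨x, y⟩).le
      have h6 : |2 * a - 2 * a * y * (y * (vortexCore a ⟨x, y⟩ + vortexCore (-a) ⟨x, y⟩))| ≤
          2 * a := by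
        rw [abs_le]
        constructor <;> nlinarith [h3 a, h3 (-a)]
      rw [norm_mul, Real.norm_of_nonneg h2, Real.norm_eq_abs, mul_comm]
      exact mul_le_mul h6 h1 h2 (by positivity)
  have hlim : ∀ l : Filter ℝ, Tendsto (fun y : ℝ => |y|) l atTop →
      Tendsto (fun y : ℝ => dipoleFactor a ⟨x, y⟩ * (2 * a * y)) l (nhds 0) := by
    intro l hl
    refine squeeze_zero_norm (a := fun y => 2 * a * (|y| * (1 + y ^ 2)⁻¹)) (fun y => ?_) ?_
    · rw [norm_mul, Real.norm_of_nonneg (dipoleFactor_pos a ⟨x, y⟩).le, Real.norm_eq_abs, abs_mul,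
        abs_of_pos (by positivity : 0 < 2 * a)]
      have := mul_le_mul_of_nonneg_right (dipoleFactor_le a x y)
        (by positivity : 0 ≤ 2 * a * |y|)
      linarith
    · simpa using (tendsto_mul_inv_one_add_sq l hl).const_mul (2 * a)
  refine ⟨hI, ?_⟩
  rw [integral_of_hasDerivAt_of_tendsto (f := fun y : ℝ => dipoleFactor a ⟨x, y⟩ * (2 * a * y))
    (fun y => ?_) hI (hlim _ tendsto_abs_atBot_atTop) (hlim _ tendsto_abs_atTop_atTop), sub_zero]
  have h1 := hasDerivAt_dipoleFactor_im a ⟨x, y⟩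
  have h3 : HasDerivAt (fun t : ℝ => 2 * a * t) (2 * a) y := by
    simpa using (hasDerivAt_id y).const_mul (2 * a)
  refine (h1.fun_mul h3).congr_deriv ?_
  ring

lemma integral_momDensity_dipole_slice {a x : ℝ} (ha : 0 < a) (hx : x ≠ 0) :
    0 ≤ ∫ y : ℝ, momDensity (dipole a) ⟨x, y⟩ ∧
    (|x| ≤ a → Real.pi * a / (1 + a) ≤ ∫ y : ℝ, momDensity (dipole a) ⟨x, y⟩) := by
  set A := √(1 + (x - a) ^ 2) with hA
  set B := √(1 + (x + a) ^ 2) with hB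
  have hA0 : 0 < A := Real.sqrt_pos.2 (by positivity)
  have hB0 : 0 < B := Real.sqrt_pos.2 (by positivity)
  have hA2 : A ^ 2 = 1 + (x - a) ^ 2 := Real.sq_sqrt (by positivity)
  have hB2 : B ^ 2 = 1 + (x + a) ^ 2 := Real.sq_sqrt (by positivity)
  have hne : A ≠ B := fun h => by
    have : A ^ 2 = B ^ 2 := by rw [h]
    rw [hA2, hB2] at this
    have : x * a = 0 := by linarith
    exact (mul_ne_zero hx ha.ne') this
  obtain ⟨i1, v1⟩ := integral_inv_mul_inv_mul hA0 hB0 hne (a ^ 2 - x ^ 2)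
  obtain ⟨i2, v2⟩ := integral_deriv_im_dipole a x ha
  have hval : ∫ y : ℝ, momDensity (dipole a) ⟨x, y⟩ =
      2 * a * (Real.pi * (A * B + (a ^ 2 - x ^ 2)) / (A * B * (A + B))) := by
    have : ∀ y : ℝ, momDensity (dipole a) ⟨x, y⟩ =
        2 * a * ((A ^ 2 + y ^ 2)⁻¹ * (B ^ 2 + y ^ 2)⁻¹ * (y ^ 2 + (a ^ 2 - x ^ 2))) +
        dipoleFactor a ⟨x, y⟩ *
        (2 * a - 2 * a * y * (y * (vortexCore a ⟨x, y⟩ + vortexCore (-a) ⟨x, y⟩))) := by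
      intro y
      rw [momDensity_dipole, hA2, hB2]
      simp [vortexCore]
    simp_rw [this]
    rw [integral_add (i1.const_mul _) i2, integral_const_mul, v1, v2, add_zero]
  rw [hval]
  have hAB : |a ^ 2 - x ^ 2| ≤ A * B := by
    refine abs_le_of_sq_le_sq ?_ (by positivity)
    rw [mul_pow, hA2, hB2]
    nlinarith [sq_nonneg (x - a), sq_nonneg (x + a)]
  refine ⟨?_, fun hxa => ?_⟩
  · have := (abs_le.1 hAB).1
    have h : 0 ≤ A * B + (a ^ 2 - x ^ 2) := by linarith
    positivity
  · have hx2 : x ^ 2 ≤ a ^ 2 := sq_le_sq.2 (by rwa [abs_of_pos ha])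
    obtain ⟨hx1, hx3⟩ := abs_le.1 hxa
    have hA1 : A ≤ 1 + (a - x) :=
      Real.sqrt_le_iff.2 ⟨by linarith, by nlinarith⟩
    have hB1 : B ≤ 1 + (x + a) :=
      Real.sqrt_le_iff.2 ⟨by linarith, by nlinarith⟩
    have h1 : Real.pi / (2 + 2 * a) ≤
        Real.pi * (A * B + (a ^ 2 - x ^ 2)) / (A * B * (A + B)) := by
      rw [div_le_div_iff₀ (by positivity) (by positivity)]
      have h2 : A * B * (A + B) ≤ (A * B + (a ^ 2 - x ^ 2)) * (2 + 2 * a) := by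
        refine mul_le_mul ?_ ?_ (by positivity) ?_ <;> nlinarith [mul_pos hA0 hB0]
      linarith [mul_le_mul_of_nonneg_left h2 Real.pi_pos.le]
    calc Real.pi * a / (1 + a) = 2 * a * (Real.pi / (2 + 2 * a)) := by field_simp
      _ ≤ _ := mul_le_mul_of_nonneg_left h1 (by positivity)

lemma vortexCore_neg_le {a : ℝ} (z : ℂ) :
    vortexCore (-a) z ≤ (2 + 8 * a ^ 2) * vortexCore a z := by
  unfold vortexCore
  rw [← div_eq_mul_inv, le_div_iff₀ (by positivity), inv_mul_eq_div, div_le_iff₀ (by positivity)]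
  nlinarith [sq_nonneg (z.re + 3 * a), sq_nonneg (a * (z.re + a)), sq_nonneg (a * z.im),
    sq_nonneg z.im]

lemma sq_norm_dipole_sub_one_le {a : ℝ} (z : ℂ) :
    ‖dipole a z - 1‖ ^ 2 ≤ ((1 + 2 * a ^ 2) ^ 2 + 4 * a ^ 2 * (2 + 8 * a ^ 2)) *
      vortexCore a z := by
  have hG := vortexCore_mul a z
  have hH := vortexCore_neg_mul a z
  have hG0 := vortexCore_pos a z
  have hH0 := vortexCore_pos (-a) z
  have hH1 := vortexCore_le_one (-a) z
  have hHG := vortexCore_neg_le (a := a) z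
  have hg := sq_dipoleFactor a z
  have hg0 := dipoleFactor_pos a z
  have hmod := dipole_modulus hG hH
  have hG1 := vortexCore_le_one a z
  have e : ‖dipole a z - 1‖ ^ 2 = (1 - dipoleFactor a z * (z.re ^ 2 + z.im ^ 2 - a ^ 2)) ^ 2 +
      (dipoleFactor a z * (2 * a * z.im)) ^ 2 := by
    rw [Complex.sq_norm, Complex.normSq_apply, dipole_eq]
    simp only [Complex.add_re, Complex.add_im, Complex.mul_re, Complex.sub_re, Complex.sub_im,
      Complex.mul_im, Complex.I_re, Complex.I_im, Complex.ofReal_re, Complex.ofReal_im,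
      Complex.one_re, Complex.one_im]
    ring
  rw [e]
  generalize vortexCore a z = G at *
  generalize vortexCore (-a) z = H at *
  generalize dipoleFactor a z = g at *
  generalize z.re = x at *
  generalize z.im = y at *
  have h1 : (g * (2 * a * y)) ^ 2 ≤ 4 * a ^ 2 * H := by
    have : (g * (2 * a * y)) ^ 2 = 4 * a ^ 2 * H * (G * y ^ 2) := by
      rw [mul_pow, hg]; ring
    rw [this]
    have : G * y ^ 2 ≤ 1 := by nlinarith [mul_nonneg hG0.le (sq_nonneg (x - a))]
    exact mul_le_of_le_one_right (by positivity) this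
  have h2 : g * (x ^ 2 + y ^ 2 - a ^ 2) ≤ 1 := by
    refine le_of_abs_le (abs_le_of_sq_le_sq ?_ zero_le_one)
    rw [mul_pow, hg]
    nlinarith [mul_nonneg (mul_nonneg hG0.le hH0.le) (sq_nonneg (2 * a * y))]
  have h3 : 1 ≤ g * (1 + x ^ 2 + y ^ 2 + a ^ 2) := by
    have : (1 : ℝ) ^ 2 ≤ (g * (1 + x ^ 2 + y ^ 2 + a ^ 2)) ^ 2 := by
      rw [mul_pow, hg]
      have h4 : G * H * ((1 + (x - a) ^ 2 + y ^ 2) * (1 + (x + a) ^ 2 + y ^ 2)) = 1 := by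
        linear_combination H * (1 + (x + a) ^ 2 + y ^ 2) * hG + hH
      have h5 : G * H * (1 + x ^ 2 + y ^ 2 + a ^ 2) ^ 2 = 1 + G * H * (2 * a * x) ^ 2 := by
        linear_combination h4
      rw [h5]
      have : 0 ≤ G * H * (2 * a * x) ^ 2 := by positivity
      linarith
    exact le_of_sq_le_sq this (by positivity)
  have h6 : (1 - g * (x ^ 2 + y ^ 2 - a ^ 2)) ^ 2 ≤ G * (1 + 2 * a ^ 2) ^ 2 := by
    have : (1 - g * (x ^ 2 + y ^ 2 - a ^ 2)) ^ 2 ≤ (g * (1 + 2 * a ^ 2)) ^ 2 := by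
      apply pow_le_pow_left₀ <;> nlinarith
    refine this.trans ?_
    rw [mul_pow, hg]
    refine mul_le_mul_of_nonneg_right ?_ (sq_nonneg _)
    nlinarith
  have h7 : 4 * a ^ 2 * H ≤ 4 * a ^ 2 * ((2 + 8 * a ^ 2) * G) :=
    mul_le_mul_of_nonneg_left hHG (by positivity)
  nlinarith

lemma integrable_momDensity_dipole (a : ℝ) : Integrable (momDensity (dipole a)) := by
  set K := 2 + 8 * a ^ 2 with hK
  set C₁ := 4 * a ^ 2 * K + 2 * (1 + K ^ 2) with hC₁
  set C₂ := (1 + 2 * a ^ 2) ^ 2 + 4 * a ^ 2 * K with hC₂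
  have h_integrable := ((integrable_rpow_neg_one_add_norm_sq (E := ℂ) (μ := volume) (r := 3)
    (by simp; norm_num)).comp_sub_right (a : ℂ)).const_mul (√(C₁ * C₂))
  refine h_integrable.mono' (continuous_momDensity (contDiff_dipole a)).aestronglyMeasurable
    (Eventually.of_forall fun z => ?_)
  have hG0 := vortexCore_pos a z
  have hH0 := vortexCore_pos (-a) z
  have h1 : ‖momDensity (dipole a) z‖ ≤ ‖pd2 (dipole a) z‖ * ‖dipole a z - 1‖ := by
    rw [momDensity, Real.norm_eq_abs]
    refine (Complex.abs_re_le_norm _).trans ?_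
    have h : (starRingEnd ℂ) (dipole a z) - 1 = (starRingEnd ℂ) (dipole a z - 1) := by simp
    rw [h, norm_mul, norm_mul, Complex.norm_I, one_mul, Complex.norm_conj]
  have h2 : ‖pd2 (dipole a) z‖ ^ 2 ≤ C₁ * vortexCore a z ^ 2 := by
    have h := gradSq_dipole_le a z
    have hHG : vortexCore (-a) z ≤ K * vortexCore a z := vortexCore_neg_le z
    have h3 : vortexCore (-a) z ^ 2 ≤ (K * vortexCore a z) ^ 2 := pow_le_pow_left₀ hH0.le hHG 2
    have h4 : 4 * a ^ 2 * (vortexCore a z * vortexCore (-a) z) ≤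
        4 * a ^ 2 * (vortexCore a z * (K * vortexCore a z)) := by gcongr
    rw [gradSq] at h
    nlinarith [sq_nonneg ‖pd1 (dipole a) z‖]
  have h3 : ‖dipole a z - 1‖ ^ 2 ≤ C₂ * vortexCore a z := sq_norm_dipole_sub_one_le z
  have h4 : (((1 : ℝ) + ‖z - a‖ ^ 2) ^ (-3 / 2 : ℝ)) ^ 2 = vortexCore a z ^ 3 := by
    rw [vortexCore_eq_norm, ← Real.rpow_natCast, ← Real.rpow_mul (by positivity),
      show (-3 / 2 : ℝ) * (2 : ℕ) = -(3 : ℕ) by norm_num, Real.rpow_neg (by positivity),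
      Real.rpow_natCast, inv_pow]
  refine h1.trans (le_of_sq_le_sq ?_ (by positivity))
  have hC : 0 ≤ C₁ * C₂ := by positivity
  rw [mul_pow, mul_pow, Real.sq_sqrt hC, h4]
  calc ‖pd2 (dipole a) z‖ ^ 2 * ‖dipole a z - 1‖ ^ 2
      ≤ (C₁ * vortexCore a z ^ 2) * (C₂ * vortexCore a z) :=
        mul_le_mul h2 h3 (sq_nonneg _) (by positivity)
    _ = C₁ * C₂ * vortexCore a z ^ 3 := by ring

lemma le_P2_dipole {a : ℝ} (ha : 1 ≤ a) : a ≤ P2 (dipole a) := by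
  have ha0 : 0 < a := by linarith
  have h_integrable := integrable_momDensity_dipole a
  have hfub := integral_re_preimage h_integrable (s := Set.univ)
  simp only [Set.preimage_univ, setIntegral_univ] at hfub
  have hI : Integrable fun x : ℝ => ∫ y : ℝ, momDensity (dipole a) ⟨x, y⟩ :=
    (integrable_re_im h_integrable).integral_prod_left
  have hne : ∀ᵐ x : ℝ, x ≠ 0 := by simp [ae_iff]
  have hnn : 0 ≤ᵐ[volume] fun x : ℝ => ∫ y : ℝ, momDensity (dipole a) ⟨x, y⟩ := by
    filter_upwards [hne] with x hx using (integral_momDensity_dipole_slice ha0 hx).1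
  have h1 : ∫ x in Set.Icc (-a) a, (Real.pi * a / (1 + a)) ≤
      ∫ x in Set.Icc (-a) a, ∫ y : ℝ, momDensity (dipole a) ⟨x, y⟩ := by
    refine setIntegral_mono_on_ae (by simp) hI.integrableOn measurableSet_Icc ?_
    filter_upwards [hne] with x hx hxa using
      (integral_momDensity_dipole_slice ha0 hx).2 (abs_le.2 hxa)
  have h2 := h1.trans (setIntegral_le_integral hI hnn)
  rw [← hfub, setIntegral_const, Real.volume_real_Icc_of_le (by linarith), smul_eq_mul] at h2
  rw [P2]
  have h3 : a ≤ 1 / 2 * ((a - -a) * (Real.pi * a / (1 + a))) := by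
    have : 1 / 2 * ((a - -a) * (Real.pi * a / (1 + a))) = Real.pi * a ^ 2 / (1 + a) := by ring
    rw [this, le_div_iff₀ (by positivity)]
    nlinarith [Real.pi_gt_three]
  linarith

lemma exists_Emin_le_log :
    ∃ K : ℝ, 0 ≤ K ∧ ∀ p : ℝ, 1 ≤ p → Emin p ≤ 2 * Real.pi * Real.log p + K := by
  obtain ⟨C, hC⟩ := exists_Efun_dipole_le
  refine ⟨max C 0, le_max_right _ _, fun p hp => ?_⟩
  obtain ⟨hmem, hE⟩ := hC p hp
  have hP := le_P2_dipole hp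
  have hp0 : (0 : ℝ) ≤ p := by linarith
  have h1 := monotoneOn_Emin (Set.mem_Ici.2 hp0) (Set.mem_Ici.2 (hp0.trans hP)) hP
  linarith [Emin_le hmem, le_max_left C 0]

/-- `E_min` is concave, nondecreasing, `√2`-Lipschitz on `ℝ₊`, and
`E_min(𝔭) ≤ 2π ln 𝔭 + K` for `𝔭 ≥ 1`. -/
theorem Emin_properties :
    ConcaveOn ℝ (Set.Ici (0 : ℝ)) Emin ∧
    MonotoneOn Emin (Set.Ici (0 : ℝ)) ∧
    LipschitzOnWith (Real.toNNReal (Real.sqrt 2)) Emin (Set.Ici (0 : ℝ)) ∧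
    ∃ K : ℝ, 0 ≤ K ∧ ∀ p : ℝ, 1 ≤ p → Emin p ≤ 2 * Real.pi * Real.log p + K := by
  exact ⟨concaveOn_Emin, monotoneOn_Emin, lipschitzOnWith_Emin, exists_Emin_le_log⟩
end
end

section
/- Pohozaev identity: if c ∈ ℝ and U ∈ ℰ satisfies (TW_c)(U) = 0 and the momentum density of U is integrable, then (1/2)∫_{ℝ²}(1 − |U|²)² dx = c · P₂(U). -/
open MeasureTheory Filter Metric

noncomputable section

/-- A `C¹` divergence-free field `(F, G)` is orthogonal to gradients of compactly supported
functions. -/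
theorem integral_fderiv_mul_add_eq_zero {F G φ : ℂ → ℝ} {e e' : ℂ}
    (hF : ContDiff ℝ 1 F) (hG : ContDiff ℝ 1 G)
    (hdiv : ∀ z, fderiv ℝ F z e + fderiv ℝ G z e' = 0)
    (hφ : ContDiff ℝ 1 φ) (hφc : HasCompactSupport φ) :
    (∫ z, fderiv ℝ φ z e * F z) + ∫ z, fderiv ℝ φ z e' * G z = 0 := by
  have parts : ∀ (H : ℂ → ℝ) (v : ℂ), ContDiff ℝ 1 H →
      Integrable (fun z => φ z * fderiv ℝ H z v) ∧
      ∫ z, φ z * fderiv ℝ H z v = -∫ z, fderiv ℝ φ z v * H z := by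
    intro H v hH
    have hφ' : Continuous fun z => fderiv ℝ φ z v :=
      (hφ.continuous_fderiv one_ne_zero).clm_apply continuous_const
    have hH' : Continuous fun z => fderiv ℝ H z v :=
      (hH.continuous_fderiv one_ne_zero).clm_apply continuous_const
    have h1 : Integrable (fun z => φ z * fderiv ℝ H z v) :=
      (hφ.continuous.mul hH').integrable_of_hasCompactSupport hφc.mul_right
    refine ⟨h1, integral_mul_fderiv_eq_neg_fderiv_mul_of_integrable ?_ h1 ?_
      (fun z _ => hφ.differentiable one_ne_zero z) (fun z _ => hH.differentiable one_ne_zero z)⟩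
    · exact (hφ'.mul hH.continuous).integrable_of_hasCompactSupport
        (hφc.fderiv_apply ℝ v).mul_right
    · exact (hφ.continuous.mul hH.continuous).integrable_of_hasCompactSupport hφc.mul_right
  obtain ⟨hFi, hF'⟩ := parts F e hF
  obtain ⟨hGi, hG'⟩ := parts G e' hG
  have h0 : ∫ z, (φ z * fderiv ℝ F z e + φ z * fderiv ℝ G z e') = 0 := by
    simp [← mul_add, hdiv]
  rw [integral_add hFi hGi, hF', hG'] at h0
  linarith

/-- A `C¹` cutoff on the line whose derivative has weighted sup bound `C`. -/
theorem exists_cutoff : ∃ χ : ℝ → ℝ, ContDiff ℝ 1 χ ∧ HasCompactSupport χ ∧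
    (∀ t, |t| ≤ 1 → χ t = 1) ∧ (∀ t, |t| ≤ 1 → deriv χ t = 0) ∧ (∀ t, 2 ≤ |t| → χ t = 0) ∧
    (∀ t, |χ t| ≤ 1) ∧ ∃ C, ∀ t, |deriv χ t| * (1 + |t|) ≤ C := by
  let β : ContDiffBump (0 : ℝ) := ⟨3 / 2, 2, by norm_num, by norm_num⟩
  have hd : ContDiff ℝ 1 β := β.contDiff
  have hsupp : HasCompactSupport (β : ℝ → ℝ) := β.hasCompactSupport
  have hc' : Continuous (deriv β) := hd.continuous_deriv le_rfl
  refine ⟨β, hd, hsupp, fun t ht => ?_, fun t ht => ?_, fun t ht => ?_, fun t => ?_, ?_⟩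
  · exact β.one_of_mem_closedBall (by simp [β]; linarith)
  · have : (β : ℝ → ℝ) =ᶠ[nhds t] fun _ => 1 :=
      β.eventuallyEq_one_of_mem_ball (by simp [β]; linarith)
    simp [this.deriv_eq]
  · exact β.zero_of_le_dist (by simpa [β] using ht)
  · rw [abs_of_nonneg β.nonneg]; exact β.le_one
  · obtain ⟨C, hC⟩ := (hsupp.deriv.mul_right (f' := fun t : ℝ => 1 + |t|)).exists_bound_of_continuous
      (hc'.mul (by fun_prop))
    refine ⟨C, fun t => (le_of_eq ?_).trans (hC t)⟩
    simp only [Pi.mul_apply, norm_mul, Real.norm_eq_abs]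
    rw [abs_of_nonneg (by positivity : (0 : ℝ) ≤ 1 + |t|)]

/-- The flux component of a divergence-free field vanishes in mean, provided it is integrable and
the transverse component lies in `L¹ + L²`. -/
theorem integral_eq_zero_of_div_eq_zero {F G f g : ℂ → ℝ} {e e' : ℂ} {l l' : ℂ →L[ℝ] ℝ}
    (hle : l e = 1) (hle' : l e' = 0) (hl'e : l' e = 0) (hl'e' : l' e' = 1)
    (hnorm : ∀ z, ‖z‖ ≤ |l z| + |l' z|)
    (hw : Integrable fun z => (1 + l z ^ 2)⁻¹ * (1 + l' z ^ 2)⁻¹)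
    (hF : ContDiff ℝ 1 F) (hG : ContDiff ℝ 1 G)
    (hdiv : ∀ z, fderiv ℝ F z e + fderiv ℝ G z e' = 0)
    (hFi : Integrable F) (hf : Integrable f) (hg : Integrable fun z => g z ^ 2)
    (hbound : ∀ z, |G z| ≤ f z + g z) : ∫ z, F z = 0 := by
  obtain ⟨χ, hχd, hχc, hχ1, hχ1', hχ0, hχb, C, hC⟩ := exists_cutoff
  have hC0 : 0 ≤ C := (by positivity : (0 : ℝ) ≤ |deriv χ 0| * (1 + |0|)).trans (hC 0)
  have hχ' : Continuous (deriv χ) := hχd.continuous_deriv le_rfl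
  have hχb' : ∀ t, |deriv χ t| ≤ C := fun t =>
    (le_mul_of_one_le_right (abs_nonneg _) (by simp)).trans (hC t)
  have small : ∀ x : ℝ, ∀ᶠ n : ℕ in atTop, |x / (n + 1 : ℝ)| ≤ 1 := by
    intro x
    filter_upwards [eventually_ge_atTop ⌈|x|⌉₊] with n hn
    have hx : |x| ≤ n := Nat.ceil_le.mp hn
    have hn1 : (0 : ℝ) < n + 1 := by positivity
    rw [abs_div, abs_of_pos hn1, div_le_one hn1]
    linarith
  -- integrating against functions of `l` only
  have key : ∀ a : ℝ → ℝ, ContDiff ℝ 1 a → HasCompactSupport a →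
      ∫ z, deriv a (l z) * F z = 0 := by
    intro a ha hac
    obtain ⟨A, hA⟩ := hac.exists_bound_of_continuous ha.continuous
    have ha' : Continuous (deriv a) := ha.continuous_deriv le_rfl
    obtain ⟨A', hA'⟩ := hac.deriv.exists_bound_of_continuous ha'
    have haw : Continuous fun t : ℝ => (1 + t ^ 2) * a t ^ 2 := by
      have := ha.continuous
      fun_prop
    obtain ⟨K, hK⟩ := (hac.comp_left (g := fun y : ℝ => y ^ 2) (by simp)).mul_left
      (f := fun t : ℝ => 1 + t ^ 2) |>.exists_bound_of_continuous haw
    have had : ∀ t, HasDerivAt a (deriv a t) t := fun t =>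
      (ha.differentiable one_ne_zero t).hasDerivAt
    have hχD : ∀ t, HasDerivAt χ (deriv χ t) t := fun t =>
      (hχd.differentiable one_ne_zero t).hasDerivAt
    have zero : ∀ n : ℕ, (∫ z, deriv a (l z) * χ (l' z / (n + 1)) * F z) +
        ∫ z, a (l z) * (deriv χ (l' z / (n + 1)) / (n + 1)) * G z = 0 := by
      intro n
      have hn1 : (0 : ℝ) < n + 1 := by positivity
      have hφ : ContDiff ℝ 1 fun z => a (l z) * χ (l' z / (n + 1 : ℝ)) :=
        (ha.comp l.contDiff).mul (hχd.comp (l'.contDiff.div_const _))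
      have hφc : HasCompactSupport fun z => a (l z) * χ (l' z / (n + 1 : ℝ)) := by
        obtain ⟨M, hM⟩ := hac.isCompact.isBounded.subset_closedBall 0
        refine HasCompactSupport.intro (isCompact_closedBall (0 : ℂ) (M + 2 * (n + 1)))
          fun z hz => ?_
        by_contra hne
        obtain ⟨h1, h2⟩ := mul_ne_zero_iff.mp hne
        have h3 : |l z| ≤ M := by
          simpa using hM (subset_tsupport a h1)
        have h4 : |l' z| ≤ 2 * (n + 1) := by
          by_contra! h
          refine h2 (hχ0 _ ?_)
          rw [abs_div, abs_of_pos hn1, le_div_iff₀ hn1]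
          exact h.le
        apply hz
        simp only [mem_closedBall, dist_zero_right]
        linarith [hnorm z]
      have hder : ∀ z v, fderiv ℝ (fun z => a (l z) * χ (l' z / (n + 1 : ℝ))) z v =
          deriv a (l z) * l v * χ (l' z / (n + 1)) +
            a (l z) * (deriv χ (l' z / (n + 1)) * (l' v / (n + 1))) := by
        intro z v
        have h1 := (had (l z)).comp_hasFDerivAt z l.hasFDerivAt
        have h2 := (hχD (l' z / (n + 1))).comp_hasFDerivAt z
          (l'.hasFDerivAt.mul_const (n + 1 : ℝ)⁻¹)
        have h3 := (h1.mul h2).fderiv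
        refine (DFunLike.congr_fun h3 v).trans ?_
        simp [div_eq_mul_inv]
        ring
      have := integral_fderiv_mul_add_eq_zero (e := e) (e' := e') hF hG hdiv hφ hφc
      simpa only [hder, hle, hle', hl'e, hl'e', mul_one, mul_zero, zero_div, add_zero, zero_mul,
        zero_add, mul_one_div] using this
    have lim1 : Tendsto (fun n : ℕ => ∫ z, deriv a (l z) * χ (l' z / (n + 1)) * F z) atTop
        (nhds (∫ z, deriv a (l z) * F z)) := by
      refine tendsto_integral_of_dominated_convergence (fun z => A' * |F z|) (fun n => ?_)
        (hFi.abs.const_mul _) (fun n => .of_forall fun z => ?_) (.of_forall fun z => ?_)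
      · refine Continuous.aestronglyMeasurable ?_
        have := hF.continuous
        have := hχd.continuous
        fun_prop
      · simp only [norm_mul, Real.norm_eq_abs]
        gcongr
        calc _ ≤ A' * 1 := by
              have := hA' (l z)
              have h0 : 0 ≤ A' := (norm_nonneg _).trans this
              exact mul_le_mul this (hχb _) (abs_nonneg _) h0
          _ = A' := mul_one _
      · refine tendsto_const_nhds.congr' ?_
        filter_upwards [small (l' z)] with n hn
        simp [hχ1 _ hn]
    have lim2 : Tendsto (fun n : ℕ => ∫ z, a (l z) * (deriv χ (l' z / (n + 1)) / (n + 1)) * G z)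
        atTop (nhds (∫ _ : ℂ, (0 : ℝ))) := by
      refine tendsto_integral_of_dominated_convergence
        (fun z => A * C * |f z| + (g z ^ 2 +
          C ^ 2 * K * ((1 + l z ^ 2)⁻¹ * (1 + l' z ^ 2)⁻¹)) / 2) (fun n => ?_)
        ((hf.abs.const_mul _).add ((hg.add (hw.const_mul _)).div_const 2))
        (fun n => .of_forall fun z => ?_) (.of_forall fun z => ?_)
      · refine Continuous.aestronglyMeasurable ?_
        have := hG.continuous
        have := ha.continuous
        fun_prop
      · set s : ℝ := l' z / (n + 1) with hs
        have hn1 : (1 : ℝ) ≤ n + 1 := by simp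
        have hn0 : (0 : ℝ) < n + 1 := by positivity
        set d : ℝ := |deriv χ s / (n + 1)| with hd
        have hd0 : 0 ≤ d := abs_nonneg _
        have hd1 : d * (1 + |l' z|) ≤ C := by
          have hs' : |l' z| = |s| * (n + 1) := by
            rw [hs, abs_div, abs_of_pos hn0]; field_simp
          refine le_trans ?_ (hC s)
          rw [hd, abs_div, abs_of_pos hn0, hs', div_mul_eq_mul_div, div_le_iff₀ hn0, mul_assoc]
          gcongr
          nlinarith [abs_nonneg s]
        have hdC : d ≤ C := (le_mul_of_one_le_right hd0 (by simp)).trans hd1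
        have haA : |a (l z)| ≤ A := hA _
        have hA0 : 0 ≤ A := (abs_nonneg _).trans haA
        have haK : (1 + l z ^ 2) * a (l z) ^ 2 ≤ K := (le_abs_self _).trans (hK (l z))
        have hdd : (1 + l' z ^ 2) * d ^ 2 ≤ C ^ 2 := by
          calc (1 + l' z ^ 2) * d ^ 2 ≤ (d * (1 + |l' z|)) ^ 2 := by
                rw [← sq_abs (l' z)]
                nlinarith [mul_nonneg (abs_nonneg (l' z)) (sq_nonneg d)]
            _ ≤ C ^ 2 := by gcongr
        have hsq : (|a (l z)| * d) ^ 2 ≤ C ^ 2 * K * ((1 + l z ^ 2)⁻¹ * (1 + l' z ^ 2)⁻¹) := by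
          rw [← mul_inv, ← div_eq_mul_inv, le_div_iff₀ (by positivity), mul_pow, sq_abs]
          calc _ = ((1 + l' z ^ 2) * d ^ 2) * ((1 + l z ^ 2) * a (l z) ^ 2) := by ring
            _ ≤ C ^ 2 * K := by gcongr
        calc ‖a (l z) * (deriv χ s / (n + 1)) * G z‖ = |a (l z)| * d * |G z| := by
              simp only [norm_mul, Real.norm_eq_abs, hd]
          _ ≤ |a (l z)| * d * (|f z| + g z) := by
              gcongr
              exact (hbound z).trans (by gcongr; exact le_abs_self _)
          _ ≤ A * C * |f z| + (g z ^ 2 + (|a (l z)| * d) ^ 2) / 2 := by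
              have : |a (l z)| * d * |f z| ≤ A * C * |f z| := by gcongr
              nlinarith [sq_nonneg (g z - |a (l z)| * d)]
          _ ≤ _ := by gcongr
      · refine tendsto_const_nhds.congr' ?_
        filter_upwards [small (l' z)] with n hn
        simp [hχ1' _ hn]
    have := tendsto_nhds_unique (lim1.add lim2)
      (tendsto_const_nhds.congr fun n => (zero n).symm)
    simpa using this
  have lim : Tendsto (fun n : ℕ => ∫ z, (χ (l z / (n + 1)) +
      l z / (n + 1) * deriv χ (l z / (n + 1))) * F z) atTop (nhds (∫ z, F z)) := by
    refine tendsto_integral_of_dominated_convergence (fun z => (1 + C) * |F z|) (fun n => ?_)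
      (hFi.abs.const_mul _) (fun n => .of_forall fun z => ?_) (.of_forall fun z => ?_)
    · refine Continuous.aestronglyMeasurable ?_
      have := hF.continuous
      have := hχd.continuous
      fun_prop
    · simp only [norm_mul, Real.norm_eq_abs]
      gcongr
      refine (abs_add_le _ _).trans (add_le_add (hχb _) ?_)
      rw [abs_mul]
      nlinarith [hC (l z / (n + 1)), abs_nonneg (deriv χ (l z / (n + 1)))]
    · refine tendsto_const_nhds.congr' ?_
      filter_upwards [small (l z)] with n hn
      simp [hχ1 _ hn, hχ1' _ hn]
  refine tendsto_nhds_unique lim (tendsto_const_nhds.congr fun n => ?_)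
  have hn0 : (n + 1 : ℝ) ≠ 0 := by positivity
  have hd : ∀ t, HasDerivAt (fun t : ℝ => t * χ (t / (n + 1)))
      (χ (t / (n + 1)) + t / (n + 1) * deriv χ (t / (n + 1))) t := by
    intro t
    have h1 := ((hχd.differentiable one_ne_zero (t / (n + 1))).hasDerivAt).comp t
      ((hasDerivAt_id t).div_const (n + 1 : ℝ))
    refine ((hasDerivAt_id t).mul h1).congr_deriv ?_
    simp
    ring
  have hc : HasCompactSupport fun t : ℝ => t * χ (t / (n + 1)) := by
    refine HasCompactSupport.mul_left ?_
    simpa [div_eq_inv_mul] using hχc.comp_smul (c := (n + 1 : ℝ)⁻¹) (inv_ne_zero hn0)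
  have := key _ (contDiff_id.mul (hχd.comp (contDiff_id.div_const _))) hc
  have hd' := fun t => (hd t).deriv
  simp only [id, Function.comp_def] at this
  simp only [hd'] at this
  exact this.symm

theorem integrable_inv_one_add_re_sq_mul_inv_one_add_im_sq :
    Integrable fun z : ℂ => (1 + z.re ^ 2)⁻¹ * (1 + z.im ^ 2)⁻¹ := by
  have h := integrable_inv_one_add_sq.mul_prod integrable_inv_one_add_sq
  exact (Complex.volume_preserving_equiv_real_prod.integrable_comp_emb
    Complex.measurableEquivRealProd.measurableEmbedding).2 h

/-- A finite-energy map has continuous partial derivatives and integrable energy density. -/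
theorem memE.integrable {U : ℂ → ℂ} (hU : memE U) :
    Continuous (pd1 U) ∧ Continuous (pd2 U) ∧ Integrable (energyDensity U) := by
  have h1 : Continuous (pd1 U) :=
    (hU.1.continuous_fderiv (by simp)).clm_apply continuous_const
  have h2 : Continuous (pd2 U) :=
    (hU.1.continuous_fderiv (by simp)).clm_apply continuous_const
  have h0 := hU.1.continuous
  refine ⟨h1, h2, Continuous.aestronglyMeasurable ?_, ?_⟩
  · unfold energyDensity gradSq
    fun_prop
  · rw [hasFiniteIntegral_iff_ofReal (.of_forall fun z => ?_)]
    · exact hU.2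
    · simp only [energyDensity, gradSq, Pi.zero_apply]
      positivity

/-- The `(1, 1)` entry of the stress tensor of `u`. -/
def stress11 (u : ℂ → ℂ) (z : ℂ) : ℝ :=
  (‖pd1 u z‖ ^ 2 - ‖pd2 u z‖ ^ 2) / 2 - (1 - ‖u z‖ ^ 2) ^ 2 / 4

/-- The `(2, 2)` entry of the stress tensor of `u`. -/
def stress22 (u : ℂ → ℂ) (z : ℂ) : ℝ :=
  (‖pd2 u z‖ ^ 2 - ‖pd1 u z‖ ^ 2) / 2 - (1 - ‖u z‖ ^ 2) ^ 2 / 4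

/-- The off-diagonal entry of the stress tensor of `u`. -/
def stress12 (u : ℂ → ℂ) (z : ℂ) : ℝ :=
  (pd1 u z * (starRingEnd ℂ) (pd2 u z)).re

/-- The momentum density in the direction `x₁`. -/
def momDensity1 (u : ℂ → ℂ) (z : ℂ) : ℝ :=
  (Complex.I * pd1 u z * ((starRingEnd ℂ) (u z) - 1)).re

theorem fderiv_pd1_I {U : ℂ → ℂ} (hU : ContDiff ℝ (⊤ : ℕ∞) U) (z : ℂ) :
    fderiv ℝ (pd1 U) z Complex.I = fderiv ℝ (pd2 U) z 1 := by
  have hd : DifferentiableAt ℝ (fderiv ℝ U) z :=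
    (hU.fderiv_right (m := 1) (by norm_cast)).differentiable one_ne_zero z
  have hs : IsSymmSndFDerivAt ℝ U z := hU.contDiffAt.isSymmSndFDerivAt (by
    rw [minSmoothness_of_isRCLikeNormedField]; exact WithTop.coe_le_coe.2 (le_top (a := (2 : ℕ∞))))
  have hv : ∀ v w : ℂ, fderiv ℝ (fun y => fderiv ℝ U y v) z w = fderiv ℝ (fderiv ℝ U) z w v := by
    intro v w
    rw [fderiv_clm_apply hd (differentiableAt_const v)]
    simp
  exact (hv _ _).trans ((hs.eq _ _).trans (hv _ _).symm)

/-- The travelling wave equation makes the stress tensor divergence free in the direction `x₂`,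
and in the direction `x₁` after correction by the momentum densities. -/
theorem TW.divergence {c : ℝ} {U : ℂ → ℂ} (hU : ContDiff ℝ (⊤ : ℕ∞) U) (hTW : TW c U) (z : ℂ) :
    fderiv ℝ (stress22 U) z Complex.I + fderiv ℝ (stress12 U) z 1 = 0 ∧
    fderiv ℝ (fun z => stress11 U z + c / 2 * momDensity U z) z 1 +
      fderiv ℝ (fun z => stress12 U z - c / 2 * momDensity1 U z) z Complex.I = 0 := by
  have d1 : ContDiff ℝ (⊤ : ℕ∞) (pd1 U) := (hU.fderiv_right (by norm_cast)).clm_apply contDiff_const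
  have d2 : ContDiff ℝ (⊤ : ℕ∞) (pd2 U) := (hU.fderiv_right (by norm_cast)).clm_apply contDiff_const
  have H0 := (hU.differentiable (by simp) z).hasFDerivAt
  have H1 := (d1.differentiable (by simp) z).hasFDerivAt
  have H2 := (d2.differentiable (by simp) z).hasFDerivAt
  have re : ∀ {f : ℂ → ℂ} {f' : ℂ →L[ℝ] ℂ}, HasFDerivAt f f' z →
      HasFDerivAt (fun z => (f z).re) (Complex.reCLM ∘L f') z := fun h =>
    Complex.reCLM.hasFDerivAt.comp z h
  have im : ∀ {f : ℂ → ℂ} {f' : ℂ →L[ℝ] ℂ}, HasFDerivAt f f' z →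
      HasFDerivAt (fun z => (f z).im) (Complex.imCLM ∘L f') z := fun h =>
    Complex.imCLM.hasFDerivAt.comp z h
  have nsq : ∀ w : ℂ, ‖w‖ ^ 2 = w.re * w.re + w.im * w.im := fun w => by
    rw [← Complex.normSq_eq_norm_sq, Complex.normSq_apply]
  have N0 := ((re H0).mul (re H0)).add ((im H0).mul (im H0))
  have N1 := ((re H1).mul (re H1)).add ((im H1).mul (im H1))
  have N2 := ((re H2).mul (re H2)).add ((im H2).mul (im H2))
  have W := ((N0.const_sub 1).mul (N0.const_sub 1)).const_mul (1 / 4 : ℝ)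
  have S11 := ((N1.sub N2).const_mul (1 / 2 : ℝ)).sub W
  have S22 := ((N2.sub N1).const_mul (1 / 2 : ℝ)).sub W
  have S12 := ((re H1).mul (re H2)).add ((im H1).mul (im H2))
  have M2 := ((im H2).mul ((re H0).const_sub 1)).add ((re H2).mul (im H0))
  have M1 := ((im H1).mul ((re H0).const_sub 1)).add ((re H1).mul (im H0))
  have e22 := S22.congr_of_eventuallyEq (f₁ := stress22 U) (.of_forall fun z => by
    simp [stress22, nsq]; ring)
  have e12 := S12.congr_of_eventuallyEq (f₁ := stress12 U) (.of_forall fun z => by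
    simp [stress12])
  have eF := (S11.add (M2.const_mul (c / 2))).congr_of_eventuallyEq
    (f₁ := fun z => stress11 U z + c / 2 * momDensity U z) (.of_forall fun z => by
      simp [stress11, momDensity, nsq]; ring)
  have eG := (S12.sub (M1.const_mul (c / 2))).congr_of_eventuallyEq
    (f₁ := fun z => stress12 U z - c / 2 * momDensity1 U z) (.of_forall fun z => by
      simp [stress12, momDensity1, -mul_eq_mul_left_iff]; ring)
  have hsym := fderiv_pd1_I hU z
  have tw := hTW z
  have twr := congrArg Complex.re tw
  have twi := congrArg Complex.im tw
  rw [e22.fderiv, e12.fderiv, eF.fderiv, eG.fderiv]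
  have g0 : fderiv ℝ U z 1 = pd1 U z := rfl
  have g1 : fderiv ℝ U z Complex.I = pd2 U z := rfl
  rw [nsq] at twr twi
  simp [lap] at twr twi
  simp [hsym, g0, g1]
  constructor
  · linear_combination (-(pd2 U z).re) * twr - (pd2 U z).im * twi
  · linear_combination (-(pd1 U z).re) * twr - (pd1 U z).im * twi

/-- Pohozaev identity. -/
theorem pohozaev (c : ℝ) (U : ℂ → ℂ) (hU : memE U) (hTW : TW c U) (hmom : momInt U) :
    (1 / 2) * (∫ z : ℂ, (1 - ‖U z‖ ^ 2) ^ 2) = c * P2 U := by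
  obtain ⟨c1, c2, hE⟩ := hU.integrable
  have c0 := hU.1.continuous
  have d0 : ContDiff ℝ 1 U := hU.1.of_le (by norm_cast)
  have d1 : ContDiff ℝ 1 (pd1 U) := (hU.1.fderiv_right (by norm_cast)).clm_apply contDiff_const
  have d2 : ContDiff ℝ 1 (pd2 U) := (hU.1.fderiv_right (by norm_cast)).clm_apply contDiff_const
  have dconj : ∀ {f : ℂ → ℂ}, ContDiff ℝ 1 f → ContDiff ℝ 1 fun z => (starRingEnd ℂ) (f z) :=
    fun h => Complex.conjCLE.contDiff.comp h
  have dre : ∀ {f : ℂ → ℂ}, ContDiff ℝ 1 f → ContDiff ℝ 1 fun z => (f z).re :=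
    fun h => Complex.reCLM.contDiff.comp h
  have D11 : ContDiff ℝ 1 (stress11 U) :=
    (((d1.norm_sq ℝ).sub (d2.norm_sq ℝ)).div_const 2).sub
      (((contDiff_const.sub (d0.norm_sq ℝ)).pow 2).div_const 4)
  have D22 : ContDiff ℝ 1 (stress22 U) :=
    (((d2.norm_sq ℝ).sub (d1.norm_sq ℝ)).div_const 2).sub
      (((contDiff_const.sub (d0.norm_sq ℝ)).pow 2).div_const 4)
  have D12 : ContDiff ℝ 1 (stress12 U) := dre (d1.mul (dconj d2))
  have DM1 : ContDiff ℝ 1 (momDensity1 U) :=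
    dre ((contDiff_const.mul d1).mul ((dconj d0).sub contDiff_const))
  have DM2 : ContDiff ℝ 1 (momDensity U) :=
    dre ((contDiff_const.mul d2).mul ((dconj d0).sub contDiff_const))
  have dominated : ∀ {f : ℂ → ℝ}, Continuous f → (∀ z, |f z| ≤ 4 * energyDensity U z) →
      Integrable f := fun hf h =>
    (hE.const_mul 4).mono' hf.aestronglyMeasurable (.of_forall h)
  have i11 : Integrable (stress11 U) := dominated D11.continuous fun z => by
    simp only [stress11, energyDensity, gradSq]
    rw [abs_le]
    constructor <;> nlinarith [sq_nonneg ‖pd1 U z‖, sq_nonneg ‖pd2 U z‖, sq_nonneg (1 - ‖U z‖ ^ 2)]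
  have i22 : Integrable (stress22 U) := dominated D22.continuous fun z => by
    simp only [stress22, energyDensity, gradSq]
    rw [abs_le]
    constructor <;> nlinarith [sq_nonneg ‖pd1 U z‖, sq_nonneg ‖pd2 U z‖, sq_nonneg (1 - ‖U z‖ ^ 2)]
  have i1 : Integrable fun z => ‖pd1 U z‖ ^ 2 := dominated (by fun_prop) fun z => by
    simp only [energyDensity, gradSq, abs_pow, abs_norm]
    nlinarith [sq_nonneg ‖pd1 U z‖, sq_nonneg ‖pd2 U z‖, sq_nonneg (1 - ‖U z‖ ^ 2)]
  have b12 : ∀ z, |stress12 U z| ≤ energyDensity U z := fun z => by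
    have := Complex.abs_re_le_norm (pd1 U z * (starRingEnd ℂ) (pd2 U z))
    rw [norm_mul, RCLike.norm_conj] at this
    simp only [stress12, energyDensity, gradSq]
    nlinarith [sq_nonneg (‖pd1 U z‖ - ‖pd2 U z‖), sq_nonneg (1 - ‖U z‖ ^ 2)]
  have bM : ∀ z, |momDensity1 U z| ≤ 2 * energyDensity U z + 2 * ‖pd1 U z‖ := fun z => by
    have h := Complex.abs_re_le_norm (Complex.I * pd1 U z * ((starRingEnd ℂ) (U z) - 1))
    rw [norm_mul, norm_mul, Complex.norm_I, one_mul] at h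
    have h1 : ‖(starRingEnd ℂ) (U z) - 1‖ ≤ ‖U z‖ + 1 := by
      simpa using norm_sub_le ((starRingEnd ℂ) (U z)) 1
    have h2 : ‖U z‖ ≤ 1 + |1 - ‖U z‖ ^ 2| := by
      have := neg_abs_le (1 - ‖U z‖ ^ 2)
      rcases le_total ‖U z‖ 1 with h | h <;> nlinarith [abs_nonneg (1 - ‖U z‖ ^ 2)]
    have h3 : ‖pd1 U z‖ * ‖(starRingEnd ℂ) (U z) - 1‖ ≤
        ‖pd1 U z‖ * (2 + |1 - ‖U z‖ ^ 2|) := by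
      gcongr
      linarith
    have h4 := sq_abs (1 - ‖U z‖ ^ 2)
    simp only [momDensity1, energyDensity, gradSq]
    nlinarith [sq_nonneg (‖pd1 U z‖ - |1 - ‖U z‖ ^ 2|), sq_nonneg ‖pd2 U z‖]
  have hw := integrable_inv_one_add_re_sq_mul_inv_one_add_im_sq
  have I22 : ∫ z, stress22 U z = 0 :=
    integral_eq_zero_of_div_eq_zero (l := Complex.imCLM) (l' := Complex.reCLM) (e := Complex.I)
      (e' := 1) (g := fun _ => 0) (by simp) (by simp) (by simp) (by simp)
      (fun z => by simpa [add_comm] using Complex.norm_le_abs_re_add_abs_im z)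
      (by simpa [mul_comm] using hw) D22 D12 (fun z => (hTW.divergence hU.1 z).1) i22 hE
      (by simp) (by simpa using b12)
  have I11 : ∫ z, (stress11 U z + c / 2 * momDensity U z) = 0 := by
    refine integral_eq_zero_of_div_eq_zero (l := Complex.reCLM) (l' := Complex.imCLM) (e := 1)
      (e' := Complex.I) (G := fun z => stress12 U z - c / 2 * momDensity1 U z)
      (f := fun z => (1 + |c|) * energyDensity U z) (g := fun z => |c| * ‖pd1 U z‖)
      (by simp) (by simp) (by simp) (by simp)
      (fun z => by simpa using Complex.norm_le_abs_re_add_abs_im z)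
      (by simpa using hw) (D11.add (contDiff_const.mul DM2)) (D12.sub (contDiff_const.mul DM1))
      (fun z => (hTW.divergence hU.1 z).2) (i11.add (hmom.const_mul _)) (hE.const_mul _)
      (by simpa [mul_pow] using i1.const_mul (c ^ 2)) fun z => ?_
    calc _ ≤ |stress12 U z| + |c / 2 * momDensity1 U z| := abs_sub _ _
      _ = |stress12 U z| + |c| / 2 * |momDensity1 U z| := by rw [abs_mul, abs_div]; simp
      _ ≤ energyDensity U z + |c| / 2 * (2 * energyDensity U z + 2 * ‖pd1 U z‖) := by
          gcongr
          exacts [b12 z, bM z]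
      _ = _ := by ring
  rw [integral_add i11 (hmom.const_mul _), integral_const_mul] at I11
  have hsum : ∫ z, (stress11 U z + stress22 U z) = ∫ z, (-1 / 2) * (1 - ‖U z‖ ^ 2) ^ 2 :=
    integral_congr_ae (.of_forall fun z => by simp only [stress11, stress22]; ring)
  rw [integral_add i11 i22, I22, integral_const_mul] at hsum
  rw [P2]
  linarith
end
end

section
/- There exists a universal constant K > 0 such that for every c ∈ [−√2, √2] and every U ∈ L³_loc(ℝ², ℂ) that is a (distributional, hence smooth) solution of ΔU + ic ∂_{x₂}U + U(1 − |U|²) = 0 on ℝ², one has ‖∇U‖_{L^∞(ℝ²)} + ‖∇²U‖_{L^∞(ℝ²)} ≤ K. -/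
open MeasureTheory Filter Metric

noncomputable section

/-- The derivative of `f` in the direction `v`. -/
def dirDeriv {F : Type*} [NormedAddCommGroup F] [NormedSpace ℝ F] (v : ℂ) (f : ℂ → F) (z : ℂ) : F :=
  fderiv ℝ f z v

section DirDeriv

variable {F : Type*} [NormedAddCommGroup F] [NormedSpace ℝ F]

theorem ContDiff.dirDeriv {f : ℂ → F} (hf : ContDiff ℝ (⊤ : ℕ∞) f) (v : ℂ) :
    ContDiff ℝ (⊤ : ℕ∞) (dirDeriv v f) :=
  (hf.fderiv_right (m := (⊤ : ℕ∞)) (by simp)).clm_apply contDiff_const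

theorem ContDiff.differentiableAt_top {f : ℂ → F} (hf : ContDiff ℝ (⊤ : ℕ∞) f) (z : ℂ) :
    DifferentiableAt ℝ f z :=
  hf.differentiable (by simp) z

theorem fderiv_fderiv_apply {f : ℂ → F} (hf : ContDiff ℝ (⊤ : ℕ∞) f) (v w z : ℂ) :
    fderiv ℝ (fderiv ℝ f) z w v = dirDeriv w (dirDeriv v f) z := by
  have h : DifferentiableAt ℝ (fderiv ℝ f) z :=
    (hf.fderiv_right (m := (⊤ : ℕ∞)) (by simp)).differentiable (by simp) z
  have := fderiv_clm_apply h (differentiableAt_const (𝕜 := ℝ) v)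
  change _ = fderiv ℝ (fun y => fderiv ℝ f y v) z w
  rw [this]
  simp

theorem dirDeriv_comm {f : ℂ → F} (hf : ContDiff ℝ (⊤ : ℕ∞) f) (v w : ℂ) :
    dirDeriv v (dirDeriv w f) = dirDeriv w (dirDeriv v f) := by
  ext z
  rw [← fderiv_fderiv_apply hf, ← fderiv_fderiv_apply hf]
  exact (hf.contDiffAt.isSymmSndFDerivAt (n := (⊤ : ℕ∞))
    (by rw [minSmoothness_of_isRCLikeNormedField]; exact WithTop.coe_le_coe.2 le_top)) v w

/-- The second directional derivatives are nonpositive at a local maximum. -/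
theorem dirDeriv_dirDeriv_nonpos {f : ℂ → ℝ} (hf : ContDiff ℝ (⊤ : ℕ∞) f) {z : ℂ}
    (hz : IsLocalMax f z) (e : ℂ) : dirDeriv e (dirDeriv e f) z ≤ 0 := by
  have hline : ∀ {g : ℂ → ℝ}, ContDiff ℝ (⊤ : ℕ∞) g →
      deriv (fun t : ℝ => g (z + t • e)) = fun t : ℝ => dirDeriv e g (z + t • e) := by
    intro g hg
    ext t
    have h1 : HasDerivAt (fun t : ℝ => z + t • e) e t := by
      simpa using ((hasDerivAt_id t).smul_const e).const_add z
    exact ((hg.differentiableAt_top _).hasFDerivAt.comp_hasDerivAt t h1).deriv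
  by_contra! hpos
  set g : ℝ → ℝ := fun t => f (z + t • e) with hg
  have hcont : Continuous fun t : ℝ => z + t • e := by fun_prop
  have hmax : IsLocalMax g 0 := by
    have : Tendsto (fun t : ℝ => z + t • e) (nhds 0) (nhds z) := by
      simpa using hcont.tendsto 0
    simpa [IsLocalMax, IsMaxFilter, hg] using this.eventually hz
  have hdd : deriv (deriv g) 0 = dirDeriv e (dirDeriv e f) z := by
    rw [hline hf, hline (hf.dirDeriv e)]
    simp
  have hmin : IsLocalMin g 0 :=
    isLocalMin_of_deriv_deriv_pos (by rw [hdd]; exact hpos) hmax.deriv_eq_zero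
      (hf.continuous.comp hcont).continuousAt
  have hconst : g =ᶠ[nhds 0] fun _ => g 0 := by
    filter_upwards [hmax, hmin] with t h1 h2 using le_antisymm h1 h2
  rw [← hdd, hconst.deriv.deriv_eq] at hpos
  simp at hpos

theorem dirDeriv_norm_sq {f : ℂ → ℂ} (hf : ContDiff ℝ (⊤ : ℕ∞) f) (v : ℂ) :
    dirDeriv v (fun z => ‖f z‖ ^ 2) = fun z => 2 * inner ℝ (f z) (dirDeriv v f z) := by
  ext z
  have := (hf.differentiableAt_top z).hasFDerivAt.norm_sq.fderiv
  change fderiv ℝ (fun z => ‖f z‖ ^ 2) z v = _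
  rw [this]
  simp [dirDeriv]
  ring

theorem dirDeriv_add {f g : ℂ → F} (hf : ContDiff ℝ (⊤ : ℕ∞) f)
    (hg : ContDiff ℝ (⊤ : ℕ∞) g) (v : ℂ) :
    dirDeriv v (fun z => f z + g z) = fun z => dirDeriv v f z + dirDeriv v g z := by
  ext z
  simp [dirDeriv, fderiv_fun_add (hf.differentiableAt_top z) (hg.differentiableAt_top z)]

theorem dirDeriv_sub {f g : ℂ → F} (hf : ContDiff ℝ (⊤ : ℕ∞) f)
    (hg : ContDiff ℝ (⊤ : ℕ∞) g) (v : ℂ) :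
    dirDeriv v (fun z => f z - g z) = fun z => dirDeriv v f z - dirDeriv v g z := by
  ext z
  simp [dirDeriv, fderiv_fun_sub (hf.differentiableAt_top z) (hg.differentiableAt_top z)]

theorem dirDeriv_smul {a : ℂ → ℝ} {f : ℂ → F} (ha : ContDiff ℝ (⊤ : ℕ∞) a)
    (hf : ContDiff ℝ (⊤ : ℕ∞) f) (v : ℂ) :
    dirDeriv v (fun z => a z • f z) = fun z => a z • dirDeriv v f z + dirDeriv v a z • f z := by
  ext z
  simp [dirDeriv, fderiv_fun_smul (ha.differentiableAt_top z) (hf.differentiableAt_top z)]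

theorem dirDeriv_mul {f g : ℂ → ℂ} (hf : ContDiff ℝ (⊤ : ℕ∞) f)
    (hg : ContDiff ℝ (⊤ : ℕ∞) g) (v : ℂ) :
    dirDeriv v (fun z => f z * g z) = fun z => f z * dirDeriv v g z + dirDeriv v f z * g z := by
  ext z
  simp [dirDeriv, fderiv_fun_mul (hf.differentiableAt_top z) (hg.differentiableAt_top z), mul_comm]

theorem ContDiff.conj {f : ℂ → ℂ} (hf : ContDiff ℝ (⊤ : ℕ∞) f) :
    ContDiff ℝ (⊤ : ℕ∞) fun z => (starRingEnd ℂ) (f z) :=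
  Complex.conjCLE.contDiff.comp hf

theorem dirDeriv_conj {f : ℂ → ℂ} (hf : ContDiff ℝ (⊤ : ℕ∞) f) (v : ℂ) :
    dirDeriv v (fun z => (starRingEnd ℂ) (f z)) = fun z => (starRingEnd ℂ) (dirDeriv v f z) := by
  ext z
  have := (Complex.conjCLE.toContinuousLinearMap.hasFDerivAt.comp z
    (hf.differentiableAt_top z).hasFDerivAt).fderiv
  change fderiv ℝ (Complex.conjCLE.toContinuousLinearMap ∘ f) z v = _
  rw [this]
  rfl

theorem dirDeriv_dirDeriv_norm_sq {f : ℂ → ℂ} (hf : ContDiff ℝ (⊤ : ℕ∞) f) (v z : ℂ) :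
    dirDeriv v (dirDeriv v fun z => ‖f z‖ ^ 2) z =
      2 * ‖dirDeriv v f z‖ ^ 2 + 2 * inner ℝ (f z) (dirDeriv v (dirDeriv v f) z) := by
  have h := hf.dirDeriv v
  rw [dirDeriv_norm_sq hf]
  have : dirDeriv v (fun z => 2 * inner ℝ (f z) (dirDeriv v f z)) z =
      2 * dirDeriv v (fun z => inner ℝ (f z) (dirDeriv v f z)) z := by
    rw [dirDeriv, fderiv_const_mul ((hf.differentiableAt_top z).inner ℝ (h.differentiableAt_top z))]
    rfl
  rw [this]
  rw [dirDeriv, fderiv_inner_apply ℝ (hf.differentiableAt_top z) (h.differentiableAt_top z)]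
  change 2 * (_ + inner ℝ (dirDeriv v f z) (dirDeriv v f z)) = 2 * ‖dirDeriv v f z‖ ^ 2 + _
  rw [real_inner_self_eq_norm_sq]
  simp only [dirDeriv]
  ring

end DirDeriv

/-- A cutoff function vanishing on the unit circle around `z₀`. -/
def cutoff (z₀ z : ℂ) : ℝ := 1 - ‖z - z₀‖ ^ 2

theorem contDiff_cutoff (z₀ : ℂ) : ContDiff ℝ (⊤ : ℕ∞) (cutoff z₀) :=
  contDiff_const.sub ((contDiff_id.sub contDiff_const).norm_sq ℝ)

theorem dirDeriv_cutoff (z₀ v : ℂ) :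
    dirDeriv v (cutoff z₀) = fun z => -2 * inner ℝ (z - z₀) v := by
  ext z
  have h1 : HasFDerivAt (fun y : ℂ => y - z₀) (ContinuousLinearMap.id ℝ ℂ) z :=
    (hasFDerivAt_id z).sub_const z₀
  have h2 := (h1.norm_sq.const_sub 1).fderiv
  change fderiv ℝ (fun y => 1 - ‖y - z₀‖ ^ 2) z v = _
  rw [h2]
  simp
  ring

theorem dirDeriv_dirDeriv_cutoff (z₀ v z : ℂ) :
    dirDeriv v (dirDeriv v (cutoff z₀)) z = -2 * ‖v‖ ^ 2 := by
  rw [dirDeriv_cutoff]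
  have h1 : HasFDerivAt (fun y : ℂ => y - z₀) (ContinuousLinearMap.id ℝ ℂ) z :=
    (hasFDerivAt_id z).sub_const z₀
  have h2 := ((h1.inner ℝ (hasFDerivAt_const v z)).const_mul (-2)).fderiv
  simp only [dirDeriv]
  rw [h2]
  simp

/-- Lower bound for the second directional derivatives of `|ζ W|²`, `ζ` being the cutoff. -/
theorem dirDeriv_dirDeriv_cutoff_smul {W : ℂ → ℂ} (hW : ContDiff ℝ (⊤ : ℕ∞) W) {z₀ z e : ℂ}
    (he : ‖e‖ = 1) (hz : ‖z - z₀‖ ≤ 1) :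
    cutoff z₀ z ^ 2 * (‖dirDeriv e W z‖ ^ 2 + 2 * inner ℝ (W z) (dirDeriv e (dirDeriv e W) z))
      - 60 * ‖W z‖ ^ 2 ≤
    dirDeriv e (dirDeriv e fun y => ‖cutoff z₀ y • W y‖ ^ 2) z := by
  have hζ := contDiff_cutoff z₀
  have hW' := hW.dirDeriv e
  have hζ' := hζ.dirDeriv e
  have hY : ContDiff ℝ (⊤ : ℕ∞) fun y => cutoff z₀ y • W y := hζ.smul hW
  rw [dirDeriv_dirDeriv_norm_sq hY, dirDeriv_smul hζ hW,
    dirDeriv_add (f := fun y => cutoff z₀ y • dirDeriv e W y)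
      (g := fun y => dirDeriv e (cutoff z₀) y • W y) (hζ.smul hW') (hζ'.smul hW), dirDeriv_smul hζ hW', dirDeriv_smul hζ' hW]
  simp only [dirDeriv_dirDeriv_cutoff, he]
  have ha : |dirDeriv e (cutoff z₀) z| ≤ 2 := by
    rw [dirDeriv_cutoff, abs_mul]
    have := abs_real_inner_le_norm (z - z₀) e
    rw [he] at this
    rw [abs_neg, abs_of_pos (zero_lt_two' ℝ)]
    linarith
  have ha2 : dirDeriv e (cutoff z₀) z ^ 2 ≤ 4 := by
    nlinarith [sq_abs (dirDeriv e (cutoff z₀) z), abs_nonneg (dirDeriv e (cutoff z₀) z)]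
  have hz1 : cutoff z₀ z ≤ 1 := by unfold cutoff; nlinarith [sq_nonneg ‖z - z₀‖]
  generalize dirDeriv e (cutoff z₀) z = a at *
  generalize cutoff z₀ z = ζ at *
  generalize W z = w at *
  generalize dirDeriv e W z = w' at *
  generalize dirDeriv e (dirDeriv e W) z = w'' at *
  have h1 : 0 ≤ ‖ζ • w' + (4 * a) • w‖ ^ 2 := by positivity
  have h2 : a ^ 2 * ‖w‖ ^ 2 ≤ 4 * ‖w‖ ^ 2 := by gcongr
  have h3 : ζ * ‖w‖ ^ 2 ≤ 1 * ‖w‖ ^ 2 := by gcongr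
  have hc := real_inner_comm w w'
  rw [norm_add_sq_real] at h1 ⊢
  simp only [norm_smul, inner_add_right, real_inner_smul_left, real_inner_smul_right,
    real_inner_self_eq_norm_sq, mul_pow, Real.norm_eq_abs, sq_abs, hc] at h1 ⊢
  nlinarith

/-- The maximum principle for `|ζ W|² + l |R|²` on the unit disc around `z₀`. -/
theorem exists_weighted_max {W R : ℂ → ℂ} (hW : ContDiff ℝ (⊤ : ℕ∞) W)
    (hR : ContDiff ℝ (⊤ : ℕ∞) R) (z₀ : ℂ) {l : ℝ} (hl : 0 ≤ l) :
    ∃ (z : ℂ) (t : ℝ), 0 ≤ t ∧ t ≤ 1 ∧ ‖W z₀‖ ^ 2 ≤ t ^ 2 * ‖W z‖ ^ 2 + l * ‖R z‖ ^ 2 ∧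
      (t = 0 ∨ t ^ 2 * (gradSq W z + 2 * inner ℝ (W z) (lap W z)) - 120 * ‖W z‖ ^ 2 +
        l * (2 * gradSq R z + 2 * inner ℝ (R z) (lap R z)) ≤ 0) := by
  have hY : ContDiff ℝ (⊤ : ℕ∞) fun y => cutoff z₀ y • W y := (contDiff_cutoff z₀).smul hW
  have hY2 := hY.norm_sq ℝ
  have hR2 := (hR.norm_sq ℝ).const_smul l
  have hφ := hY2.add hR2
  obtain ⟨z, hz, hmax⟩ := (isCompact_closedBall z₀ 1).exists_isMaxOn
    ⟨z₀, mem_closedBall_self zero_le_one⟩ hφ.continuous.continuousOn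
  have hz1 : ‖z - z₀‖ ≤ 1 := by simpa [dist_eq_norm] using hz
  refine ⟨z, cutoff z₀ z, by unfold cutoff; nlinarith [norm_nonneg (z - z₀)],
    by unfold cutoff; nlinarith [sq_nonneg ‖z - z₀‖], ?_, ?_⟩
  · have h := hmax (mem_closedBall_self (x := z₀) zero_le_one)
    have h0 : cutoff z₀ z₀ = 1 := by simp [cutoff]
    simp [mul_pow, h0] at h
    nlinarith [sq_nonneg ‖R z₀‖]
  · rcases hz1.lt_or_eq with hlt | heq
    · right
      have hloc := hmax.isLocalMax (closedBall_mem_nhds_of_mem (by simpa [dist_eq_norm] using hlt))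
      have key : ∀ e : ℂ, ‖e‖ = 1 → cutoff z₀ z ^ 2 * (‖dirDeriv e W z‖ ^ 2 +
          2 * inner ℝ (W z) (dirDeriv e (dirDeriv e W) z)) - 60 * ‖W z‖ ^ 2 +
          l * (2 * ‖dirDeriv e R z‖ ^ 2 + 2 * inner ℝ (R z) (dirDeriv e (dirDeriv e R) z)) ≤ 0 := by
        intro e he
        have h1 := dirDeriv_dirDeriv_nonpos hφ hloc e
        have hc : ∀ g : ℂ → ℝ, ContDiff ℝ (⊤ : ℕ∞) g →
            dirDeriv e (fun y => l • g y) = fun y => l • dirDeriv e g y := by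
          intro g hg
          ext y
          simp [dirDeriv, fderiv_const_mul (hg.differentiableAt_top y)]
        have hR1 := hR.norm_sq (n := (⊤ : ℕ∞)) ℝ
        rw [dirDeriv_add hY2 hR2, dirDeriv_add (hY2.dirDeriv e) (hR2.dirDeriv e),
          hc _ hR1, hc _ (hR1.dirDeriv e)] at h1
        simp only [dirDeriv_dirDeriv_norm_sq hR, smul_eq_mul] at h1
        linarith [dirDeriv_dirDeriv_cutoff_smul hW he hz1]
      have k1 := key 1 (by simp)
      have k2 := key Complex.I (by simp)
      have hlap : ∀ f : ℂ → ℂ, lap f z = dirDeriv 1 (dirDeriv 1 f) z +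
        dirDeriv Complex.I (dirDeriv Complex.I f) z := fun f => rfl
      have hgrad : ∀ f : ℂ → ℂ, gradSq f z = ‖dirDeriv 1 f z‖ ^ 2 +
        ‖dirDeriv Complex.I f z‖ ^ 2 := fun f => rfl
      simp only [hlap, hgrad, inner_add_right]
      linarith
    · left
      simp [cutoff, heq]

/-- Bernstein's estimate: an interior bound for `W` in terms of a bound for `R`, where `W` is
controlled by the gradient of `R`. -/
theorem exists_bernstein_bound {C M : ℝ} (hC : 0 ≤ C) (hM : 0 ≤ M) :
    ∃ B : ℝ, 0 ≤ B ∧ ∀ W R : ℂ → ℂ, ContDiff ℝ (⊤ : ℕ∞) W → ContDiff ℝ (⊤ : ℕ∞) R →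
      (∀ z, -gradSq W z - C * (‖W z‖ ^ 2 + 1) ≤ 2 * inner ℝ (W z) (lap W z)) →
      (∀ z, -gradSq R z - C * (‖R z‖ ^ 2 + 1) ≤ 2 * inner ℝ (R z) (lap R z)) →
      (∀ z, ‖W z‖ ^ 2 ≤ gradSq R z) → (∀ z, ‖R z‖ ^ 2 ≤ M) → ∀ z, ‖W z‖ ^ 2 ≤ B := by
  refine ⟨C + (121 + C) * (C * (M + 1)) + (121 + C) * M, by positivity, ?_⟩
  intro W R hW hR hWl hRl hWR hRM z₀
  obtain ⟨z, t, ht0, ht1, hle, hz⟩ := exists_weighted_max hW hR z₀ (l := 121 + C) (by positivity)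
  have hRz : (121 + C) * ‖R z‖ ^ 2 ≤ (121 + C) * M := by gcongr; exact hRM z
  have ht2 : t ^ 2 ≤ 1 := by nlinarith
  rcases hz with rfl | hz
  · have : 0 ≤ C + (121 + C) * (C * (M + 1)) := by positivity
    linarith
  · have h1 : t ^ 2 * (C * (‖W z‖ ^ 2 + 1)) ≤ 1 * (C * (‖W z‖ ^ 2 + 1)) := by gcongr
    have h2 : t ^ 2 * (-(C * (‖W z‖ ^ 2 + 1))) ≤
        t ^ 2 * (gradSq W z + 2 * inner ℝ (W z) (lap W z)) := by
      gcongr; linarith [hWl z]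
    have h3 : (121 + C) * (‖W z‖ ^ 2 - C * (M + 1)) ≤
        (121 + C) * (2 * gradSq R z + 2 * inner ℝ (R z) (lap R z)) := by
      gcongr
      have : C * (‖R z‖ ^ 2 + 1) ≤ C * (M + 1) := by gcongr; exact hRM z
      linarith [hRl z, hWR z]
    have h4 : t ^ 2 * ‖W z‖ ^ 2 ≤ 1 * ‖W z‖ ^ 2 := by gcongr
    linarith

/-- Differentiating the equation `Δ W + i c ∂₂ W + G = 0`. -/
theorem dirDeriv_equation {c : ℝ} {W G : ℂ → ℂ} (hW : ContDiff ℝ (⊤ : ℕ∞) W)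
    (hG : ContDiff ℝ (⊤ : ℕ∞) G) (h : ∀ z, lap W z + Complex.I * (c : ℂ) * pd2 W z + G z = 0)
    (v z : ℂ) :
    lap (dirDeriv v W) z + Complex.I * (c : ℂ) * pd2 (dirDeriv v W) z + dirDeriv v G z = 0 := by
  have h1 := (hW.dirDeriv 1).dirDeriv 1
  have h2 := (hW.dirDeriv Complex.I).dirDeriv Complex.I
  have h3 : ContDiff ℝ (⊤ : ℕ∞) fun z => Complex.I * (c : ℂ) * dirDeriv Complex.I W z :=
    contDiff_const.mul (hW.dirDeriv Complex.I)
  have h0 : (fun z => dirDeriv 1 (dirDeriv 1 W) z +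
      dirDeriv Complex.I (dirDeriv Complex.I W) z +
      Complex.I * (c : ℂ) * dirDeriv Complex.I W z + G z) = fun _ => 0 := funext h
  have hD := congrFun (congrArg (dirDeriv v) h0) z
  have hconst : ∀ a : ℂ, dirDeriv v (fun _ => a) = fun _ => 0 := fun a => by
    ext y; simp [dirDeriv]
  rw [dirDeriv_add ((h1.add h2).add h3) hG, dirDeriv_add (h1.add h2) h3, dirDeriv_add h1 h2,
    dirDeriv_mul contDiff_const (hW.dirDeriv Complex.I), hconst, hconst,
    dirDeriv_comm (hW.dirDeriv 1), dirDeriv_comm hW v 1,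
    dirDeriv_comm (hW.dirDeriv Complex.I), dirDeriv_comm hW v Complex.I] at hD
  simp only [zero_mul, add_zero] at hD
  exact hD

theorem inner_lap_lower_bound {c : ℝ} (hc : c ^ 2 ≤ 2) {W : ℂ → ℂ} {z g : ℂ}
    (h : lap W z + Complex.I * (c : ℂ) * pd2 W z + g = 0) :
    -gradSq W z - 2 * ‖W z‖ ^ 2 - 2 * inner ℝ (W z) g ≤ 2 * inner ℝ (W z) (lap W z) := by
  have h1 : lap W z = -(Complex.I * (c : ℂ) * pd2 W z) - g := by linear_combination h
  have h2 := real_inner_le_norm (W z) (Complex.I * (c : ℂ) * pd2 W z)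
  rw [norm_mul, norm_mul, Complex.norm_I, one_mul, Complex.norm_real, Real.norm_eq_abs] at h2
  rw [h1, inner_sub_right, inner_neg_right, gradSq]
  have h3 : c ^ 2 * ‖W z‖ ^ 2 ≤ 2 * ‖W z‖ ^ 2 := by gcongr
  nlinarith [sq_nonneg (‖pd2 W z‖ - |c| * ‖W z‖), sq_abs c, sq_nonneg ‖pd1 W z‖]

theorem inner_lap_lower_bound_of_norm_le {c a b C : ℝ} (hc : c ^ 2 ≤ 2) {W : ℂ → ℂ} {z g : ℂ}
    (h : lap W z + Complex.I * (c : ℂ) * pd2 W z + g = 0) (ha : 0 ≤ a) (hb : 0 ≤ b)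
    (hg : ‖g‖ ≤ a * ‖W z‖ + b) (hC : 2 * a + b + 2 ≤ C) :
    -gradSq W z - C * (‖W z‖ ^ 2 + 1) ≤ 2 * inner ℝ (W z) (lap W z) := by
  have h1 := inner_lap_lower_bound hc h
  have h2 := real_inner_le_norm (W z) g
  have h3 : ‖W z‖ * ‖g‖ ≤ ‖W z‖ * (a * ‖W z‖ + b) := by gcongr
  have h4 : b * (2 * ‖W z‖) ≤ b * (‖W z‖ ^ 2 + 1) := by
    gcongr; nlinarith [sq_nonneg (‖W z‖ - 1)]
  have h5 : (2 * a + b + 2) * (‖W z‖ ^ 2 + 1) ≤ C * (‖W z‖ ^ 2 + 1) := by gcongr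
  linarith

/-- The Keller–Osserman bound for `|U|²`. -/
theorem norm_sq_le_of_equation {c : ℝ} (hc : c ^ 2 ≤ 2) {U : ℂ → ℂ}
    (hU : ContDiff ℝ (⊤ : ℕ∞) U)
    (h : ∀ z, lap U z + Complex.I * (c : ℂ) * pd2 U z + U z * ((1 - ‖U z‖ ^ 2 : ℝ) : ℂ) = 0)
    (z₀ : ℂ) : ‖U z₀‖ ^ 2 ≤ 62 := by
  obtain ⟨z, t, ht0, ht1, hle, hz⟩ := exists_weighted_max hU hU z₀ le_rfl
  rcases hz with rfl | hz
  · linarith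
  have h1 := inner_lap_lower_bound hc (h z)
  have h2 : inner ℝ (U z) (U z * ((1 - ‖U z‖ ^ 2 : ℝ) : ℂ)) = (1 - ‖U z‖ ^ 2) * ‖U z‖ ^ 2 := by
    rw [mul_comm, ← Complex.real_smul, real_inner_smul_right, real_inner_self_eq_norm_sq]
  rw [h2] at h1
  have h3 : t ^ 2 * (-4 * ‖U z‖ ^ 2 + 2 * (‖U z‖ ^ 2) ^ 2) ≤
      t ^ 2 * (gradSq U z + 2 * inner ℝ (U z) (lap U z)) := by
    refine mul_le_mul_of_nonneg_left ?_ (sq_nonneg t)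
    linarith
  have ht2 : t ^ 2 * ‖U z‖ ^ 2 ≤ 1 * ‖U z‖ ^ 2 := by gcongr; nlinarith
  by_contra! hlt
  have hpos : 0 < ‖U z‖ ^ 2 := by nlinarith
  nlinarith

/-- The nonlinearity `U (1 - |U|²)`. -/
def nonlin (U : ℂ → ℂ) (z : ℂ) : ℂ := U z - U z * U z * (starRingEnd ℂ) (U z)

theorem nonlin_eq (U : ℂ → ℂ) (z : ℂ) : nonlin U z = U z * ((1 - ‖U z‖ ^ 2 : ℝ) : ℂ) := by
  push_cast
  rw [nonlin, mul_assoc, Complex.mul_conj, Complex.normSq_eq_norm_sq]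
  push_cast
  ring

theorem contDiff_nonlin {U : ℂ → ℂ} (hU : ContDiff ℝ (⊤ : ℕ∞) U) :
    ContDiff ℝ (⊤ : ℕ∞) (nonlin U) :=
  hU.sub ((hU.mul hU).mul hU.conj)

theorem dirDeriv_nonlin {U : ℂ → ℂ} (hU : ContDiff ℝ (⊤ : ℕ∞) U) (v : ℂ) :
    dirDeriv v (nonlin U) = fun z => dirDeriv v U z -
      (U z * U z * (starRingEnd ℂ) (dirDeriv v U z) +
        (U z * dirDeriv v U z + dirDeriv v U z * U z) * (starRingEnd ℂ) (U z)) := by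
  unfold nonlin
  rw [dirDeriv_sub hU ((hU.mul hU).mul hU.conj), dirDeriv_mul (hU.mul hU) hU.conj,
    dirDeriv_mul hU hU, dirDeriv_conj hU]

theorem dirDeriv_dirDeriv_nonlin {U : ℂ → ℂ} (hU : ContDiff ℝ (⊤ : ℕ∞) U) (v w z : ℂ) :
    dirDeriv w (dirDeriv v (nonlin U)) z = dirDeriv w (dirDeriv v U) z -
      ((U z * U z * (starRingEnd ℂ) (dirDeriv w (dirDeriv v U) z) +
        (U z * dirDeriv w U z + dirDeriv w U z * U z) * (starRingEnd ℂ) (dirDeriv v U z)) +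
       ((U z * dirDeriv v U z + dirDeriv v U z * U z) * (starRingEnd ℂ) (dirDeriv w U z) +
        ((U z * dirDeriv w (dirDeriv v U) z + dirDeriv w U z * dirDeriv v U z) +
          (dirDeriv v U z * dirDeriv w U z + dirDeriv w (dirDeriv v U) z * U z)) *
          (starRingEnd ℂ) (U z))) := by
  have hv := hU.dirDeriv v
  have h1 := (hU.mul hU).mul hv.conj
  have h2 := (hU.mul hv).add (hv.mul hU)
  have h3 := h2.mul hU.conj
  rw [dirDeriv_nonlin hU, dirDeriv_sub hv (h1.add h3), dirDeriv_add h1 h3,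
    dirDeriv_mul (hU.mul hU) hv.conj, dirDeriv_mul hU hU, dirDeriv_conj hv,
    dirDeriv_mul h2 hU.conj, dirDeriv_add (hU.mul hv) (hv.mul hU), dirDeriv_mul hU hv,
    dirDeriv_mul hv hU, dirDeriv_conj hU]

theorem norm_dirDeriv_nonlin_le {U : ℂ → ℂ} (hU : ContDiff ℝ (⊤ : ℕ∞) U) (v z : ℂ) :
    ‖dirDeriv v (nonlin U) z‖ ≤ (1 + 3 * ‖U z‖ ^ 2) * ‖dirDeriv v U z‖ := by
  rw [dirDeriv_nonlin hU]
  dsimp only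
  generalize U z = u
  generalize dirDeriv v U z = p
  have h1 := norm_sub_le p (u * u * (starRingEnd ℂ) p + (u * p + p * u) * (starRingEnd ℂ) u)
  have h2 := norm_add_le (u * u * (starRingEnd ℂ) p) ((u * p + p * u) * (starRingEnd ℂ) u)
  have h3 := mul_le_mul_of_nonneg_right (norm_add_le (u * p) (p * u)) (norm_nonneg u)
  simp only [norm_mul, RCLike.norm_conj] at h2 h3
  linarith

theorem norm_dirDeriv_dirDeriv_nonlin_le {U : ℂ → ℂ} (hU : ContDiff ℝ (⊤ : ℕ∞) U) (v w z : ℂ) :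
    ‖dirDeriv w (dirDeriv v (nonlin U)) z‖ ≤
      (1 + 3 * ‖U z‖ ^ 2) * ‖dirDeriv w (dirDeriv v U) z‖ +
        6 * ‖U z‖ * (‖dirDeriv v U z‖ * ‖dirDeriv w U z‖) := by
  rw [dirDeriv_dirDeriv_nonlin hU]
  generalize U z = u
  generalize dirDeriv w (dirDeriv v U) z = r
  generalize dirDeriv v U z = p
  generalize dirDeriv w U z = q
  refine (norm_sub_le _ _).trans ((add_le_add_right (norm_add_le _ _) _).trans ?_)
  have h1 := norm_add_le (u * u * (starRingEnd ℂ) r) ((u * q + q * u) * (starRingEnd ℂ) p)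
  have h2 := mul_le_mul_of_nonneg_right (norm_add_le (u * q) (q * u)) (norm_nonneg p)
  have h3 := norm_add_le ((u * p + p * u) * (starRingEnd ℂ) q)
    (((u * r + q * p) + (p * q + r * u)) * (starRingEnd ℂ) u)
  have h4 := mul_le_mul_of_nonneg_right (norm_add_le (u * p) (p * u)) (norm_nonneg q)
  have h5 := mul_le_mul_of_nonneg_right ((norm_add_le (u * r + q * p) (p * q + r * u)).trans
    (add_le_add (norm_add_le _ _) (norm_add_le _ _))) (norm_nonneg u)
  simp only [norm_mul, RCLike.norm_conj] at h1 h2 h3 h4 h5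
  linarith

theorem norm_clm_le_add {F : Type*} [NormedAddCommGroup F] [NormedSpace ℝ F] (L : ℂ →L[ℝ] F) :
    ‖L‖ ≤ ‖L 1‖ + ‖L Complex.I‖ := by
  refine L.opNorm_le_bound (by positivity) fun v => ?_
  have hv : L v = v.re • L 1 + v.im • L Complex.I := by
    rw [← map_smul, ← map_smul, ← map_add]
    congr 1
    apply Complex.ext <;> simp
  rw [hv]
  refine (norm_add_le _ _).trans ?_
  rw [norm_smul, norm_smul, Real.norm_eq_abs, Real.norm_eq_abs, add_mul, mul_comm |v.re|,
    mul_comm |v.im|]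
  gcongr
  · exact Complex.abs_re_le_norm v
  · exact Complex.abs_im_le_norm v

theorem dirDeriv_sq_le_gradSq {e : ℂ} (he : e = 1 ∨ e = Complex.I) (f : ℂ → ℂ) (z : ℂ) :
    ‖dirDeriv e f z‖ ^ 2 ≤ gradSq f z := by
  rcases he with rfl | rfl
  · exact le_add_of_nonneg_right (sq_nonneg ‖pd2 f z‖)
  · exact le_add_of_nonneg_left (sq_nonneg ‖pd1 f z‖)

/-- Uniform bounds for the first and second partial derivatives of solutions. -/
theorem exists_partial_derivative_bounds : ∃ B₁ B₂ : ℝ, 0 ≤ B₁ ∧ 0 ≤ B₂ ∧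
    ∀ (c : ℝ) (U : ℂ → ℂ), c ^ 2 ≤ 2 → ContDiff ℝ (⊤ : ℕ∞) U →
      (∀ z, lap U z + Complex.I * (c : ℂ) * pd2 U z + U z * ((1 - ‖U z‖ ^ 2 : ℝ) : ℂ) = 0) →
      ∀ v w : ℂ, v = 1 ∨ v = Complex.I → w = 1 ∨ w = Complex.I → ∀ z,
        ‖dirDeriv v U z‖ ^ 2 ≤ B₁ ∧ ‖dirDeriv w (dirDeriv v U) z‖ ^ 2 ≤ B₂ := by
  obtain ⟨B₁, hB₁, h₁⟩ := exists_bernstein_bound (C := 376) (M := 62) (by norm_num) (by norm_num)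
  obtain ⟨B₂, hB₂, h₂⟩ := exists_bernstein_bound (C := 376 + 48 * B₁) (M := B₁) (by positivity) hB₁
  refine ⟨B₁, B₂, hB₁, hB₂, ?_⟩
  intro c U hc hU h
  have hU2 := norm_sq_le_of_equation hc hU h
  have hU1 : ∀ z, ‖U z‖ ≤ 8 := fun z => by nlinarith [hU2 z, norm_nonneg (U z)]
  have hG := contDiff_nonlin hU
  have hN : ∀ z, lap U z + Complex.I * (c : ℂ) * pd2 U z + nonlin U z = 0 := fun z => by
    rw [nonlin_eq]; exact h z
  have hN1 := fun v => dirDeriv_equation hU hG hN v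
  have hN2 := fun v w => dirDeriv_equation (hU.dirDeriv v) (hG.dirDeriv v) (hN1 v) w
  have h187 : ∀ z, 1 + 3 * ‖U z‖ ^ 2 ≤ 187 := fun z => by linarith [hU2 z]
  have hl0 : ∀ z, -gradSq U z - 376 * (‖U z‖ ^ 2 + 1) ≤ 2 * inner ℝ (U z) (lap U z) := by
    intro z
    have h1 := inner_lap_lower_bound hc (h z)
    rw [mul_comm (U z), ← Complex.real_smul, real_inner_smul_right,
      real_inner_self_eq_norm_sq] at h1
    nlinarith [sq_nonneg ‖U z‖]
  have hl1 : ∀ C, 376 ≤ C → ∀ v z, -gradSq (dirDeriv v U) z -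
      C * (‖dirDeriv v U z‖ ^ 2 + 1) ≤
      2 * inner ℝ (dirDeriv v U z) (lap (dirDeriv v U) z) := by
    intro C hC v z
    refine inner_lap_lower_bound_of_norm_le (a := 187) (b := 0) hc (hN1 v z) (by norm_num) le_rfl
      ?_ (by linarith)
    rw [add_zero]
    refine (norm_dirDeriv_nonlin_le hU v z).trans ?_
    gcongr
    exact h187 z
  have hb1 : ∀ v, v = 1 ∨ v = Complex.I → ∀ z, ‖dirDeriv v U z‖ ^ 2 ≤ B₁ := fun v hv =>
    h₁ _ U (hU.dirDeriv v) hU (hl1 _ le_rfl v) hl0 (dirDeriv_sq_le_gradSq hv U) hU2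
  intro v w hv hw z
  refine ⟨hb1 v hv z, h₂ _ _ ((hU.dirDeriv v).dirDeriv w) (hU.dirDeriv v) (fun y => ?_)
    (hl1 _ (by linarith) v) (dirDeriv_sq_le_gradSq hw _) (hb1 v hv) z⟩
  refine inner_lap_lower_bound_of_norm_le (a := 187) (b := 48 * B₁) hc (hN2 v w y) (by norm_num)
    (by positivity) ?_ (by linarith)
  refine (norm_dirDeriv_dirDeriv_nonlin_le hU v w y).trans ?_
  have hprod : ‖dirDeriv v U y‖ * ‖dirDeriv w U y‖ ≤ B₁ := by
    nlinarith [sq_nonneg (‖dirDeriv v U y‖ - ‖dirDeriv w U y‖), hb1 v hv y, hb1 w hw y]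
  have h6 : 6 * ‖U y‖ ≤ 48 := by linarith [hU1 y]
  gcongr
  exact h187 y

/-- uniform gradient and Hessian bounds for travelling waves with
speeds in `[−√2, √2]`. -/
theorem uniform_gradient_bound :
    ∃ K : ℝ, 0 < K ∧ ∀ c : ℝ, c ∈ Set.Icc (-(Real.sqrt 2)) (Real.sqrt 2) →
      ∀ U : ℂ → ℂ, ContDiff ℝ (⊤ : ℕ∞) U →
        (∀ z : ℂ,
          lap U z + Complex.I * (c : ℂ) * pd2 U z + U z * ((1 - ‖U z‖ ^ 2 : ℝ) : ℂ) = 0) →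
        ∀ z w : ℂ, ‖fderiv ℝ U z‖ + ‖fderiv ℝ (fderiv ℝ U) w‖ ≤ K := by
  obtain ⟨B₁, B₂, hB₁, hB₂, hB⟩ := exists_partial_derivative_bounds
  refine ⟨2 * √B₁ + 4 * √B₂ + 1, by positivity, ?_⟩
  intro c hc U hU h z w
  have hc2 : c ^ 2 ≤ 2 := by
    have := sq_le_sq' hc.1 hc.2
    rwa [Real.sq_sqrt (by norm_num)] at this
  have hb := hB c U hc2 hU h
  have h1 : ∀ v : ℂ, v = 1 ∨ v = Complex.I → ‖fderiv ℝ U z v‖ ≤ √B₁ := fun v hv =>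
    Real.le_sqrt_of_sq_le (hb v v hv hv z).1
  have h2 : ∀ v e : ℂ, v = 1 ∨ v = Complex.I → e = 1 ∨ e = Complex.I →
      ‖fderiv ℝ (fderiv ℝ U) w e v‖ ≤ √B₂ := fun v e hv he => by
    rw [fderiv_fderiv_apply hU]
    exact Real.le_sqrt_of_sq_le (hb v e hv he w).2
  have h3 : ∀ e : ℂ, e = 1 ∨ e = Complex.I → ‖fderiv ℝ (fderiv ℝ U) w e‖ ≤ 2 * √B₂ :=
    fun e he => by
      linarith [norm_clm_le_add (fderiv ℝ (fderiv ℝ U) w e), h2 1 e (.inl rfl) he,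
        h2 Complex.I e (.inr rfl) he]
  linarith [norm_clm_le_add (fderiv ℝ U z), norm_clm_le_add (fderiv ℝ (fderiv ℝ U) w),
    h1 1 (.inl rfl), h1 Complex.I (.inr rfl), h3 1 (.inl rfl), h3 Complex.I (.inr rfl)]
end
end
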